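/- arXiv:1807.10963 — 4 statements merged into one kernel-verified Lean document; each statement's English description precedes it below -/
import Mathlib

section
/- Let A be a unital commutative Banach algebra over ℂ whose group of invertible elements is dense in A. Then the maximal ideal space of A (with the Gelfand topology) contains no subspace homeomorphic to the closed unit disc in ℝ². -/
/-- The closed unit disc in ℝ². -/
def ClosedUnitDisc : Set (EuclideanSpace ℝ (Fin 2)) := Metric.closedBall 0 1

section

open Complex Set Filter Topology

section PlaneTopology

variable {X : Type*} [TopologicalSpace X]

/-- Every nowhere vanishing continuous complex function on `X` has a continuous logarithm. -/
def HasContinuousLogs (X : Type*) [TopologicalSpace X] : Prop :=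
  ∀ h : C(X, ℂ), (∀ x, h x ≠ 0) → ∃ u : C(X, ℂ), ∀ x, exp (u x) = h x

theorem IsPreconnected.sub_eq_sub_of_exp_eq_mul_exp {S : Set X} (hS : IsPreconnected S)
    {u w : X → ℂ} (hu : ContinuousOn u S) (hw : ContinuousOn w S) (κ : ℂ)
    (h : ∀ x ∈ S, exp (u x) = κ * exp (w x)) {x y : X} (hx : x ∈ S) (hy : y ∈ S) :
    u x - u y = w x - w y := by
  have key : ∀ z ∈ S, exp (u z - w z) = κ := fun z hz ↦ by
    rw [exp_sub, h z hz, mul_div_cancel_right₀ _ (exp_ne_zero _)]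
  have := isCoveringMap_exp.constOn_of_comp hS (g := fun z ↦ u z - w z) (hu.sub hw)
    (fun a ha b hb ↦ Subtype.ext ((key a ha).trans (key b hb).symm)) hx hy
  linear_combination this

/-- A normal space with continuous logarithms is unicoherent. -/
theorem HasContinuousLogs.isPreconnected_inter [NormalSpace X] (hlog : HasContinuousLogs X)
    {A B : Set X} (hA : IsClosed A) (hB : IsClosed B) (hA' : IsPreconnected A)
    (hB' : IsPreconnected B) (hAB : A ∪ B = univ) : IsPreconnected (A ∩ B) := by
  classical
  rw [isPreconnected_closed_iff]
  rintro t t' ht ht' hcov ⟨p, ⟨hpA, hpB⟩, hpt⟩ ⟨q, ⟨hqA, hqB⟩, hqt⟩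
  by_contra hne
  rw [not_nonempty_iff_eq_empty] at hne
  have hdisj : Disjoint (A ∩ B ∩ t) (A ∩ B ∩ t') := by
    rw [Set.disjoint_left]
    rintro x ⟨hx, hxt⟩ ⟨-, hxt'⟩
    exact (hne ▸ (⟨hx, hxt, hxt'⟩ : x ∈ A ∩ B ∩ (t ∩ t')) : x ∈ (∅ : Set X))
  obtain ⟨θ, hθ0, hθ1, -⟩ := exists_continuous_zero_one_of_isClosed
    ((hA.inter hB).inter ht) ((hA.inter hB).inter ht') hdisj
  have hagree : ∀ x ∈ A ∩ B, exp (θ x * (Real.pi * I)) = exp (-(θ x * (Real.pi * I))) := by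
    intro x hx
    rcases hcov hx with h | h
    · simp [hθ0 ⟨hx, h⟩]
    · simp [hθ1 ⟨hx, h⟩, exp_neg, exp_pi_mul_I]
  let h : X → ℂ := fun x ↦ if x ∈ A then exp (θ x * (Real.pi * I))
    else exp (-(θ x * (Real.pi * I)))
  have hhA : ∀ x ∈ A, h x = exp (θ x * (Real.pi * I)) := fun x hx ↦ if_pos hx
  have hhB : ∀ x ∈ B, h x = exp (-(θ x * (Real.pi * I))) := fun x hx ↦ by
    by_cases hxA : x ∈ A
    · rw [hhA x hxA, hagree x ⟨hxA, hx⟩]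
    · exact if_neg hxA
  have hc1 : Continuous fun x ↦ (θ x : ℂ) * (Real.pi * I) := by fun_prop
  have hcont : Continuous h := by
    rw [← continuousOn_univ, ← hAB]
    exact ContinuousOn.union_of_isClosed
      ((continuous_exp.comp hc1).continuousOn.congr hhA)
      ((continuous_exp.comp hc1.neg).continuousOn.congr hhB) hA hB
  obtain ⟨u, hu⟩ := hlog ⟨h, hcont⟩ fun x ↦ by
    simp only [ContinuousMap.coe_mk, h]; split_ifs <;> exact exp_ne_zero _
  have e1 := hA'.sub_eq_sub_of_exp_eq_mul_exp u.continuous.continuousOn hc1.continuousOn 1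
    (fun x hx ↦ by rw [hu, one_mul]; exact hhA x hx) hpA hqA
  have e2 := hB'.sub_eq_sub_of_exp_eq_mul_exp u.continuous.continuousOn hc1.neg.continuousOn 1
    (fun x hx ↦ by rw [hu, one_mul]; exact hhB x hx) hpB hqB
  simp only [Pi.neg_apply] at e2
  rw [hθ0 ⟨⟨hpA, hpB⟩, hpt⟩, hθ1 ⟨⟨hqA, hqB⟩, hqt⟩] at e1 e2
  have : (2 : ℂ) * (Real.pi * I) = 0 := by
    simp only [Pi.zero_apply, Pi.one_apply, ofReal_zero, ofReal_one] at e1 e2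
    linear_combination e1 - e2
  simp [Real.pi_ne_zero, I_ne_zero] at this

theorem closure_connectedComponentIn_inter_subset (F : Set X) (x : X) :
    closure (connectedComponentIn F x) ∩ F ⊆ connectedComponentIn F x := by
  by_cases hx : x ∈ F
  · refine IsPreconnected.subset_connectedComponentIn ?_
      ⟨subset_closure (mem_connectedComponentIn hx), hx⟩ inter_subset_right
    exact isPreconnected_connectedComponentIn.subset_closure
      (fun y hy ↦ ⟨subset_closure hy, connectedComponentIn_subset _ _ hy⟩) inter_subset_left
  · simp [connectedComponentIn_eq_empty hx]

theorem isPreconnected_compl_connectedComponentIn_compl [PreconnectedSpace X]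
    [LocallyConnectedSpace X] {Y : Set X} (hYc : IsClosed Y) (hY : IsPreconnected Y)
    (hne : Y.Nonempty) (q : X) : IsPreconnected (connectedComponentIn Yᶜ q)ᶜ := by
  obtain ⟨x₀, hx₀⟩ := hne
  have hYV : Y ⊆ (connectedComponentIn Yᶜ q)ᶜ := fun x hx hx' ↦
    connectedComponentIn_subset _ _ hx' hx
  refine isPreconnected_of_forall x₀ fun y hy ↦ ?_
  by_cases hyY : y ∈ Y
  · exact ⟨Y, hYV, hx₀, hyY, hY⟩
  have hyW : y ∈ connectedComponentIn Yᶜ y := mem_connectedComponentIn hyY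
  have hmeet : (closure (connectedComponentIn Yᶜ y) ∩ Y).Nonempty := by
    by_contra hem
    have hsub : closure (connectedComponentIn Yᶜ y) ⊆ connectedComponentIn Yᶜ y := fun z hz ↦
      closure_connectedComponentIn_inter_subset _ _ ⟨hz, fun hzY ↦ hem ⟨z, hz, hzY⟩⟩
    have hclopen : IsClopen (connectedComponentIn Yᶜ y) :=
      ⟨isClosed_of_closure_subset hsub, hYc.isOpen_compl.connectedComponentIn⟩
    rcases isClopen_iff.1 hclopen with h | h
    · exact (h ▸ hyW : y ∈ (∅ : Set X))
    · exact connectedComponentIn_subset Yᶜ y (h ▸ mem_univ x₀) hx₀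
  refine ⟨closure (connectedComponentIn Yᶜ y) ∪ Y, union_subset ?_ hYV, Or.inr hx₀,
    Or.inl (subset_closure hyW),
    IsPreconnected.union' hmeet isPreconnected_connectedComponentIn.closure hY⟩
  refine closure_minimal (fun z hz hz' ↦ hy ?_)
    hYc.isOpen_compl.connectedComponentIn.isClosed_compl
  rwa [connectedComponentIn_eq hz', ← connectedComponentIn_eq hz]

/-- In a unicoherent space, a level set separating two points has a connected subset separating
them. -/
theorem HasContinuousLogs.exists_isPreconnected_level [NormalSpace X] [PreconnectedSpace X]
    [LocallyConnectedSpace X] (hlog : HasContinuousLogs X) {φ : X → ℝ} (hφ : Continuous φ)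
    {p q : X} {t : ℝ} (hp : φ p < t) (hq : t < φ q) :
    ∃ C : Set X, IsPreconnected C ∧ (∀ x ∈ C, φ x = t) ∧
      ∀ S : Set X, IsPreconnected S → p ∈ S → q ∈ S → (S ∩ C).Nonempty := by
  set U := connectedComponentIn {x | φ x < t} p with hU
  set V := connectedComponentIn (closure U)ᶜ q with hV
  have hUo : IsOpen U := (isOpen_lt hφ continuous_const).connectedComponentIn
  have hVo : IsOpen V := isClosed_closure.isOpen_compl.connectedComponentIn
  have hpU : p ∈ U := mem_connectedComponentIn hp
  have hUle : closure U ⊆ {x | φ x ≤ t} :=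
    closure_minimal (fun x hx ↦ le_of_lt (b := t) (connectedComponentIn_subset {x | φ x < t} p hx))
      (isClosed_le hφ continuous_const)
  have hqV : q ∈ V := mem_connectedComponentIn fun hq' ↦ (hUle hq').not_gt hq
  have hcov : closure V ∪ Vᶜ = univ :=
    eq_univ_of_forall fun x ↦ (em (x ∈ V)).imp (fun h ↦ subset_closure h) id
  have hVU : V ⊆ (closure U)ᶜ := connectedComponentIn_subset _ _
  refine ⟨closure V ∩ Vᶜ, hlog.isPreconnected_inter isClosed_closure hVo.isClosed_compl
    isPreconnected_connectedComponentIn.closure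
    (isPreconnected_compl_connectedComponentIn_compl isClosed_closure
      isPreconnected_connectedComponentIn.closure ⟨p, subset_closure hpU⟩ q) hcov, ?_, ?_⟩
  · rintro x ⟨hxV, hxV'⟩
    have hxU : x ∈ closure U := by
      by_contra h
      exact hxV' (closure_connectedComponentIn_inter_subset _ _ ⟨hxV, h⟩)
    refine (hUle hxU : φ x ≤ t).eq_of_not_lt fun hlt ↦ ?_
    have hxU' : x ∈ U := closure_connectedComponentIn_inter_subset _ _ ⟨hxU, hlt⟩
    obtain ⟨y, hyU, hyV⟩ := mem_closure_iff.1 hxV U hUo hxU'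
    exact hVU hyV (subset_closure hyU)
  · intro S hS hpS hqS
    exact isPreconnected_closed_iff.1 hS _ _ isClosed_closure hVo.isClosed_compl
      (hcov ▸ subset_univ S) ⟨q, hqS, subset_closure hqV⟩
      ⟨p, hpS, fun hpV ↦ hVU hpV (subset_closure hpU)⟩

/-- The Gaussian rationals, as a countable dense family of complex numbers. -/
def gaussianRat (r : ℚ × ℚ) : ℂ := ⟨r.1, r.2⟩

theorem denseRange_gaussianRat : DenseRange gaussianRat := by
  have h := (Rat.denseRange_cast (𝕜 := ℝ)).prodMap (Rat.denseRange_cast (𝕜 := ℝ))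
  exact equivRealProdCLM.symm.surjective.denseRange.comp h equivRealProdCLM.symm.continuous

theorem HasContinuousLogs.exists_isPreconnected_fiber [NormalSpace X] [PreconnectedSpace X]
    [LocallyConnectedSpace X] (hlog : HasContinuousLogs X) (f : C(X, ℂ))
    (hf : ∀ r x, f x ≠ gaussianRat r) {p q : X} {t : ℚ} (hp : (f p).re < t) (hq : t < (f q).re) :
    ∃ (C : Set X) (α : ℂ), IsPreconnected C ∧ α.re = t ∧ (∀ x ∈ C, f x = α) ∧
      ∀ S : Set X, IsPreconnected S → p ∈ S → q ∈ S → (S ∩ C).Nonempty := by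
  obtain ⟨C, hC, hCt, hCS⟩ := hlog.exists_isPreconnected_level
    (φ := fun x ↦ (f x).re) (by fun_prop) hp hq
  obtain ⟨z, -, hz⟩ := hCS univ isPreconnected_univ trivial trivial
  refine ⟨C, f z, hC, hCt z hz, ?_, hCS⟩
  have key : ∀ x ∈ C, ∀ y ∈ C, ¬ (f x).im < (f y).im := by
    intro x hx y hy hlt
    obtain ⟨s, hs1, hs2⟩ := exists_rat_btwn hlt
    obtain ⟨w, hw, hws⟩ := hC.intermediate_value hx hy (f := fun x ↦ (f x).im)
      (by fun_prop) ⟨hs1.le, hs2.le⟩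
    exact hf (t, s) w (Complex.ext (hCt w hw) hws)
  intro x hx
  exact Complex.ext ((hCt x hx).trans (hCt z hz).symm)
    (le_antisymm (not_lt.1 (key z hz x hx)) (not_lt.1 (key x hx z hz)))

theorem Complex.log_neg_of_im_pos {z : ℂ} (hz : 0 < z.im) : log (-z) = log z - Real.pi * I := by
  simp only [log, norm_neg, arg_neg_eq_arg_sub_pi_of_im_pos hz]
  push_cast; ring

theorem Complex.log_neg_of_im_neg {z : ℂ} (hz : z.im < 0) : log (-z) = log z + Real.pi * I := by
  simp only [log, norm_neg, arg_neg_eq_arg_add_pi_of_im_neg hz]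
  push_cast; ring

/-- Two functions `f`, `g` cannot both have level sets forming a combinatorial rectangle, if `g`
and `f + g` omit all integer translates of some value near the real axis. -/
theorem HasContinuousLogs.false_of_level_rectangle (hlog : HasContinuousLogs X)
    [PreconnectedSpace X] (f g : C(X, ℂ)) {ζ v : ℂ} {R M : ℝ}
    (hf : ∀ x, ‖f x‖ ≤ R) (hg : ∀ x, ‖g x‖ ≤ M) (hζ : R + 1 ≤ ζ.im) (hv : |v.im| < 1)
    (hgv : ∀ (k : ℤ) x, g x ≠ v + k) (hfgv : ∀ (k : ℤ) x, f x + g x ≠ v + k)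
    {C₀ C₁ D₀ D₁ : Set X} (hC₀ : IsPreconnected C₀) (hC₁ : IsPreconnected C₁)
    (hD₀ : IsPreconnected D₀) (hD₁ : IsPreconnected D₁)
    (hfC₀ : ∀ x ∈ C₀, f x = 0) (hfC₁ : ∀ x ∈ C₁, f x = 1)
    (hgD₀ : ∀ x ∈ D₀, g x = -ζ) (hgD₁ : ∀ x ∈ D₁, g x = ζ)
    (h₀₀ : (C₀ ∩ D₀).Nonempty) (h₀₁ : (C₀ ∩ D₁).Nonempty)
    (h₁₀ : (C₁ ∩ D₀).Nonempty) (h₁₁ : (C₁ ∩ D₁).Nonempty) : False := by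
  obtain ⟨a, haC, haD⟩ := h₀₀
  obtain ⟨b, hbC, hbD⟩ := h₀₁
  obtain ⟨c, hcC, hcD⟩ := h₁₀
  obtain ⟨d, hdC, hdD⟩ := h₁₁
  have hL : ∀ k : ℤ, ∃ u : C(X, ℂ), ∀ x, exp (u x) = g x - (v + k) := fun k ↦
    hlog ⟨fun x ↦ g x - (v + k), by fun_prop⟩ fun x ↦ sub_ne_zero.2 (hgv k x)
  have hH : ∀ k : ℤ, ∃ u : C(X, ℂ), ∀ x, exp (u x) = f x + g x - (v + k) := fun k ↦
    hlog ⟨fun x ↦ f x + g x - (v + k), by fun_prop⟩ fun x ↦ sub_ne_zero.2 (hfgv k x)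
  choose L hL using hL
  choose H hH using hH
  have hv' := abs_lt.1 hv
  have him : ∀ x, |(f x).im| ≤ R := fun x ↦ (abs_im_le_norm _).trans (hf x)
  have hR : 0 ≤ R := (norm_nonneg _).trans (hf a)
  let n : ℤ → ℂ := fun k ↦ L k b - L k a - log (ζ - (v + k)) + log (-ζ - (v + k))
  have hstep : ∀ k, n (k - 1) = n k := by
    intro k
    have hup : ∀ x, f x + ζ - (v + k) ∈ slitPlane := fun x ↦ by
      have := abs_le.1 (him x)
      refine Or.inr (ne_of_gt ?_)
      simp; linarith
    have hdown : ∀ x, f x - ζ - (v + k) ∈ slitPlane := fun x ↦ by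
      have := abs_le.1 (him x)
      refine Or.inr (ne_of_lt ?_)
      simp; linarith
    have e1 := hC₀.sub_eq_sub_of_exp_eq_mul_exp (H k).continuous.continuousOn
      (L k).continuous.continuousOn 1
      (fun x hx ↦ by rw [hH, hL, hfC₀ x hx]; ring) hbC haC
    have e2 := hC₁.sub_eq_sub_of_exp_eq_mul_exp (H k).continuous.continuousOn
      (L (k - 1)).continuous.continuousOn 1
      (fun x hx ↦ by rw [hH, hL, hfC₁ x hx]; push_cast; ring) hdC hcC
    have e3 := hD₁.sub_eq_sub_of_exp_eq_mul_exp (H k).continuous.continuousOn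
      (w := fun x ↦ log (f x + ζ - (v + k)))
      (Continuous.clog (by fun_prop) hup).continuousOn 1
      (fun x hx ↦ by rw [hH, exp_log (slitPlane_ne_zero (hup x)), hgD₁ x hx]; ring) hdD hbD
    have e4 := hD₀.sub_eq_sub_of_exp_eq_mul_exp (H k).continuous.continuousOn
      (w := fun x ↦ log (f x - ζ - (v + k)))
      (Continuous.clog (by fun_prop) hdown).continuousOn 1
      (fun x hx ↦ by rw [hH, exp_log (slitPlane_ne_zero (hdown x)), hgD₀ x hx]; ring) hcD haD
    have e5 := hD₁.sub_eq_sub_of_exp_eq_mul_exp (L (k - 1)).continuous.continuousOn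
      (w := fun _ ↦ 0) continuousOn_const (ζ - (v + (k - 1 : ℤ)))
      (fun x hx ↦ by rw [hL, hgD₁ x hx]; simp) hbD hdD
    have e6 := hD₀.sub_eq_sub_of_exp_eq_mul_exp (L (k - 1)).continuous.continuousOn
      (w := fun _ ↦ 0) continuousOn_const (-ζ - (v + (k - 1 : ℤ)))
      (fun x hx ↦ by rw [hL, hgD₀ x hx]; simp) haD hcD
    simp only [hfC₀ a haC, hfC₀ b hbC, hfC₁ c hcC, hfC₁ d hdC] at e3 e4
    have r1 : (1 : ℂ) + ζ - (v + k) = ζ - (v + (k - 1 : ℤ)) := by push_cast; ring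
    have r2 : (1 : ℂ) - ζ - (v + k) = -ζ - (v + (k - 1 : ℤ)) := by push_cast; ring
    rw [r1, zero_add] at e3
    rw [r2, zero_sub] at e4
    simp only [n]
    linear_combination e3 - e4 + e1 - e2 + e5 - e6
  have hconst : ∀ k : ℤ, n k = n 0 := by
    intro k
    induction k using Int.induction_on with
    | zero => rfl
    | succ i ih => rw [← ih, ← hstep (i + 1)]; simp
    | pred i ih => rw [hstep, ih]
  obtain ⟨N, hN⟩ := exists_nat_gt (M + |v.re|)
  have hv'' := abs_le.1 (le_refl |v.re|)
  have hre : ∀ x, |(g x).re| ≤ M := fun x ↦ (abs_re_le_norm _).trans (hg x)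
  have hneg : n (-N) = 0 := by
    have hs : ∀ x, g x - (v + (-N : ℤ)) ∈ slitPlane := fun x ↦ by
      have := abs_le.1 (hre x)
      refine Or.inl ?_
      simp; linarith
    have e := isPreconnected_univ.sub_eq_sub_of_exp_eq_mul_exp (L (-N)).continuous.continuousOn
      (w := fun x ↦ log (g x - (v + (-N : ℤ)))) (Continuous.clog (by fun_prop) hs).continuousOn 1
      (fun x _ ↦ by rw [hL, exp_log (slitPlane_ne_zero (hs x)), one_mul]) (mem_univ b) (mem_univ a)
    simp only [hgD₀ a haD, hgD₁ b hbD] at e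
    simp only [n]
    linear_combination e
  have hpos : n N = -(2 * (Real.pi * I)) := by
    have hs : ∀ x, -(g x - (v + (N : ℤ))) ∈ slitPlane := fun x ↦ by
      have := abs_le.1 (hre x)
      refine Or.inl ?_
      simp; linarith
    have e := isPreconnected_univ.sub_eq_sub_of_exp_eq_mul_exp (L N).continuous.continuousOn
      (w := fun x ↦ log (-(g x - (v + (N : ℤ))))) (Continuous.clog (by fun_prop) hs).continuousOn
      (-1) (fun x _ ↦ by rw [hL, exp_log (slitPlane_ne_zero (hs x))]; ring)
      (mem_univ b) (mem_univ a)
    simp only [hgD₀ a haD, hgD₁ b hbD] at e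
    rw [log_neg_of_im_pos (z := ζ - (v + (N : ℤ))) (by simp; linarith),
      log_neg_of_im_neg (z := -ζ - (v + (N : ℤ))) (by simp; linarith)] at e
    simp only [n]
    linear_combination e
  have : (2 : ℂ) * (Real.pi * I) = 0 := by
    have := (hconst N).trans (hconst (-N)).symm
    rw [hpos, hneg] at this
    linear_combination -this
  simp [Real.pi_ne_zero, I_ne_zero] at this

end PlaneTopology

section Disc

/-- The radial retraction of the plane onto the closed unit disc. -/
noncomputable def discRetraction (x : EuclideanSpace ℝ (Fin 2)) : ClosedUnitDisc :=
  ⟨(max 1 ‖x‖)⁻¹ • x, by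
    have h : 0 < max 1 ‖x‖ := lt_max_of_lt_left one_pos
    rw [ClosedUnitDisc, mem_closedBall_zero_iff, norm_smul, norm_inv, Real.norm_of_nonneg h.le,
      inv_mul_le_iff₀ h, mul_one]
    exact le_max_right _ _⟩

theorem continuous_discRetraction : Continuous discRetraction := by
  have h : Continuous fun x : EuclideanSpace ℝ (Fin 2) ↦ max 1 ‖x‖ := by fun_prop
  exact Continuous.subtype_mk
    ((h.inv₀ fun x ↦ (lt_max_of_lt_left one_pos).ne').smul continuous_id) _

theorem discRetraction_coe (x : ClosedUnitDisc) : discRetraction x = x := by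
  have h : ‖(x : EuclideanSpace ℝ (Fin 2))‖ ≤ 1 := mem_closedBall_zero_iff.1 x.2
  exact Subtype.ext (by simp [discRetraction, max_eq_left h])

instance : CompactSpace ClosedUnitDisc :=
  isCompact_iff_compactSpace.1 (isCompact_closedBall _ _)

instance : PreconnectedSpace ClosedUnitDisc :=
  Function.Surjective.denseRange (f := discRetraction) (fun x ↦ ⟨x, discRetraction_coe x⟩)
    |>.preconnectedSpace continuous_discRetraction

instance : LocallyConnectedSpace ClosedUnitDisc :=
  (IsQuotientMap.of_inverse continuous_subtype_val
    continuous_discRetraction discRetraction_coe).isCoinducing.locallyConnectedSpace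

theorem hasContinuousLogs_closedUnitDisc : HasContinuousLogs ClosedUnitDisc := by
  intro h hh
  obtain ⟨u, ⟨-, hu⟩, -⟩ := isCoveringMapOn_exp.existsUnique_continuousMap_lifts
    (h.comp ⟨discRetraction, continuous_discRetraction⟩) (a₀ := 0)
    (exp_log (hh (discRetraction 0))) (fun x ↦ hh _)
  refine ⟨u.comp ⟨Subtype.val, continuous_subtype_val⟩, fun x ↦ ?_⟩
  have := congrFun hu x
  simpa [discRetraction_coe] using this

/-- Two connected arcs in the disc that only share their end points. -/
theorem exists_arcs_closedUnitDisc : ∃ (p q : ClosedUnitDisc) (S T : Set ClosedUnitDisc),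
    p ≠ q ∧ IsPreconnected S ∧ IsPreconnected T ∧ IsClosed S ∧ IsClosed T ∧
      p ∈ S ∧ q ∈ S ∧ p ∈ T ∧ q ∈ T ∧ S ∩ T ⊆ {p, q} := by
  have : PreconnectedSpace (Icc (-1 : ℝ) 1) :=
    isPreconnected_iff_preconnectedSpace.1 isPreconnected_Icc
  let γ : ℝ → Icc (-1 : ℝ) 1 → ClosedUnitDisc := fun a x ↦
    discRetraction !₂[x, a * (1 - |(x : ℝ)|)]
  have hγ : ∀ a, Continuous (γ a) := fun a ↦ continuous_discRetraction.comp (by fun_prop)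
  have hval : ∀ a x, a = 0 ∨ a = 1 →
      (γ a x : EuclideanSpace ℝ (Fin 2)) = !₂[(x : ℝ), a * (1 - |(x : ℝ)|)] := by
    intro a x ha
    have hx := abs_le.2 x.2
    have : !₂[(x : ℝ), a * (1 - |(x : ℝ)|)] ∈ ClosedUnitDisc := by
      rw [ClosedUnitDisc, mem_closedBall_zero_iff, EuclideanSpace.norm_eq, Real.sqrt_le_one]
      simp only [Fin.sum_univ_two, Real.norm_eq_abs, sq_abs]
      have h0 := abs_nonneg (x : ℝ)
      have h1 := sq_abs (x : ℝ)
      rcases ha with rfl | rfl <;> simp <;> nlinarith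
    exact congrArg Subtype.val (discRetraction_coe ⟨_, this⟩)
  have hend : ∀ x : Icc (-1 : ℝ) 1, |(x : ℝ)| = 1 → γ 1 x = γ 0 x := fun x hx ↦
    Subtype.ext (by rw [hval 1 x (.inr rfl), hval 0 x (.inl rfl), hx]; simp)
  let l : Icc (-1 : ℝ) 1 := ⟨-1, by simp⟩
  let r : Icc (-1 : ℝ) 1 := ⟨1, by simp⟩
  refine ⟨γ 0 l, γ 0 r, range (γ 0), range (γ 1), fun h ↦ ?_, isPreconnected_range (hγ 0),
    isPreconnected_range (hγ 1), (isCompact_range (hγ 0)).isClosed,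
    (isCompact_range (hγ 1)).isClosed, ⟨l, rfl⟩, ⟨r, rfl⟩, ⟨l, hend l (by simp [l])⟩,
    ⟨r, hend r (by simp [r])⟩, ?_⟩
  · have h0 := congrArg (fun z : ClosedUnitDisc ↦ (z : EuclideanSpace ℝ (Fin 2)) 0) h
    simp only [hval 0 _ (.inl rfl)] at h0
    norm_num [l, r] at h0
  · rintro _ ⟨⟨x, rfl⟩, ⟨y, hxy⟩⟩
    have h1 := congrArg (fun z : ClosedUnitDisc ↦ (z : EuclideanSpace ℝ (Fin 2)) 0) hxy
    have h2 := congrArg (fun z : ClosedUnitDisc ↦ (z : EuclideanSpace ℝ (Fin 2)) 1) hxy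
    simp only [hval 0 _ (.inl rfl), hval 1 _ (.inr rfl)] at h1 h2
    simp at h1 h2
    obtain rfl := Subtype.ext h1
    rcases eq_or_eq_neg_of_abs_eq (show |(y : ℝ)| = 1 by linarith) with h | h
    · exact .inr (congrArg (γ 0) (Subtype.ext h))
    · exact .inl (congrArg (γ 0) (Subtype.ext h))

end Disc

section Genericity

theorem dense_setOf_forall_isUnit_smul_add {A : Type*} [NormedRing A] [NormedAlgebra ℂ A]
    [CompleteSpace A] (hd : Dense {a : A | IsUnit a}) {ι : Type*} [Countable ι] {c : ι → ℂ}
    (hc : ∀ i, c i ≠ 0) (b : ι → A) : Dense {a : A | ∀ i, IsUnit (c i • a + b i)} := by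
  rw [ofPred_forall]
  refine dense_iInter_of_isOpen (fun i ↦ ?_) fun i ↦ ?_
  · exact Units.isOpen.preimage (f := fun a : A ↦ c i • a + b i) (by fun_prop)
  · exact hd.preimage ((Homeomorph.smulOfNeZero (c i) (hc i)).trans
      (Homeomorph.addRight (b i))).isOpenMap

theorem dense_setOf_forall_affine_mem {ι : Type*} [Countable ι] {c : ι → ℂ} (hc : ∀ i, c i ≠ 0)
    (b : ι → ℂ) {O : ι → Set ℂ} (hO : ∀ i, IsOpen (O i)) (hO' : ∀ i, Dense (O i)) :
    Dense {z : ℂ | ∀ i, c i * z + b i ∈ O i} := by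
  rw [ofPred_forall]
  refine dense_iInter_of_isOpen (fun i ↦ ?_) fun i ↦ ?_
  · exact (hO i).preimage (f := fun z : ℂ ↦ c i * z + b i) (by fun_prop)
  · exact (hO' i).preimage ((Homeomorph.smulOfNeZero (c i) (hc i)).trans
      (Homeomorph.addRight (b i))).isOpenMap

theorem exists_re_lt_re_of_dense {A : Type*} [NormedCommRing A] [NormedAlgebra ℂ A] {G : Set A}
    (hG : Dense G) {φ ψ : WeakDual.characterSpace ℂ A} (h : φ ≠ ψ) :
    ∃ a ∈ G, (φ a).re < (ψ a).re := by
  obtain ⟨a, ha⟩ := DFunLike.ne_iff.1 h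
  refine hG.exists_mem_open (U := {a | (φ a).re < (ψ a).re}) ?_
    ⟨(starRingEnd ℂ (ψ a - φ a)) • a, ?_⟩
  · have hc : ∀ χ : WeakDual.characterSpace ℂ A, Continuous fun a ↦ (χ a).re := fun χ ↦
      continuous_re.comp (map_continuous χ)
    exact isOpen_lt (hc φ) (hc ψ)
  · have h1 : 0 < normSq (ψ a - φ a) := normSq_pos.2 (sub_ne_zero.2 ha.symm)
    have h2 := congrArg re (normSq_eq_conj_mul_self (z := ψ a - φ a))
    rw [mul_sub, sub_re, ofReal_re] at h2
    simp only [mem_ofPred_eq, map_smul, smul_eq_mul]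
    linarith

end Genericity

section Levels

variable {X : Type*} [TopologicalSpace X]

theorem isOpen_compl_range_of_compactSpace [CompactSpace X] (f : C(X, ℂ)) : IsOpen (range f)ᶜ :=
  (isCompact_range f.continuous).isClosed.isOpen_compl

theorem dense_compl_range_of_forall_ne_gaussianRat {f : C(X, ℂ)}
    (hf : ∀ r x, f x ≠ gaussianRat r) : Dense (range f)ᶜ := by
  refine Dense.mono ?_ denseRange_gaussianRat
  rintro _ ⟨r, rfl⟩ ⟨x, hx⟩
  exact hf r x hx

variable [CompactSpace X] [PreconnectedSpace X]

/-- Two distinct level sets of `f` cannot both connect two distinct level sets of `g`, if `g` and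
the pencil `f + c g` avoid all Gaussian rationals. -/
theorem HasContinuousLogs.false_of_transverse_levels (hlog : HasContinuousLogs X) (f g : C(X, ℂ))
    (hg : ∀ r x, g x ≠ gaussianRat r)
    (hfg : ∀ c, gaussianRat c ≠ 0 → ∀ r x, f x + gaussianRat c * g x ≠ gaussianRat r)
    {α β μ ν : ℂ} (hαβ : α ≠ β) (hμν : μ ≠ ν) {C₀ C₁ D₀ D₁ : Set X}
    (hC₀ : IsPreconnected C₀) (hC₁ : IsPreconnected C₁)
    (hD₀ : IsPreconnected D₀) (hD₁ : IsPreconnected D₁)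
    (hfC₀ : ∀ x ∈ C₀, f x = α) (hfC₁ : ∀ x ∈ C₁, f x = β)
    (hgD₀ : ∀ x ∈ D₀, g x = μ) (hgD₁ : ∀ x ∈ D₁, g x = ν)
    (h₀₀ : (C₀ ∩ D₀).Nonempty) (h₀₁ : (C₀ ∩ D₁).Nonempty)
    (h₁₀ : (C₁ ∩ D₀).Nonempty) (h₁₁ : (C₁ ∩ D₁).Nonempty) : False := by
  obtain ⟨δ, hδ⟩ : ∃ δ, δ = β - α := ⟨_, rfl⟩
  have hδ0 : δ ≠ 0 := hδ ▸ sub_ne_zero.2 hαβ.symm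
  obtain ⟨κ, hκ⟩ : ∃ κ, κ = (ν - μ) / (2 * δ) := ⟨_, rfl⟩
  have hκ0 : κ ≠ 0 := hκ ▸ div_ne_zero (sub_ne_zero.2 hμν.symm) (mul_ne_zero two_ne_zero hδ0)
  let F : C(X, ℂ) := ⟨fun x ↦ (f x - α) / δ, by fun_prop⟩
  obtain ⟨r, hr⟩ : ∃ r, ‖F‖ + 1 < (gaussianRat r * κ).im := by
    refine denseRange_gaussianRat.exists_mem_open (s := {c : ℂ | ‖F‖ + 1 < (c * κ).im})
      (isOpen_lt continuous_const (by fun_prop)) ⟨(‖F‖ + 2 : ℝ) * I / κ, ?_⟩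
    rw [mem_ofPred_eq, div_mul_cancel₀ _ hκ0, im_ofReal_mul, I_im]
    linarith
  obtain ⟨c, hc⟩ : ∃ c, c = gaussianRat r := ⟨_, rfl⟩
  have hc0 : c ≠ 0 := by
    rintro rfl
    rw [← hc, zero_mul, zero_im] at hr
    linarith [norm_nonneg F]
  obtain ⟨m, hm⟩ : ∃ m, m = (μ + ν) / 2 := ⟨_, rfl⟩
  let G : C(X, ℂ) := ⟨fun x ↦ c * (g x - m) / δ, by fun_prop⟩
  let H : C(X, ℂ) := ⟨fun x ↦ f x + c * g x, by fun_prop⟩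
  have hH : ∀ s x, H x ≠ gaussianRat s := fun s x ↦ by
    have := hfg r (hc ▸ hc0) s x
    rwa [← hc] at this
  have hdense := dense_setOf_forall_affine_mem (ι := ℤ × Bool)
    (c := fun i ↦ cond i.2 (δ / c) δ) (by
      rintro ⟨k, _ | _⟩
      · exact hδ0
      · exact div_ne_zero hδ0 hc0)
    (fun i ↦ cond i.2 (m + δ / c * i.1) (α + c * m + δ * i.1))
    (O := fun i ↦ cond i.2 (range g)ᶜ (range H)ᶜ)
    (by
      rintro ⟨k, _ | _⟩
      · exact isOpen_compl_range_of_compactSpace H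
      · exact isOpen_compl_range_of_compactSpace g)
    (by
      rintro ⟨k, _ | _⟩
      · exact dense_compl_range_of_forall_ne_gaussianRat hH
      · exact dense_compl_range_of_forall_ne_gaussianRat hg)
  obtain ⟨v, hv, hvim⟩ := hdense.exists_mem_open (U := {v : ℂ | |v.im| < 1})
    (isOpen_lt (by fun_prop) continuous_const) ⟨0, by simp⟩
  refine hlog.false_of_level_rectangle F G (ζ := c * κ) (v := v) F.norm_coe_le_norm
    G.norm_coe_le_norm (hc ▸ hr.le) hvim (fun k x hx ↦ hv (k, true) ⟨x, ?_⟩)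
    (fun k x hx ↦ hv (k, false) ⟨x, ?_⟩) hC₀ hC₁ hD₀ hD₁ (fun x hx ↦ ?_) (fun x hx ↦ ?_)
    (fun x hx ↦ ?_) (fun x hx ↦ ?_) h₀₀ h₀₁ h₁₀ h₁₁
  · change c * (g x - m) / δ = v + k at hx
    change g x = δ / c * v + (m + δ / c * k)
    field_simp at hx ⊢
    linear_combination hx
  · change (f x - α) / δ + c * (g x - m) / δ = v + k at hx
    change f x + c * g x = δ * v + (α + c * m + δ * k)
    field_simp at hx
    linear_combination hx
  · change (f x - α) / δ = 0
    rw [hfC₀ x hx, sub_self, zero_div]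
  · change (f x - α) / δ = 1
    rw [hfC₁ x hx, ← hδ, div_self hδ0]
  · change c * (g x - m) / δ = -(c * κ)
    rw [hgD₀ x hx, hκ, hm]
    field_simp
    ring
  · change c * (g x - m) / δ = c * κ
    rw [hgD₁ x hx, hκ, hm]
    field_simp
    ring

variable [T2Space X] [LocallyConnectedSpace X]

/-- The level sets of `f` that separate `p` from `q` accumulate at two distinct points. -/
theorem HasContinuousLogs.exists_accumulating_levels [FirstCountableTopology X]
    (hlog : HasContinuousLogs X)
    (f : C(X, ℂ)) (hf : ∀ r x, f x ≠ gaussianRat r) {p q : X} (hpq : (f p).re < (f q).re)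
    {S T : Set X} (hS : IsPreconnected S) (hT : IsPreconnected T) (hS' : IsClosed S)
    (hT' : IsClosed T) (hpS : p ∈ S) (hqS : q ∈ S) (hpT : p ∈ T) (hqT : q ∈ T)
    (hST : S ∩ T ⊆ {p, q}) :
    ∃ a b : X, a ≠ b ∧ ∀ U ∈ 𝓝 a, ∀ V ∈ 𝓝 b, ∃ (C₀ C₁ : Set X) (α β : ℂ), α ≠ β ∧
      IsPreconnected C₀ ∧ IsPreconnected C₁ ∧ (∀ x ∈ C₀, f x = α) ∧ (∀ x ∈ C₁, f x = β) ∧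
      (C₀ ∩ U).Nonempty ∧ (C₀ ∩ V).Nonempty ∧ (C₁ ∩ U).Nonempty ∧ (C₁ ∩ V).Nonempty := by
  obtain ⟨l, hpl, hlq⟩ := exists_rat_btwn hpq
  obtain ⟨u, hlu, huq⟩ := exists_rat_btwn hlq
  have hlu' : l < u := by exact_mod_cast hlu
  let t : ℕ → ℚ := fun n ↦ l + (u - l) / (n + 1)
  have hlt : ∀ n, l ≤ t n := fun n ↦
    le_add_of_nonneg_right (div_nonneg (sub_nonneg.2 hlu'.le) (by positivity))
  have htu : ∀ n, t n ≤ u := fun n ↦ by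
    have : (u - l) / (n + 1) ≤ u - l := div_le_self (sub_nonneg.2 hlu'.le) (by simp)
    change l + (u - l) / (n + 1) ≤ u
    linarith
  have ht : Function.Injective t := fun n m h ↦ by
    have h1 := add_left_cancel h
    rw [div_eq_div_iff (by positivity) (by positivity)] at h1
    exact_mod_cast (add_right_cancel (mul_left_cancel₀ (sub_pos.2 hlu').ne' h1)).symm
  have hlt' : ∀ n, (l : ℝ) ≤ t n := fun n ↦ by exact_mod_cast hlt n
  have htu' : ∀ n, (t n : ℝ) ≤ u := fun n ↦ by exact_mod_cast htu n
  choose C α hC hα hfC hsep using fun n ↦ hlog.exists_isPreconnected_fiber f hf (t := t n)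
    (hpl.trans_le (hlt' n)) ((htu' n).trans_lt huq)
  choose a ha using fun n ↦ hsep n S hS hpS hqS
  choose b hb using fun n ↦ hsep n T hT hpT hqT
  obtain ⟨⟨a', b'⟩, φ, hφ, hlim⟩ := CompactSpace.tendsto_subseq fun n ↦ (a n, b n)
  have hlima : Tendsto (a ∘ φ) atTop (𝓝 a') := (continuous_fst.tendsto _).comp hlim
  have hlimb : Tendsto (b ∘ φ) atTop (𝓝 b') := (continuous_snd.tendsto _).comp hlim
  refine ⟨a', b', ?_, fun U hU V hV ↦ ?_⟩
  · rintro rfl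
    have hre : Tendsto (fun n ↦ (f (a (φ n))).re) atTop (𝓝 (f a').re) :=
      ((continuous_re.comp f.continuous).tendsto a').comp hlima
    have hval : ∀ n, (f (a n)).re = t n := fun n ↦ by rw [hfC n _ (ha n).2, hα]
    have h1 : (l : ℝ) ≤ (f a').re := ge_of_tendsto' hre fun n ↦ (hval _).symm ▸ hlt' _
    have h2 : (f a').re ≤ u := le_of_tendsto' hre fun n ↦ (hval _).symm ▸ htu' _
    have haS : a' ∈ S := hS'.mem_of_tendsto hlima (.of_forall fun n ↦ (ha _).1)
    have haT : a' ∈ T := hT'.mem_of_tendsto hlimb (.of_forall fun n ↦ (hb _).1)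
    rcases hST ⟨haS, haT⟩ with rfl | rfl
    · exact hpl.not_ge h1
    · exact huq.not_ge h2
  · obtain ⟨n, hn⟩ := eventually_atTop.1
      ((hlima.eventually_mem hU).and (hlimb.eventually_mem hV))
    have hne : α (φ n) ≠ α (φ (n + 1)) := fun h ↦ by
      have h1 : (t (φ n) : ℝ) = t (φ (n + 1)) := by rw [← hα, ← hα, h]
      exact n.succ_ne_self (hφ.injective (ht (Rat.cast_injective h1))).symm
    exact ⟨_, _, _, _, hne, hC _, hC _, hfC _, hfC _, ⟨_, (ha _).2, (hn n le_rfl).1⟩,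
      ⟨_, (hb _).2, (hn n le_rfl).2⟩, ⟨_, (ha _).2, (hn _ n.le_succ).1⟩,
      ⟨_, (hb _).2, (hn _ n.le_succ).2⟩⟩

/-- A function separating two points has two distinct level sets, both of which meet every
connected set that comes close enough to the two points. -/
theorem HasContinuousLogs.exists_levels_inter_nonempty (hlog : HasContinuousLogs X)
    (g : C(X, ℂ)) (hg : ∀ r x, g x ≠ gaussianRat r) {a b : X} (hab : (g a).re < (g b).re) :
    ∃ U ∈ 𝓝 a, ∃ V ∈ 𝓝 b, ∃ (D₀ D₁ : Set X) (μ ν : ℂ), μ ≠ ν ∧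
      IsPreconnected D₀ ∧ IsPreconnected D₁ ∧ (∀ x ∈ D₀, g x = μ) ∧ (∀ x ∈ D₁, g x = ν) ∧
      ∀ C : Set X, IsPreconnected C → (C ∩ U).Nonempty → (C ∩ V).Nonempty →
        (C ∩ D₀).Nonempty ∧ (C ∩ D₁).Nonempty := by
  obtain ⟨l, hal, hlb⟩ := exists_rat_btwn hab
  obtain ⟨u, hlu, hub⟩ := exists_rat_btwn hlb
  obtain ⟨D₀, μ, hD₀, hμ, hgD₀, hsep₀⟩ := hlog.exists_isPreconnected_fiber g hg hal hlb
  obtain ⟨D₁, ν, hD₁, hν, hgD₁, hsep₁⟩ := hlog.exists_isPreconnected_fiber g hg (hal.trans hlu) hub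
  have hgc : Continuous fun x ↦ (g x).re := continuous_re.comp g.continuous
  obtain ⟨U, ⟨hU, haU, hUc⟩, hUl⟩ := (locallyConnectedSpace_iff_hasBasis_isOpen_isConnected.1
    inferInstance a).mem_iff.1 ((isOpen_lt hgc continuous_const).mem_nhds hal)
  obtain ⟨V, ⟨hV, hbV, hVc⟩, hVu⟩ := (locallyConnectedSpace_iff_hasBasis_isOpen_isConnected.1
    inferInstance b).mem_iff.1 ((isOpen_lt continuous_const hgc).mem_nhds hub)
  refine ⟨U, hU.mem_nhds haU, V, hV.mem_nhds hbV, D₀, D₁, μ, ν, ?_, hD₀, hD₁, hgD₀, hgD₁, ?_⟩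
  · rintro rfl
    exact hlu.ne (hμ.symm.trans hν)
  rintro C hC ⟨x, hxC, hxU⟩ ⟨y, hyC, hyV⟩
  have hconn : IsPreconnected (U ∪ C ∪ V) :=
    (hUc.isPreconnected.union x hxU hxC hC).union y (.inr hyC) hyV hVc.isPreconnected
  have key : ∀ (D : Set X) (η : ℂ), (∀ z ∈ D, g z = η) → (l : ℝ) ≤ η.re → η.re ≤ u →
      ((U ∪ C ∪ V) ∩ D).Nonempty → (C ∩ D).Nonempty := by
    rintro D η hD h1 h2 ⟨z, (hz | hz) | hz, hzD⟩
    · have : (g z).re < l := hUl hz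
      rw [hD z hzD] at this
      exact absurd this h1.not_gt
    · exact ⟨z, hz, hzD⟩
    · have : u < (g z).re := hVu hz
      rw [hD z hzD] at this
      exact absurd this h2.not_gt
  exact ⟨key D₀ μ hgD₀ hμ.ge (hμ ▸ hlu.le) (hsep₀ _ hconn (.inl (.inl haU)) (.inr hbV)),
    key D₁ ν hgD₁ (hν ▸ hlu.le) hν.le (hsep₁ _ hconn (.inl (.inl haU)) (.inr hbV))⟩

end Levels

/-- The Gelfand transform restricted along a map into the character space. -/
noncomputable def gelfandComp {X A : Type*} [TopologicalSpace X] [NormedCommRing A]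
    [NormedAlgebra ℂ A] (e : C(X, WeakDual.characterSpace ℂ A)) (a : A) : C(X, ℂ) :=
  ⟨fun x ↦ e x a, (WeakDual.eval_continuous a).comp (continuous_subtype_val.comp e.continuous)⟩

theorem gelfandComp_ne_of_isUnit_sub {X A : Type*} [TopologicalSpace X] [NormedCommRing A]
    [NormedAlgebra ℂ A] (e : C(X, WeakDual.characterSpace ℂ A)) {a : A} {z : ℂ}
    (h : IsUnit (a - algebraMap ℂ A z)) (x : X) : e x a ≠ z := fun hx ↦ by
  refine (h.map (e x)).ne_zero ?_
  rw [map_sub, AlgHomClass.commutes, hx]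
  exact sub_self z

theorem not_injective_of_dense_isUnit {A : Type*} [NormedCommRing A] [NormedAlgebra ℂ A]
    [CompleteSpace A] (hd : Dense {a : A | IsUnit a})
    (e : C(ClosedUnitDisc, WeakDual.characterSpace ℂ A)) : ¬ Function.Injective e := by
  intro he
  obtain ⟨p, q, S, T, hpq, hS, hT, hS', hT', hpS, hqS, hpT, hqT, hST⟩ :=
    exists_arcs_closedUnitDisc
  obtain ⟨f, hf, hfpq⟩ := exists_re_lt_re_of_dense (dense_setOf_forall_isUnit_smul_add hd
    (c := fun _ : ℚ × ℚ ↦ 1) (fun _ ↦ one_ne_zero) fun r ↦ -algebraMap ℂ A (gaussianRat r))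
    (he.ne hpq)
  obtain ⟨a, b, hab, hlev⟩ := hasContinuousLogs_closedUnitDisc.exists_accumulating_levels
    (gelfandComp e f) (fun r ↦ gelfandComp_ne_of_isUnit_sub e
      (by simpa [sub_eq_add_neg] using hf r))
    hfpq hS hT hS' hT' hpS hqS hpT hqT hST
  obtain ⟨g, hg, hgab⟩ := exists_re_lt_re_of_dense (dense_setOf_forall_isUnit_smul_add hd
    (ι := (ℚ × ℚ) ⊕ {c : ℚ × ℚ // gaussianRat c ≠ 0} × (ℚ × ℚ))
    (c := Sum.elim (fun _ ↦ 1) fun i ↦ gaussianRat i.1)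
    (by
      rintro (_ | i)
      · exact one_ne_zero
      · exact i.1.2)
    (Sum.elim (fun r ↦ -algebraMap ℂ A (gaussianRat r))
      fun i ↦ f - algebraMap ℂ A (gaussianRat i.2))) (he.ne hab)
  have hg' : ∀ r x, gelfandComp e g x ≠ gaussianRat r := fun r ↦
    gelfandComp_ne_of_isUnit_sub e (by simpa [sub_eq_add_neg] using hg (.inl r))
  obtain ⟨U, hU, V, hV, D₀, D₁, μ, ν, hμν, hD₀, hD₁, hgD₀, hgD₁, hmeet⟩ :=
    hasContinuousLogs_closedUnitDisc.exists_levels_inter_nonempty _ hg' hgab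
  obtain ⟨C₀, C₁, α, β, hαβ, hC₀, hC₁, hfC₀, hfC₁, hU₀, hV₀, hU₁, hV₁⟩ := hlev U hU V hV
  refine hasContinuousLogs_closedUnitDisc.false_of_transverse_levels _ _ hg' (fun c hc r x ↦ ?_)
    hαβ hμν hC₀ hC₁ hD₀ hD₁ hfC₀ hfC₁ hgD₀ hgD₁ (hmeet C₀ hC₀ hU₀ hV₀).1
    (hmeet C₀ hC₀ hU₀ hV₀).2 (hmeet C₁ hC₁ hU₁ hV₁).1 (hmeet C₁ hC₁ hU₁ hV₁).2
  have h := gelfandComp_ne_of_isUnit_sub e (a := f + gaussianRat c • g) (z := gaussianRat r)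
    (by
      have := hg (.inr (⟨c, hc⟩, r))
      rwa [Sum.elim_inr, Sum.elim_inr, ← add_sub_assoc, add_comm] at this) x
  rwa [map_add, map_smul] at h

end

/-- A unital commutative Banach algebra over ℂ with dense invertibles has a maximal ideal
space containing no subspace homeomorphic to the closed unit disc in ℝ². -/
theorem stmt_0 (A : Type*) [NormedCommRing A] [NormedAlgebra ℂ A] [CompleteSpace A]
    (hd : Dense {a : A | IsUnit a}) (E : Set (WeakDual.characterSpace ℂ A)) :
    ¬ Nonempty (↥E ≃ₜ ↥ClosedUnitDisc) := by
  rintro ⟨h⟩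
  exact not_injective_of_dense_isUnit hd
    ⟨fun x ↦ (h.symm x : WeakDual.characterSpace ℂ A), by fun_prop⟩
    (Subtype.val_injective.comp h.symm.injective)
end

section
/- Let A be a unital commutative Banach algebra over ℂ such that the set of units of A is dense in A and the set {a² : a ∈ A} of squares is dense in A. Then the maximal ideal space of A contains no compact, locally connected subspace of Lebesgue covering dimension ≥ 2. -/
/-- Lebesgue covering dimension of `X` is at most `n`: every open cover has an
open shrinking/refinement of order at most `n + 1`. -/
def CoveringDimLE (X : Type*) [TopologicalSpace X] (n : ℕ) : Prop :=
  ∀ (ι : Type) (U : ι → Set X), (∀ i, IsOpen (U i)) → (⋃ i, U i) = Set.univ →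
    ∃ V : ι → Set X, (∀ i, IsOpen (V i)) ∧ (⋃ i, V i) = Set.univ ∧
      (∀ i, V i ⊆ U i) ∧ ∀ x : X, {i | x ∈ V i}.Finite ∧ {i | x ∈ V i}.ncard ≤ n + 1

open Topology Filter Set Metric

theorem isCompact_closure_of_equicontinuousAt {X : Type*} [TopologicalSpace X] [CompactSpace X]
    {S : Set C(X, ℂ)} {R : ℝ} (hb : ∀ f ∈ S, ‖f‖ ≤ R)
    (he : ∀ x, ∀ ε > 0, ∀ᶠ y in 𝓝 x, ∀ f ∈ S, ‖f y - f x‖ < ε) : IsCompact (closure S) := by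
  let e := ContinuousMap.isometryEquivBoundedOfCompact X ℂ
  have h : IsCompact (closure (e '' S)) := by
    refine BoundedContinuousFunction.arzela_ascoli (closedBall 0 R)
      (isCompact_closedBall 0 R) _ ?_ ?_
    · rintro _ x ⟨f, hf, rfl⟩
      exact mem_closedBall_zero_iff.2 ((f.norm_coe_le_norm x).trans (hb f hf))
    · intro x
      rw [Metric.equicontinuousAt_iff_right]
      intro ε hε
      filter_upwards [he x ε hε] with y hy
      rintro ⟨_, f, hf, rfl⟩
      rw [dist_comm, dist_eq_norm]
      exact hy f hf
  rw [← e.toHomeomorph.isCompact_image, e.toHomeomorph.image_closure]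
  exact h

theorem exists_isPreconnected_subset {X : Type*} [TopologicalSpace X] [LocallyConnectedSpace X]
    {x : X} {W : Set X} (hW : W ∈ 𝓝 x) : ∃ U ⊆ W, IsOpen U ∧ x ∈ U ∧ IsPreconnected U := by
  obtain ⟨U, ⟨h1, h2, h3⟩, h4⟩ := (LocallyConnectedSpace.open_connected_basis x).mem_iff.1 hW
  exact ⟨U, h4, h1, h2, h3.isPreconnected⟩

theorem isCompact_preimage_sq {X : Type*} [TopologicalSpace X] [CompactSpace X] [T2Space X]
    [LocallyConnectedSpace X] {S : Set C(X, ℂ)} (hS : IsCompact S) :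
    IsCompact ((fun g : C(X, ℂ) => g ^ 2) ⁻¹' S) := by
  have hcl : IsClosed ((fun g : C(X, ℂ) => g ^ 2) ⁻¹' S) :=
    hS.isClosed.preimage (continuous_pow 2)
  rw [← hcl.closure_eq]
  obtain ⟨R, hR⟩ := hS.isBounded.exists_norm_le
  refine isCompact_closure_of_equicontinuousAt (R := R + 1) ?_ ?_
  · intro g hg
    have h1 : ‖g ^ 2‖ ≤ R := hR _ hg
    have h0 : 0 ≤ R := (norm_nonneg _).trans h1
    rw [ContinuousMap.norm_le _ (by linarith)]
    intro x
    have h2 := (ContinuousMap.norm_coe_le_norm (g ^ 2) x).trans h1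
    simp only [ContinuousMap.pow_apply, norm_pow] at h2
    nlinarith [norm_nonneg (g x)]
  · intro x ε hε
    have hequi : ∀ᶠ y in 𝓝 x, ∀ f ∈ S, ‖f y - f x‖ < (ε / 3) ^ 2 := by
      refine hS.eventually_forall_of_forall_eventually (P := fun y f => ‖f y - f x‖ < (ε / 3) ^ 2)
        fun f _ => ?_
      have hc : Continuous fun z : X × C(X, ℂ) => ‖z.2 z.1 - z.2 x‖ := by fun_prop
      refine hc.continuousAt.eventually_lt continuousAt_const ?_
      simpa using by positivity
    obtain ⟨U, hUW, hUo, hxU, hU⟩ := exists_isPreconnected_subset hequi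
    filter_upwards [hUo.mem_nhds hxU] with y hy g hg
    have key : ∀ z ∈ U, ‖g z - g x‖ < ε / 3 ∨ ‖g z + g x‖ < ε / 3 := by
      intro z hz
      have h := hUW hz (g ^ 2) hg
      simp only [ContinuousMap.pow_apply] at h
      rw [show g z ^ 2 - g x ^ 2 = (g z - g x) * (g z + g x) by ring, norm_mul] at h
      by_contra! hcon
      nlinarith [hcon.1, hcon.2]
    by_contra! hlt
    have hy2 : ‖g y + g x‖ < ε / 3 := (key y hy).resolve_left (by linarith)
    have hgx : ε / 3 ≤ ‖g x‖ := by
      have : ‖g y - g x‖ ≤ ‖g y + g x‖ + 2 * ‖g x‖ := by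
        calc ‖g y - g x‖ = ‖(g y + g x) - 2 * g x‖ := by ring_nf
          _ ≤ ‖g y + g x‖ + ‖2 * g x‖ := norm_sub_le _ _
          _ = _ := by simp
      linarith
    obtain ⟨z, -, hz1, hz2⟩ := hU {z | ‖g z - g x‖ < ε / 3} {z | ‖g z + g x‖ < ε / 3}
      (isOpen_lt (by fun_prop) (by fun_prop)) (isOpen_lt (by fun_prop) (by fun_prop))
      (fun z hz => key z hz) ⟨x, hxU, by simpa using by positivity⟩ ⟨y, hy, hy2⟩
    have : ‖2 * g x‖ ≤ ‖g z + g x‖ + ‖g z - g x‖ := by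
      calc ‖2 * g x‖ = ‖(g z + g x) - (g z - g x)‖ := by ring_nf
        _ ≤ _ := norm_sub_le _ _
    simp only [mem_ofPred_eq] at hz1 hz2
    rw [norm_mul, Complex.norm_two] at this
    linarith

theorem norm_sub_le_of_norm_sq_sub_le {X : Type*} [TopologicalSpace X] {W : Set X}
    (hW : IsPreconnected W) {g : X → ℂ} (hg : Continuous g) {x : X} (hx : x ∈ W) {η : ℝ}
    (hη : η < 1) (hgx : g x ≠ 0) (h : ∀ y ∈ W, ‖g y ^ 2 - g x ^ 2‖ ≤ η * ‖g x ^ 2‖) :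
    ∀ y ∈ W, ‖g y - g x‖ ≤ η * ‖g x‖ := by
  let ρ : X → ℂ := fun y => g y / g x
  have hρc : Continuous ρ := by fun_prop
  have hρ : ∀ y ∈ W, ‖ρ y ^ 2 - 1‖ ≤ η := by
    intro y hy
    have : ρ y ^ 2 - 1 = (g y ^ 2 - g x ^ 2) / g x ^ 2 := by simp only [ρ]; field_simp
    rw [this, norm_div, div_le_iff₀ (norm_pos_iff.2 (pow_ne_zero 2 hgx))]
    exact h y hy
  have hre : ∀ y ∈ W, (ρ y).re ≠ 0 := by
    intro y hy h0
    have h1 := (Complex.abs_re_le_norm _).trans (hρ y hy)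
    have h2 : (ρ y ^ 2 - 1).re = -(ρ y).im ^ 2 - 1 := by simp [sq, h0]
    rw [h2, abs_le] at h1
    nlinarith [sq_nonneg (ρ y).im]
  have hx1 : ρ x = 1 := div_self hgx
  intro y hy
  have hpos : 0 < (ρ y).re := by
    by_contra! hneg
    obtain ⟨z, hz, hz0⟩ := hW.intermediate_value hy hx
      (f := fun z => (ρ z).re) (by fun_prop) (show (0 : ℝ) ∈ _ from ⟨hneg, by simp [hx1]⟩)
    exact hre z hz hz0
  have h1 : 1 ≤ ‖ρ y + 1‖ := by
    refine le_trans ?_ (Complex.re_le_norm _)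
    simpa using hpos.le
  have h2 : ‖ρ y - 1‖ * ‖ρ y + 1‖ ≤ η := by
    rw [← norm_mul]
    convert hρ y hy using 2
    ring
  have h3 : ‖ρ y - 1‖ ≤ η := by nlinarith [norm_nonneg (ρ y - 1)]
  have h4 : g y - g x = (ρ y - 1) * g x := by simp only [ρ]; field_simp
  rw [h4, norm_mul]
  gcongr

theorem exists_mem_norm_sub_one_lt {X : Type*} [TopologicalSpace X] [CompactSpace X] [T2Space X]
    [LocallyConnectedSpace X] {B : Subalgebra ℂ C(X, ℂ)} (hsq : ∀ f ∈ B, ∃ g ∈ B, g ^ 2 = f)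
    {v : C(X, ℂ)} (hv : v ∈ B) {K : Set X} (hK : IsClosed K) (hvK : ∀ x ∈ K, v x ≠ 0)
    {ε : ℝ} (hε : 0 < ε) :
    ∃ u ∈ B, (∀ x, ‖u x‖ ≤ 1) ∧ (∀ x, v x = 0 → u x = 0) ∧ ∀ x ∈ K, ‖u x - 1‖ < ε := by
  wlog hv1 : ‖v‖ ≤ 1 generalizing v
  · push Not at hv1
    have hne : ((‖v‖⁻¹ : ℝ) : ℂ) ≠ 0 := by
      rw [Complex.ofReal_ne_zero]; exact inv_ne_zero (by linarith)
    obtain ⟨u, hu, h1, h2, h3⟩ := this (v := ((‖v‖⁻¹ : ℝ) : ℂ) • v) (B.smul_mem hv _)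
      (fun x hx => by
        simpa only [ContinuousMap.smul_apply, smul_eq_mul] using mul_ne_zero hne (hvK x hx))
      (by rw [norm_smul, Complex.norm_real, norm_inv, norm_norm, inv_mul_cancel₀ (by linarith)])
    exact ⟨u, hu, h1, fun x hx => h2 x (by simp [hx]), h3⟩
  have : CompactSpace K := isCompact_iff_compactSpace.1 hK.isCompact
  choose! q hqB hq using hsq
  let r : ℕ → C(X, ℂ) := fun n => q^[n] v
  have hrB : ∀ n, r n ∈ B := by
    intro n
    induction n with
    | zero => exact hv
    | succ n ih => simp only [r, Function.iterate_succ_apply']; exact hqB _ ih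
  have hr : ∀ n, r (n + 1) ^ 2 = r n := by
    intro n
    simp only [r, Function.iterate_succ_apply']
    exact hq _ (hrB n)
  have hrx : ∀ n x, r (n + 1) x ^ 2 = r n x := fun n x => by
    rw [← ContinuousMap.pow_apply, hr]
  have hrpow : ∀ n m x, r (n + m) x ^ 2 ^ m = r n x := by
    intro n m x
    induction m with
    | zero => simp
    | succ m ih => rw [pow_succ', pow_mul, ← add_assoc, hrx, ih]
  have hrle : ∀ n x, ‖r n x‖ ≤ 1 := by
    intro n x
    induction n with
    | zero => exact (v.norm_coe_le_norm x).trans hv1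
    | succ n ih =>
      rw [← hrx, norm_pow] at ih
      exact (pow_le_one_iff_of_nonneg (norm_nonneg _) two_ne_zero).1 ih
  have hrge : ∀ n x, ‖v x‖ ≤ ‖r n x‖ := by
    intro n x
    have h := hrpow 0 n x
    rw [zero_add] at h
    change _ = v x at h
    rw [← h, norm_pow]
    exact pow_le_of_le_one (norm_nonneg _) (hrle n x) (by positivity)
  have hcpt : IsCompact (closure (range fun n => (r n).restrict K)) := by
    refine isCompact_closure_of_equicontinuousAt (R := 1) ?_ ?_
    · rintro _ ⟨n, rfl⟩
      rw [ContinuousMap.norm_le _ zero_le_one]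
      exact fun x => hrle n x
    · rintro ⟨x, hx⟩ δ hδ
      have hvx := hvK x hx
      let η := min (δ / 2) (1 / 2)
      have hη : 0 < η := by positivity
      have hη1 : η < 1 := lt_of_le_of_lt (min_le_right _ _) (by norm_num)
      have hηδ : η < δ := lt_of_le_of_lt (min_le_left _ _) (by linarith)
      have hW : ∀ᶠ y in 𝓝 x, ‖v y - v x‖ < η * ‖v x‖ := by
        have hc : Continuous fun y => ‖v y - v x‖ := by fun_prop
        refine hc.continuousAt.eventually_lt continuousAt_const ?_
        simpa using by positivity
      obtain ⟨U, hUW, hUo, hxU, hU⟩ := exists_isPreconnected_subset hW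
      have key : ∀ n, ∀ y ∈ U, ‖r n y - r n x‖ ≤ η * ‖r n x‖ := by
        intro n
        induction n with
        | zero => exact fun y hy => (hUW hy).le
        | succ n ih =>
          refine norm_sub_le_of_norm_sq_sub_le hU (r (n + 1)).continuous hxU hη1 ?_ ?_
          · exact norm_pos_iff.1 ((norm_pos_iff.2 hvx).trans_le (hrge _ _))
          · simpa only [hrx] using ih
      have hmem : ∀ᶠ y : K in 𝓝 ⟨x, hx⟩, (y : X) ∈ U :=
        continuous_subtype_val.continuousAt.eventually (hUo.mem_nhds hxU)
      filter_upwards [hmem] with y hy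
      rintro _ ⟨n, rfl⟩
      refine ((key n y hy).trans ?_).trans_lt hηδ
      exact mul_le_of_le_one_right hη.le (hrle n x)
  obtain ⟨δ, hδ, hδv⟩ : ∃ δ > 0, ∀ x ∈ K, δ ≤ ‖v x‖ := by
    rcases K.eq_empty_or_nonempty with rfl | hne
    · exact ⟨1, one_pos, by simp⟩
    · obtain ⟨x, hx, hmin⟩ := hK.isCompact.exists_isMinOn hne
        (f := fun x => ‖v x‖) (by fun_prop)
      exact ⟨‖v x‖, norm_pos_iff.2 (hvK x hx), fun y hy => hmin hy⟩
  obtain ⟨_, -, φ, hφ, hlim⟩ := hcpt.tendsto_subseq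
    (x := fun n => (r n).restrict K) fun n => subset_closure ⟨n, rfl⟩
  obtain ⟨N, hN⟩ := Metric.cauchySeq_iff'.1 hlim.cauchySeq (ε * δ) (by positivity)
  obtain ⟨m, hm⟩ := Nat.exists_eq_add_of_lt (hφ N.lt_succ_self)
  have hclose : ∀ x ∈ K, ‖r (φ N + (m + 1)) x - r (φ N) x‖ < ε * δ := by
    intro x hx
    have h := hN (N + 1) (Nat.le_succ N)
    rw [dist_eq_norm] at h
    refine lt_of_le_of_lt ?_ h
    have := ContinuousMap.norm_coe_le_norm
      ((r (φ (N + 1))).restrict K - (r (φ N)).restrict K) ⟨x, hx⟩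
    rw [Nat.succ_eq_add_one, add_assoc] at hm
    rw [← hm]
    exact this
  set s := r (φ N + (m + 1)) with hs
  have hs1 : ∀ x, s x ^ (2 ^ (m + 1) - 1) * s x = r (φ N) x := by
    intro x
    rw [← pow_succ, Nat.sub_add_cancel Nat.one_le_two_pow, hrpow]
  refine ⟨s ^ (2 ^ (m + 1) - 1), B.pow_mem (hrB _) _, fun x => ?_, fun x hx => ?_, fun x hx => ?_⟩
  · rw [ContinuousMap.pow_apply, norm_pow]
    exact pow_le_one₀ (norm_nonneg _) (hrle _ x)
  · have h := hrpow 0 (φ N + (m + 1)) x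
    rw [zero_add] at h
    have h0 : s x = 0 := by
      have : s x ^ 2 ^ (φ N + (m + 1)) = 0 := h.trans hx
      exact pow_eq_zero_iff (by positivity) |>.1 this
    rw [ContinuousMap.pow_apply, h0, zero_pow]
    have : 2 ≤ 2 ^ (m + 1) := by rw [pow_succ]; have := Nat.one_le_two_pow (n := m); omega
    omega
  · have h1 := hclose x hx
    rw [← hs1 x, ContinuousMap.pow_apply,
      show s x - s x ^ (2 ^ (m + 1) - 1) * s x = -((s x ^ (2 ^ (m + 1) - 1) - 1) * s x) by ring,
      norm_neg, norm_mul] at *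
    have h2 : δ ≤ ‖s x‖ := (hδv x hx).trans (hrge _ x)
    by_contra! h3
    nlinarith [mul_le_mul h3 h2 hδ.le (norm_nonneg _)]

theorem not_exists_continuous_sq_eq_neg {p : sphere (0 : ℂ) (1 / 2) → ℂ} (hp : Continuous p)
    (h : ∀ z, p z ^ 2 = -(z : ℂ)) : False := by
  let c : ℝ → sphere (0 : ℂ) (1 / 2) := fun t =>
    ⟨1 / 2 * Complex.exp (t * Complex.I), by simp [Complex.norm_exp]⟩
  have hc : Continuous c := by
    refine Continuous.subtype_mk ?_ _
    fun_prop
  let γ : ℝ → ℂ := fun t => p (c t) / Complex.exp (t / 2 * Complex.I)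
  have hγ : Continuous γ := (hp.comp hc).div (by fun_prop) fun t => Complex.exp_ne_zero _
  have hsq : ∀ t, γ t ^ 2 = -(1 / 2) := by
    intro t
    simp only [γ, div_pow, h, c]
    rw [← Complex.exp_nat_mul, neg_div, mul_div_assoc,
      show ((2 : ℕ) : ℂ) * (t / 2 * Complex.I) = t * Complex.I by push_cast; ring,
      div_self (Complex.exp_ne_zero _), mul_one]
  have hne : ∀ t, γ t ≠ 0 := fun t h0 => by
    have := hsq t
    norm_num [h0] at this
  have heq : EqOn γ (fun _ => γ 0) univ :=
    isPreconnected_univ.eq_of_sq_eq hγ.continuousOn continuousOn_const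
      (fun t _ => by simp [hsq]) (fun _ => hne 0) (mem_univ 0) rfl
  have h2 := heq (mem_univ (2 * Real.pi))
  have hc2 : c (2 * Real.pi) = c 0 := by
    apply Subtype.ext
    simp [c, Complex.exp_two_pi_mul_I]
  have hγ2 : γ (2 * Real.pi) = -γ 0 := by
    simp only [γ, hc2]
    push_cast
    rw [show (2 * (Real.pi : ℂ) / 2 * Complex.I) = Real.pi * Complex.I by ring,
      Complex.exp_pi_mul_I]
    simp [div_neg]
  simp only [hγ2] at h2
  exact hne 0 (self_eq_neg.1 h2.symm)

theorem exists_mem_eventually_eq_zero {X : Type*} [TopologicalSpace X] [CompactSpace X]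
    [T2Space X] [LocallyConnectedSpace X] {B : Subalgebra ℂ C(X, ℂ)}
    (hB : IsClosed (B : Set C(X, ℂ))) (hsep : B.SeparatesPoints)
    (hsq : ∀ f ∈ B, ∃ g ∈ B, g ^ 2 = f) {x x₀ : X} (hx : x ≠ x₀) :
    ∃ k ∈ B, k x ≠ 0 ∧ ∀ᶠ y in 𝓝 x₀, k y = 0 := by
  by_contra! hneg
  obtain ⟨f, hfB, hf0, hf1⟩ : ∃ f ∈ B, f x₀ = 0 ∧ f x = 1 := by
    obtain ⟨_, ⟨f, hf, rfl⟩, hne⟩ := hsep hx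
    have hne' : f x - f x₀ ≠ 0 := sub_ne_zero.2 hne
    refine ⟨(f x - f x₀)⁻¹ • (f - algebraMap ℂ _ (f x₀)),
      B.smul_mem (B.sub_mem hf (B.algebraMap_mem _)) _, ?_, ?_⟩
    · simp
    · simp [hne']
  let L : ℂ → C(X, ℂ) := fun z => f - algebraMap ℂ _ z
  have hL : Continuous L := continuous_const.sub (algebraMapCLM ℂ C(X, ℂ)).continuous
  have hLB : ∀ z, L z ∈ B := fun z => B.sub_mem hfB (B.algebraMap_mem _)
  have hL0 : ∀ z, L z x₀ = -z := fun z => by simp [L, hf0]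
  have hL1 : ∀ z, L z x = 1 - z := fun z => by simp [L, hf1]
  let Λ := sphere (0 : ℂ) (1 / 2)
  have hΛ0 : ∀ z : Λ, (z : ℂ) ≠ 0 := fun z => ne_of_mem_sphere z.2 (by norm_num)
  have hΛ1 : ∀ z : Λ, 1 - (z : ℂ) ∈ Complex.slitPlane := fun z => by
    refine Or.inl ?_
    have h := Complex.re_le_norm (z : ℂ)
    rw [mem_sphere_zero_iff_norm.1 z.2] at h
    simp only [Complex.sub_re, Complex.one_re]
    linarith
  let T : Set C(X, ℂ) := (B : Set C(X, ℂ)) ∩ (fun g => g ^ 2) ⁻¹' (L '' Λ)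
  have hT : IsCompact T := by
    refine IsCompact.inter_left ?_ hB
    exact isCompact_preimage_sq ((isCompact_sphere _ _).image hL)
  have : CompactSpace T := isCompact_iff_compactSpace.1 hT
  have hTL : ∀ g : T, ∀ z, (g : C(X, ℂ)) ^ 2 = L z →
      (g : C(X, ℂ)) x₀ ^ 2 = -z ∧ (g : C(X, ℂ)) x ^ 2 = 1 - z := fun g z h => by
    rw [← hL0, ← hL1, ← h]
    simp
  let π : T → Λ := fun g => ⟨-((g : C(X, ℂ)) x₀ ^ 2), by
    obtain ⟨z, hz, hzg⟩ := g.2.2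
    rw [(hTL g z hzg.symm).1, neg_neg]
    exact hz⟩
  have hπL : ∀ g : T, (g : C(X, ℂ)) ^ 2 = L (π g) := fun g => by
    obtain ⟨z, hz, hzg⟩ := g.2.2
    simp only [π]
    rw [(hTL g z hzg.symm).1, neg_neg]
    exact hzg.symm
  have hπ : Continuous π := by
    refine Continuous.subtype_mk ?_ _
    fun_prop
  have hπs : Function.Surjective π := by
    intro z
    obtain ⟨g, hgB, hg⟩ := hsq (L z) (hLB z)
    refine ⟨⟨g, hgB, z, z.2, hg.symm⟩, Subtype.ext ?_⟩
    have := (hTL ⟨g, hgB, z, z.2, hg.symm⟩ z hg).1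
    simp only [π]
    rw [this, neg_neg]
  have hq : IsQuotientMap π := hπ.isClosedMap.isQuotientMap hπ hπs
  have hx₀ne : ∀ g : T, (g : C(X, ℂ)) x₀ ≠ 0 := fun g h0 => by
    have := (hTL g _ (hπL g)).1
    rw [h0, zero_pow two_ne_zero] at this
    exact hΛ0 (π g) (neg_eq_zero.1 this.symm)
  let ρ : T → ℂ := fun g => (g : C(X, ℂ)) x / (g : C(X, ℂ)) x₀
  have hρ : Continuous ρ := by
    refine Continuous.div ?_ ?_ hx₀ne <;> fun_prop
  have hxne : ∀ g : T, (g : C(X, ℂ)) x ≠ 0 := fun g h0 => by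
    have := (hTL g _ (hπL g)).2
    rw [h0, zero_pow two_ne_zero] at this
    exact Complex.slitPlane_ne_zero (hΛ1 (π g)) this.symm
  have key : ∀ g h : T, π g = π h → (g : C(X, ℂ)) x = (h : C(X, ℂ)) x →
      (g : C(X, ℂ)) x₀ = (h : C(X, ℂ)) x₀ := by
    intro g h hgh hgx
    have hsqeq : (g : C(X, ℂ)) ^ 2 = (h : C(X, ℂ)) ^ 2 := by rw [hπL, hπL, hgh]
    have hfac : ∀ y, ((g : C(X, ℂ)) y - (h : C(X, ℂ)) y) *
        ((g : C(X, ℂ)) y + (h : C(X, ℂ)) y) = 0 := by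
      intro y
      have := DFunLike.congr_fun hsqeq y
      simp only [ContinuousMap.pow_apply] at this
      linear_combination this
    by_contra hne
    have hev : ∀ᶠ y in 𝓝 x₀, (g : C(X, ℂ)) y - (h : C(X, ℂ)) y ≠ 0 := by
      refine ContinuousAt.eventually_ne ?_ (sub_ne_zero.2 hne)
      fun_prop
    refine hneg ((g : C(X, ℂ)) + h) (B.add_mem g.2.1 h.2.1) ?_ ?_
    · rw [ContinuousMap.add_apply, hgx, ← two_mul]
      exact mul_ne_zero two_ne_zero (hxne h)
    · filter_upwards [hev] with y hy
      exact not_not.2 ((mul_eq_zero.1 (hfac y)).resolve_left hy)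
  have hρπ : ∀ g h : T, π g = π h → ρ g = ρ h := by
    intro g h hgh
    have h1 : (g : C(X, ℂ)) x ^ 2 = (h : C(X, ℂ)) x ^ 2 := by
      rw [(hTL g _ (hπL g)).2, (hTL h _ (hπL h)).2, hgh]
    rcases sq_eq_sq_iff_eq_or_eq_neg.1 h1 with h2 | h2
    · simp only [ρ]
      rw [h2, key g h hgh h2]
    · let h' : T := ⟨-h, B.neg_mem h.2.1, by
        have := h.2.2
        simpa only [mem_preimage, neg_sq] using this⟩
      have h3 : π g = π h' := by
        rw [hgh]
        apply Subtype.ext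
        simp [π, h']
      have h4 := key g h' h3 h2
      have h5 : (g : C(X, ℂ)) x₀ = -(h : C(X, ℂ)) x₀ := h4
      simp only [ρ]
      rw [h2, h5, neg_div_neg_eq]
  let σ : Λ → ℂ := fun z => ρ (Function.surjInv hπs z)
  have hσρ : σ ∘ π = ρ := funext fun g => hρπ _ _ (Function.surjInv_eq hπs _)
  have hσ : Continuous σ := hq.continuous_iff.2 (hσρ ▸ hρ)
  have hσne : ∀ z, σ z ≠ 0 := fun z => div_ne_zero (hxne _) (hx₀ne _)
  have hσsq : ∀ z : Λ, σ z ^ 2 * (-(z : ℂ)) = 1 - z := by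
    intro z
    obtain ⟨g, rfl⟩ := hπs z
    rw [show σ (π g) = ρ g from congr_fun hσρ g, ← (hTL g _ (hπL g)).2, ← (hTL g _ (hπL g)).1]
    simp only [ρ]
    field_simp [hx₀ne g]
  refine not_exists_continuous_sq_eq_neg
    (p := fun z : Λ => Complex.exp (Complex.log (1 - z) / 2) / σ z) ?_ ?_
  · refine Continuous.div ?_ hσ hσne
    refine Complex.continuous_exp.comp (Continuous.div_const ?_ _)
    exact Continuous.clog (by fun_prop) hΛ1
  · intro z
    rw [div_pow, ← Complex.exp_nat_mul, div_eq_iff (pow_ne_zero 2 (hσne z)), mul_comm,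
      mul_comm _ (_ ^ 2), hσsq, Nat.cast_ofNat, div_mul_cancel₀ _ two_ne_zero,
      Complex.exp_log (Complex.slitPlane_ne_zero (hΛ1 z))]

theorem exists_mem_eq_zero_on_ne_zero_on {X : Type*} [TopologicalSpace X] [CompactSpace X]
    [T2Space X] [LocallyConnectedSpace X] {B : Subalgebra ℂ C(X, ℂ)}
    (hB : IsClosed (B : Set C(X, ℂ))) (hsep : B.SeparatesPoints)
    (hsq : ∀ f ∈ B, ∃ g ∈ B, g ^ 2 = f) {K D : Set X} (hK : IsClosed K) (hD : IsClosed D)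
    (hKD : Disjoint K D) :
    ∃ v ∈ B, (∀ y ∈ D, v y = 0) ∧ ∀ x ∈ K, v x ≠ 0 := by
  have hpt : ∀ x ∈ K, ∃ v ∈ B, (∀ y ∈ D, v y = 0) ∧ v x ≠ 0 := by
    intro x hx
    refine hD.isCompact.induction_on (p := fun D => ∃ v ∈ B, (∀ y ∈ D, v y = 0) ∧ v x ≠ 0)
      ⟨1, B.one_mem, by simp, by simp⟩ ?_ ?_ ?_
    · rintro s t hst ⟨v, hv, h1, h2⟩
      exact ⟨v, hv, fun y hy => h1 y (hst hy), h2⟩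
    · rintro s t ⟨v, hv, h1, h2⟩ ⟨w, hw, h3, h4⟩
      refine ⟨v * w, B.mul_mem hv hw, ?_, mul_ne_zero h2 h4⟩
      rintro y (hy | hy)
      · simp [h1 y hy]
      · simp [h3 y hy]
    · intro y hy
      obtain ⟨k, hk, hkx, hky⟩ :=
        exists_mem_eventually_eq_zero hB hsep hsq (hKD.ne_of_mem hx hy)
      exact ⟨_, mem_nhdsWithin_of_mem_nhds hky, k, hk, fun _ h => h, hkx⟩
  have hloc : ∃ C, IsClosed C ∧ K ⊆ C ∧ ∃ v ∈ B, (∀ y ∈ D, v y = 0) ∧ ∀ x ∈ C, v x ≠ 0 := by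
    refine hK.isCompact.induction_on (p := fun K => ∃ C, IsClosed C ∧ K ⊆ C ∧
      ∃ v ∈ B, (∀ y ∈ D, v y = 0) ∧ ∀ x ∈ C, v x ≠ 0)
      ⟨∅, isClosed_empty, subset_rfl, 0, B.zero_mem, by simp, by simp⟩ ?_ ?_ ?_
    · rintro s t hst ⟨C, hC, htC, h⟩
      exact ⟨C, hC, hst.trans htC, h⟩
    · rintro s t ⟨C, hC, hsC, v, hv, hvD, hvC⟩ ⟨C', hC', htC', v', hv', hvD', hvC'⟩
      obtain ⟨u, hu, hu1, hu0, huC⟩ := exists_mem_norm_sub_one_lt hsq hv hC hvC one_half_pos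
      obtain ⟨u', hu', hu1', hu0', huC'⟩ := exists_mem_norm_sub_one_lt hsq hv' hC' hvC' one_half_pos
      have hle : ∀ w : C(X, ℂ), (∀ x, ‖w x‖ ≤ 1) → ∀ x, ‖w x - 1‖ ≤ 2 := fun w hw x =>
        (norm_sub_le _ _).trans (by rw [norm_one]; linarith [hw x])
      have hlt : ∀ a b : ℂ, ‖a - 1‖ < 1 / 2 → ‖b - 1‖ ≤ 2 → a + b - a * b ≠ 0 := by
        intro a b ha hb h0
        have h1 : (a - 1) * (b - 1) = 1 := by linear_combination -h0
        have h2 := congr_arg norm h1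
        rw [norm_mul, norm_one] at h2
        nlinarith [norm_nonneg (a - 1), norm_nonneg (b - 1)]
      refine ⟨C ∪ C', hC.union hC', union_subset_union hsC htC', u + u' - u * u',
        B.sub_mem (B.add_mem hu hu') (B.mul_mem hu hu'), fun y hy => ?_, ?_⟩
      · simp [hu0 y (hvD y hy), hu0' y (hvD' y hy)]
      · rintro x (hx | hx)
        · exact hlt _ _ (huC x hx) (hle u' hu1' x)
        · have := hlt _ _ (huC' x hx) (hle u hu1 x)
          rwa [add_comm, mul_comm] at this
    · intro x hx
      obtain ⟨v, hv, h1, h2⟩ := hpt x hx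
      have hpos := norm_pos_iff.2 h2
      have hev : ∀ᶠ y in 𝓝 x, ‖v x‖ / 2 ≤ ‖v y‖ := by
        have hc : Continuous fun y => ‖v y‖ := by fun_prop
        exact (continuousAt_const.eventually_lt hc.continuousAt (half_lt_self hpos)).mono
          fun _ h => h.le
      refine ⟨_, mem_nhdsWithin_of_mem_nhds hev, _, isClosed_le (by fun_prop) (by fun_prop),
        subset_rfl, v, hv, h1, fun y hy => ?_⟩
      exact norm_pos_iff.1 ((half_pos hpos).trans_le hy)
  obtain ⟨C, -, hKC, v, hv, h1, h2⟩ := hloc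
  exact ⟨v, hv, h1, fun x hx => h2 x (hKC hx)⟩

theorem sum_range_clamp (N : ℕ) {t : ℝ} (ht : 0 ≤ t) :
    ∑ j ∈ Finset.range N, max 0 (min 1 (t - j)) = min t N := by
  induction N with
  | zero => simp [ht]
  | succ N ih =>
    rw [Finset.sum_range_succ, ih]
    push_cast
    rcases le_total t N with h | h
    · rw [min_eq_left h, max_eq_left ((min_le_right _ _).trans (by linarith)),
        min_eq_left (by linarith), add_zero]
    · rw [min_eq_right h, max_eq_right (le_min zero_le_one (by linarith)),
        ← min_add_add_left, min_comm]
      ring_nf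

theorem norm_sum_clamp_sub_le (N : ℕ) (hN : 0 < N) {t : ℝ} (ht : 0 ≤ t) (u : ℕ → ℂ)
    (hu : ∀ j, ‖u j‖ ≤ 1) (h1 : ∀ j : ℕ, j + 1 ≤ t → ‖u j - 1‖ ≤ 1 / N)
    (h0 : ∀ j : ℕ, t ≤ j → u j = 0) :
    ‖∑ j ∈ Finset.range N, u j - (min t N : ℝ)‖ ≤ 3 := by
  rw [← sum_range_clamp N ht, Complex.ofReal_sum, ← Finset.sum_sub_distrib]
  refine (norm_sum_le _ _).trans ?_
  have hterm : ∀ j ∈ Finset.range N, ‖u j - ((max 0 (min 1 (t - j)) : ℝ) : ℂ)‖ ≤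
      1 / N + if j = ⌊t⌋₊ then 2 else 0 := by
    intro j _
    have hN' : (0 : ℝ) ≤ 1 / N := by positivity
    by_cases hj : j = ⌊t⌋₊
    · rw [if_pos hj]
      refine (norm_sub_le _ _).trans ?_
      have : ‖((max 0 (min 1 (t - j)) : ℝ) : ℂ)‖ ≤ 1 := by
        rw [Complex.norm_real, Real.norm_of_nonneg (le_max_left _ _)]
        exact max_le zero_le_one (min_le_left _ _)
      linarith [hu j]
    · rw [if_neg hj, add_zero]
      rcases lt_or_gt_of_ne hj with h | h
      · have h' : (j : ℝ) + 1 ≤ t := by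
          have : ((j + 1 : ℕ) : ℝ) ≤ t := (Nat.le_floor_iff ht).1 h
          exact_mod_cast this
        rw [min_eq_left (by linarith), max_eq_right zero_le_one, Complex.ofReal_one]
        exact h1 j h'
      · have h' : t ≤ j := ((Nat.floor_lt ht).1 h).le
        rw [h0 j h', max_eq_left ((min_le_right _ _).trans (by linarith))]
        simp
  refine (Finset.sum_le_sum hterm).trans ?_
  rw [Finset.sum_add_distrib, Finset.sum_const, Finset.card_range, Finset.sum_ite_eq', nsmul_eq_mul,
    mul_one_div_cancel (by positivity)]
  split_ifs <;> norm_num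

theorem subalgebra_eq_top_of_sq {X : Type*} [TopologicalSpace X] [CompactSpace X]
    [T2Space X] [LocallyConnectedSpace X] {B : Subalgebra ℂ C(X, ℂ)}
    (hB : IsClosed (B : Set C(X, ℂ))) (hsep : B.SeparatesPoints)
    (hsq : ∀ f ∈ B, ∃ g ∈ B, g ^ 2 = f) : B = ⊤ := by
  let J : C(ℝ, ℂ) := ⟨Complex.ofReal, Complex.continuous_ofReal⟩
  have hunit : ∀ F : C(X, ℝ), (∀ x, 0 ≤ F x) → (∀ x, F x ≤ 1) → J.comp F ∈ B := by
    intro F hF0 hF1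
    refine hB.closure_subset (Metric.mem_closure_iff.2 fun ε hε => ?_)
    obtain ⟨N, hN⟩ := exists_nat_gt (3 / ε)
    have hNpos : (0 : ℝ) < N := (by positivity : 0 < 3 / ε).trans hN
    have hu : ∀ j : ℕ, ∃ u ∈ B, (∀ x, ‖u x‖ ≤ 1) ∧ (∀ x, N * F x ≤ j → u x = 0) ∧
        ∀ x, j + 1 ≤ N * F x → ‖u x - 1‖ < 1 / N := by
      intro j
      obtain ⟨v, hv, hv0, hvK⟩ := exists_mem_eq_zero_on_ne_zero_on hB hsep hsq
        (K := {x | j + 1 ≤ N * F x}) (D := {x | N * F x ≤ j})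
        (isClosed_le (by fun_prop) (by fun_prop)) (isClosed_le (by fun_prop) (by fun_prop))
        (Set.disjoint_left.2 fun x (h : j + 1 ≤ N * F x) (h' : N * F x ≤ j) => by linarith)
      obtain ⟨u, hu, hu1, hu0, huK⟩ := exists_mem_norm_sub_one_lt hsq hv
        (isClosed_le (by fun_prop) (by fun_prop)) hvK (one_div_pos.2 hNpos)
      exact ⟨u, hu, hu1, fun x hx => hu0 x (hv0 x hx), huK⟩
    choose u huB hu1 hu0 huK using hu
    refine ⟨(N : ℂ)⁻¹ • ∑ j ∈ Finset.range N, u j,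
      B.smul_mem (B.sum_mem fun j _ => huB j) _, ?_⟩
    rw [dist_comm, ContinuousMap.dist_lt_iff hε]
    intro x
    have h := norm_sum_clamp_sub_le N (by exact_mod_cast hNpos) (t := N * F x)
      (mul_nonneg hNpos.le (hF0 x)) (fun j => u j x) (fun j => hu1 j x)
      (fun j hj => (huK j x hj).le) (fun j hj => hu0 j x hj)
    rw [min_eq_left (mul_le_of_le_one_right hNpos.le (hF1 x))] at h
    have hNc : (N : ℂ) ≠ 0 := by exact_mod_cast hNpos.ne'
    have heq : ((N : ℂ)⁻¹ • ∑ j ∈ Finset.range N, u j) x - J.comp F x =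
        (N : ℂ)⁻¹ * (∑ j ∈ Finset.range N, u j x - ((N * F x : ℝ) : ℂ)) := by
      simp only [ContinuousMap.smul_apply, ContinuousMap.sum_apply, smul_eq_mul,
        ContinuousMap.comp_apply, J, ContinuousMap.coe_mk, Complex.ofReal_mul,
        Complex.ofReal_natCast]
      field_simp
    rw [dist_eq_norm, heq, norm_mul, norm_inv, Complex.norm_natCast]
    calc (N : ℝ)⁻¹ * _ ≤ (N : ℝ)⁻¹ * 3 := by gcongr
      _ < ε := by
        rw [div_lt_iff₀ hε] at hN
        rw [inv_mul_lt_iff₀ hNpos]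
        exact hN
  have hreal : ∀ F : C(X, ℝ), J.comp F ∈ B := by
    intro F
    let c : ℝ := 2 * ‖F‖ + 1
    have hc : 0 < c := by positivity
    have hF := fun x => abs_le.1 (F.norm_coe_le_norm x)
    have h := hunit ⟨fun x => (F x + ‖F‖) / c, by fun_prop⟩
      (fun x => div_nonneg (by linarith [(hF x).1]) hc.le)
      (fun x => (div_le_one hc).2 (by simp only [c]; linarith [(hF x).2]))
    convert B.sub_mem (B.smul_mem h (c : ℂ)) (B.algebraMap_mem (‖F‖ : ℂ)) using 1
    ext x
    have hc' : (c : ℂ) ≠ 0 := by exact_mod_cast hc.ne'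
    simp [J]
    field_simp
    ring
  refine eq_top_iff.2 fun f _ => ?_
  convert B.add_mem (hreal ⟨fun x => (f x).re, by fun_prop⟩)
    (B.smul_mem (hreal ⟨fun x => (f x).im, by fun_prop⟩) Complex.I) using 1
  ext x
  simp [J, mul_comm Complex.I]

theorem eventually_forall_lt_of_forall_pos {X : Type*} [TopologicalSpace X] [CompactSpace X]
    {f : X → ℝ} (hf : Continuous f) (h : ∀ x, 0 < f x) : ∀ᶠ η in 𝓝[>] (0 : ℝ), ∀ x, η < f x := by
  rcases isEmpty_or_nonempty X with hX | hX
  · exact Eventually.of_forall fun _ x => isEmptyElim x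
  · obtain ⟨x, -, hx⟩ := isCompact_univ.exists_isMinOn univ_nonempty hf.continuousOn
    filter_upwards [mem_nhdsWithin_of_mem_nhds (Iio_mem_nhds (h x))] with η hη y
    exact lt_of_lt_of_le hη (hx (mem_univ y))

theorem exists_near_forall_ne_or_ne {X : Type*} [TopologicalSpace X] [CompactSpace X]
    (hd : Dense {f : C(X, ℂ) | ∀ x, f x ≠ 0}) {τ : Type*} [Finite τ] (φ : τ → C(X, ℝ)) {δ : ℝ}
    (hδ : 0 < δ) : ∃ Φ : τ → C(X, ℝ), (∀ i x, |Φ i x - φ i x| < δ) ∧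
      ∀ i j k, i ≠ j → i ≠ k → j ≠ k → ∀ x, Φ i x ≠ Φ j x ∨ Φ k x ≠ Φ j x := by
  classical
  have := Fintype.ofFinite τ
  let O : {p : τ × τ × τ // p.1 ≠ p.2.1 ∧ p.1 ≠ p.2.2 ∧ p.2.1 ≠ p.2.2} → Set (τ → C(X, ℝ)) :=
    fun p => {Φ | ∀ x, Φ p.1.1 x ≠ Φ p.1.2.1 x ∨ Φ p.1.2.2 x ≠ Φ p.1.2.1 x}
  have hO : ∀ p, IsOpen (O p) := by
    rintro ⟨⟨i, j, k⟩, hp⟩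
    have h1 : IsOpen {q : (τ → C(X, ℝ)) × X | q.1 i q.2 ≠ q.1 j q.2 ∨ q.1 k q.2 ≠ q.1 j q.2} := by
      simp only [ofPred_or]
      exact (isOpen_ne_fun (by fun_prop) (by fun_prop)).union
        (isOpen_ne_fun (by fun_prop) (by fun_prop))
    rw [isOpen_iff_eventually]
    intro Φ hΦ
    have := isCompact_univ.eventually_forall_of_forall_eventually (x₀ := Φ)
      (P := fun Φ x => Φ i x ≠ Φ j x ∨ Φ k x ≠ Φ j x)
      fun x _ => h1.mem_nhds (show (Φ, x) ∈ _ from hΦ x)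
    filter_upwards [this] with Ψ hΨ x using hΨ x (mem_univ x)
  have hOd : ∀ p, Dense (O p) := by
    rintro ⟨⟨i, j, k⟩, hij, hik, hjk⟩ Φ
    refine Metric.mem_closure_iff.2 fun ε hε => ?_
    let z : C(X, ℂ) := ⟨fun x => (Φ i x - Φ j x : ℝ) + (Φ k x - Φ j x : ℝ) * Complex.I, by fun_prop⟩
    obtain ⟨w, hw, hzw⟩ := Metric.mem_closure_iff.1 (hd z) ε hε
    have hzw' := fun x => (ContinuousMap.dist_lt_iff hε).1 hzw x
    let Ψ : τ → C(X, ℝ) := fun l =>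
      if l = i then ⟨fun x => Φ j x + (w x).re, by fun_prop⟩ else
      if l = k then ⟨fun x => Φ j x + (w x).im, by fun_prop⟩ else Φ l
    have hΨi : ∀ x, Ψ i x = Φ j x + (w x).re := fun x => by simp [Ψ]
    have hΨk : ∀ x, Ψ k x = Φ j x + (w x).im := fun x => by simp [Ψ, hik.symm]
    have hΨj : Ψ j = Φ j := by simp [Ψ, hij.symm, hjk]
    refine ⟨Ψ, ?_, ?_⟩
    · intro x
      simp only
      rw [hΨi, hΨk, hΨj]
      by_contra! h
      exact hw x (Complex.ext (by simpa using h.1) (by simpa using h.2))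
    · rw [dist_pi_lt_iff hε]
      intro l
      by_cases hli : l = i
      · subst hli
        rw [ContinuousMap.dist_lt_iff hε]
        intro x
        refine lt_of_le_of_lt ?_ (hzw' x)
        rw [hΨi, Real.dist_eq, dist_eq_norm]
        refine le_trans (le_of_eq ?_) (Complex.abs_re_le_norm _)
        simp [z, sub_sub]
      by_cases hlk : l = k
      · subst hlk
        rw [ContinuousMap.dist_lt_iff hε]
        intro x
        refine lt_of_le_of_lt ?_ (hzw' x)
        rw [hΨk, Real.dist_eq, dist_eq_norm]
        refine le_trans (le_of_eq ?_) (Complex.abs_im_le_norm _)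
        simp [z, sub_sub]
      · simpa [Ψ, hli, hlk] using hε
  obtain ⟨Φ, hΦ, hdist⟩ := Metric.mem_closure_iff.1 (dense_iInter_of_isOpen hO hOd φ) δ hδ
  refine ⟨Φ, fun i x => ?_, fun i j k hij hik hjk => mem_iInter.1 hΦ ⟨(i, j, k), hij, hik, hjk⟩⟩
  rw [dist_comm] at hdist
  rw [← Real.dist_eq]
  exact (ContinuousMap.dist_apply_le_dist x).trans_lt ((dist_le_pi_dist Φ φ i).trans_lt hdist)

theorem coveringDimLE_one_of_dense {X : Type*} [TopologicalSpace X] [CompactSpace X] [T2Space X]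
    (hd : Dense {f : C(X, ℂ) | ∀ x, f x ≠ 0}) : CoveringDimLE X 1 := by
  intro ι U hU hcov
  obtain ⟨t, ht⟩ := isCompact_univ.elim_finite_subcover U hU hcov.ge
  obtain ⟨φ, hφ⟩ := PartitionOfUnity.exists_isSubordinate isClosed_univ (fun i : t => U i)
    (fun i => hU i) (by simpa [iUnion_subtype] using ht)
  have hsum : ∀ x, ∑ i, φ i x = 1 := fun x => by
    rw [← finsum_eq_sum_of_fintype]
    exact φ.sum_eq_one (mem_univ x)
  let δ : ℝ := 1 / (3 * (t.card + 1))
  have hδ : 0 < δ := by positivity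
  have hlarge : ∀ x, ∃ i, 3 * δ ≤ φ i x := by
    intro x
    by_contra! h
    have h1 : ∑ i, φ i x ≤ ∑ i : t, 3 * δ := Finset.sum_le_sum fun i _ => (h i).le
    rw [hsum, Finset.sum_const, Finset.card_univ, Fintype.card_coe, nsmul_eq_mul] at h1
    simp only [δ] at h1
    field_simp at h1
    linarith
  obtain ⟨Φ, hΦφ, hΦ⟩ := exists_near_forall_ne_or_ne hd (fun i => φ i) hδ
  have hη : ∀ᶠ η in 𝓝[>] (0 : ℝ), ∀ i j k, i ≠ j → i ≠ k → j ≠ k →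
      ∀ x, 2 * η < |Φ i x - Φ j x| + |Φ k x - Φ j x| := by
    simp only [eventually_all]
    intro i j k hij hik hjk
    have hpos : ∀ x, 0 < (|Φ i x - Φ j x| + |Φ k x - Φ j x|) / 2 := by
      intro x
      rcases hΦ i j k hij hik hjk x with h | h
      · have := abs_pos.2 (sub_ne_zero.2 h); positivity
      · have := abs_pos.2 (sub_ne_zero.2 h); positivity
    filter_upwards [eventually_forall_lt_of_forall_pos (by fun_prop) hpos] with η h x
    linarith [h x]
  have hη' : ∀ᶠ η in 𝓝[>] (0 : ℝ), η < δ := mem_nhdsWithin_of_mem_nhds (Iio_mem_nhds hδ)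
  obtain ⟨η, hηΦ, hηδ, hη0 : 0 < η⟩ := (hη.and (hη'.and self_mem_nhdsWithin)).exists
  refine ⟨fun i => {x | ∃ h : i ∈ t, ∀ j, Φ j x < Φ ⟨i, h⟩ x + η}, fun i => ?_, ?_, fun i => ?_,
    fun x => ?_⟩
  · by_cases h : i ∈ t
    · simp only [h, exists_true_left, ofPred_forall]
      exact isOpen_iInter_of_finite fun j => isOpen_lt (by fun_prop) (by fun_prop)
    · simp [h]
  · refine eq_univ_of_forall fun x => ?_
    obtain ⟨i₀, -⟩ := hlarge x
    have : Nonempty t := ⟨i₀⟩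
    obtain ⟨i, hi⟩ := Finite.exists_max fun i => Φ i x
    exact mem_iUnion.2 ⟨i, i.2, fun j => (hi j).trans_lt (by linarith)⟩
  · rintro x ⟨hi, hx⟩
    obtain ⟨j, hj⟩ := hlarge x
    have h1 := abs_lt.1 (hΦφ j x)
    have h2 := abs_lt.1 (hΦφ ⟨i, hi⟩ x)
    have h3 := hx j
    have hpos : 0 < φ ⟨i, hi⟩ x := by linarith [h1.1, h2.2]
    exact hφ ⟨i, hi⟩ (subset_tsupport _ hpos.ne')
  · have hfin : {i | x ∈ {x | ∃ h : i ∈ t, ∀ j, Φ j x < Φ ⟨i, h⟩ x + η}}.Finite :=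
      t.finite_toSet.subset fun i hi => hi.1
    refine ⟨hfin, ?_⟩
    by_contra! hcard
    obtain ⟨i, j, k, ⟨hi, hxi⟩, ⟨hj, hxj⟩, ⟨hk, hxk⟩, hij, hik, hjk⟩ :=
      (Set.two_lt_ncard_iff hfin).1 hcard
    have h := hηΦ ⟨i, hi⟩ ⟨j, hj⟩ ⟨k, hk⟩ (by simpa using hij) (by simpa using hik)
      (by simpa using hjk) x
    have h1 : |Φ ⟨i, hi⟩ x - Φ ⟨j, hj⟩ x| < η :=
      abs_lt.2 ⟨by linarith [hxi ⟨j, hj⟩], by linarith [hxj ⟨i, hi⟩]⟩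
    have h2 : |Φ ⟨k, hk⟩ x - Φ ⟨j, hj⟩ x| < η :=
      abs_lt.2 ⟨by linarith [hxk ⟨j, hj⟩], by linarith [hxj ⟨k, hk⟩]⟩
    linarith

/-- If `A` is a unital commutative Banach algebra over ℂ with dense invertibles and dense
squares, then every compact locally connected subspace of its maximal ideal space has
covering dimension at most 1. -/
theorem stmt_1 (A : Type*) [NormedCommRing A] [NormedAlgebra ℂ A] [CompleteSpace A]
    (hd : Dense {a : A | IsUnit a}) (hsq : Dense {a : A | ∃ b : A, a = b ^ 2})
    (E : Set (WeakDual.characterSpace ℂ A)) (hE : IsCompact E)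
    (hlc : LocallyConnectedSpace ↥E) : CoveringDimLE ↥E 1 := by
  have : CompactSpace E := isCompact_iff_compactSpace.1 hE
  let Φ : A →ₐ[ℂ] C(E, ℂ) :=
    (ContinuousMap.compRightAlgHom ℂ ℂ (⟨Subtype.val, continuous_subtype_val⟩ : C(E, _))).comp
      (WeakDual.gelfandTransform ℂ A)
  have hΦa : ∀ a (x : E), Φ a x = (x : WeakDual.characterSpace ℂ A) a := fun _ _ => rfl
  have hΦ : Continuous Φ := by
    refine AddMonoidHomClass.continuous_of_bound Φ ‖(1 : A)‖ fun a => ?_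
    rw [ContinuousMap.norm_le _ (by positivity)]
    intro x
    rw [hΦa, mul_comm]
    exact AlgHom.norm_apply_le_self_mul_norm_one (x : WeakDual.characterSpace ℂ A) a
  let B : Subalgebra ℂ C(E, ℂ) := Φ.range.topologicalClosure
  have hBcl : IsClosed (B : Set C(E, ℂ)) := Subalgebra.isClosed_topologicalClosure _
  have hBcoe : (B : Set C(E, ℂ)) = closure (range Φ) := rfl
  have hΦB : ∀ a, Φ a ∈ B := fun a => subset_closure ⟨a, rfl⟩
  have hsep : B.SeparatesPoints := by
    intro x y hxy
    have hne : (x : WeakDual.characterSpace ℂ A) ≠ y := fun h => hxy (Subtype.ext h)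
    obtain ⟨a, ha⟩ := DFunLike.ne_iff.1 hne
    exact ⟨_, ⟨Φ a, hΦB a, rfl⟩, ha⟩
  have hproper : IsClosedMap fun g : C(E, ℂ) => g ^ 2 :=
    (isProperMap_iff_isCompact_preimage.2
      ⟨continuous_pow 2, fun _ hS => isCompact_preimage_sq hS⟩).isClosedMap
  have hBsq : ∀ f ∈ B, ∃ g ∈ B, g ^ 2 = f := by
    intro f hf
    have h1 : IsClosed ((fun g : C(E, ℂ) => g ^ 2) '' B) := hproper _ hBcl
    have h2 : range Φ ⊆ (fun g : C(E, ℂ) => g ^ 2) '' B := by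
      rintro _ ⟨a, rfl⟩
      refine h1.closure_subset_iff.2 ?_
        (map_mem_closure hΦ (hsq a) (t := Φ '' _) fun b hb => ⟨b, hb, rfl⟩)
      rintro _ ⟨_, ⟨b, rfl⟩, rfl⟩
      exact ⟨Φ b, hΦB b, (map_pow Φ b 2).symm⟩
    exact h1.closure_subset_iff.2 h2 hf
  have hBtop : B = ⊤ := subalgebra_eq_top_of_sq hBcl hsep hBsq
  have hrange : DenseRange Φ := fun f => by
    rw [← hBcoe, hBtop]
    trivial
  refine coveringDimLE_one_of_dense ((hrange.dense_image hΦ hd).mono ?_)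
  rintro _ ⟨a, ha, rfl⟩ x
  exact (ha.map (x : WeakDual.characterSpace ℂ A)).ne_zero
end

section
/- Let B be a closed unital subalgebra of C(E, ℂ) for a compact Hausdorff, locally connected space E, separating points of E, closed under no extra hypotheses except that the set of squares {b² : b ∈ B} is dense in B. Then B = C(E, ℂ). -/
open Filter Topology Set

/-- No continuous square root of `(a - z) * (b - z)` exists on the plane when `a ≠ b`. -/
theorem eq_of_continuous_sqrt_mul {a b : ℂ} {p : ℂ → ℂ} (hp : Continuous p)
    (hsq : ∀ z, p z ^ 2 = (a - z) * (b - z)) : a = b := by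
  by_contra hab
  set φ : ℝ → ℂ := fun t ↦ p (a - (b - a) / 2 * Complex.exp (t * Complex.I)) *
    Complex.exp (-(t * Complex.I) / 2) *
    Complex.exp (-Complex.log (1 + Complex.exp (t * Complex.I) / 2) / 2) with hφ
  have hnorm : ∀ t : ℝ, ‖Complex.exp (t * Complex.I) / 2‖ < 1 := fun t ↦ by
    rw [norm_div, Complex.norm_exp_ofReal_mul_I]; norm_num
  have hslit : ∀ t : ℝ, 1 + Complex.exp (t * Complex.I) / 2 ∈ Complex.slitPlane := fun t ↦
    Complex.mem_slitPlane_of_norm_lt_one (hnorm t)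
  have hc : Continuous φ := by
    refine ((hp.comp (by fun_prop)).mul (by fun_prop)).mul (Complex.continuous_exp.comp ?_)
    exact ((Continuous.clog (by fun_prop) hslit).neg).div_const 2
  have hφsq : ∀ t, φ t ^ 2 = (b - a) ^ 2 / 2 := fun t ↦ by
    have e1 : Complex.exp (-(t * Complex.I) / 2) ^ 2 = (Complex.exp (t * Complex.I))⁻¹ := by
      rw [← Complex.exp_nat_mul, ← Complex.exp_neg]; congr 1; push_cast; ring
    have e2 : Complex.exp (-Complex.log (1 + Complex.exp (t * Complex.I) / 2) / 2) ^ 2 =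
        (1 + Complex.exp (t * Complex.I) / 2)⁻¹ := by
      rw [← Complex.exp_nat_mul]
      conv_rhs => rw [← Complex.exp_log (Complex.slitPlane_ne_zero (hslit t)), ← Complex.exp_neg]
      congr 1; push_cast; ring
    simp only [hφ, mul_pow, e1, e2, hsq]
    have h1 := Complex.exp_ne_zero (t * Complex.I)
    have h2 := Complex.slitPlane_ne_zero (hslit t)
    rw [mul_assoc, ← mul_inv, ← div_eq_mul_inv, div_eq_iff (mul_ne_zero h1 h2)]
    ring
  have hne : (b - a) ^ 2 / 2 ≠ 0 :=
    div_ne_zero (pow_ne_zero 2 (sub_ne_zero.2 (Ne.symm hab))) two_ne_zero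
  have hφ0 : φ 0 ≠ 0 := fun h ↦ hne (by rw [← hφsq 0, h]; ring)
  have hflip : φ (2 * Real.pi) = -φ 0 := by
    have e : Complex.exp ((2 * Real.pi : ℝ) * Complex.I) = 1 := by
      push_cast; exact Complex.exp_two_pi_mul_I
    have e' : Complex.exp (-((2 * Real.pi : ℝ) * Complex.I) / 2) = -1 := by
      rw [← Complex.exp_neg_pi_mul_I]; congr 1; push_cast; ring
    simp only [hφ, e, e']
    simp
  have hconst := isPreconnected_univ.eq_of_sq_eq (f := φ) (g := fun _ ↦ φ 0)
    hc.continuousOn continuousOn_const (fun t _ ↦ by simp [hφsq]) (fun _ ↦ hφ0)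
    (mem_univ 0) rfl (mem_univ (2 * Real.pi))
  rw [hflip] at hconst
  exact hφ0 (self_eq_neg.1 hconst.symm)

/-- Polynomials fixing `0`, almost fixing `1`, and mapping the unit disc into a thin ellipse with
foci `0` and `1`. -/
theorem exists_polynomial_disc_thin_ellipse {ε : ℝ} (hε : 0 < ε) :
    ∃ P : Polynomial ℂ, P.eval 0 = 0 ∧ ‖1 - P.eval 1‖ < ε ∧
      ∀ z : ℂ, ‖z‖ ≤ 1 → ‖P.eval z‖ + ‖1 - P.eval z‖ < 1 + ε := by
  obtain ⟨Λ, hΛ1, hΛ⟩ : ∃ Λ : ℝ, 1 < Λ ∧ 10 / Λ < ε / 2 := by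
    refine ⟨1 + 20 / ε, by have := div_pos (by norm_num : (0:ℝ) < 20) hε; linarith, ?_⟩
    rw [div_lt_iff₀ (by positivity)]
    have : ε / 2 * (1 + 20 / ε) = ε / 2 + 10 := by field_simp; ring
    linarith
  have hΛ0 : 0 < Λ := by linarith
  set r : ℝ := 1 - Real.exp (-Λ) with hr
  have hexp1 : Real.exp (-Λ) < 1 := Real.exp_lt_one_iff.2 (by linarith)
  have hr0 : 0 < r := by linarith
  have hr1 : r < 1 := by have := Real.exp_pos (-Λ); linarith
  obtain ⟨n, hn⟩ : ∃ n : ℕ, (1 - r)⁻¹ / (n + 1) < ε / 4 := by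
    obtain ⟨n, hn⟩ := exists_nat_gt ((1 - r)⁻¹ / (ε / 4))
    refine ⟨n, ?_⟩
    rw [div_lt_iff₀ (by positivity)] at hn ⊢
    nlinarith
  set F : ℂ → ℂ := fun z ↦ -(Λ : ℂ)⁻¹ * Complex.log (1 + -r * z) with hF
  set P : Polynomial ℂ := Polynomial.C (-(Λ : ℂ)⁻¹) * ∑ j ∈ Finset.range (n + 1),
    Polynomial.C ((-1) ^ (j + 1) / (j : ℂ)) * (Polynomial.C (-r : ℂ) * Polynomial.X) ^ j with hP
  have hPeval : ∀ z, P.eval z = -(Λ : ℂ)⁻¹ * Complex.logTaylor (n + 1) (-r * z) := fun z ↦ by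
    simp only [hP, Polynomial.eval_mul, Polynomial.eval_C, Polynomial.eval_finsetSum,
      Polynomial.eval_pow, Polynomial.eval_X, Complex.logTaylor]
    congr 1
    exact Finset.sum_congr rfl fun j _ ↦ by ring
  have hrz : ∀ z : ℂ, ‖z‖ ≤ 1 → ‖-r * z‖ ≤ r := fun z hz ↦ by
    rw [norm_mul, norm_neg, Complex.norm_real, Real.norm_of_nonneg hr0.le]
    nlinarith
  have hnΛ : ‖-(Λ : ℂ)⁻¹‖ = Λ⁻¹ := by simp [abs_of_pos hΛ0]
  have happrox : ∀ z : ℂ, ‖z‖ ≤ 1 → ‖F z - P.eval z‖ < ε / 4 := fun z hz ↦ by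
    have h1 := Complex.norm_log_sub_logTaylor_le n ((hrz z hz).trans_lt hr1)
    have h2 : ‖-r * z‖ ^ (n + 1) * (1 - ‖-r * z‖)⁻¹ / (n + 1) ≤ (1 - r)⁻¹ / (n + 1) := by
      have h3 := hrz z hz
      have : ‖-r * z‖ ^ (n + 1) ≤ 1 := pow_le_one₀ (norm_nonneg _) (h3.trans hr1.le)
      have h4 : (1 - ‖-r * z‖)⁻¹ ≤ (1 - r)⁻¹ := inv_anti₀ (by linarith) (by linarith)
      have h5 : 0 ≤ (1 - ‖-r * z‖)⁻¹ := inv_nonneg.2 (by linarith)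
      gcongr
      nlinarith
    rw [hPeval, hF]
    simp only
    rw [← mul_sub, norm_mul, hnΛ]
    have : Λ⁻¹ ≤ 1 := inv_le_one_of_one_le₀ hΛ1.le
    have h0 := norm_nonneg (Complex.log (1 + -r * z) - Complex.logTaylor (n + 1) (-r * z))
    nlinarith
  have hF1 : F 1 = 1 := by
    have : (1 + -r * 1 : ℂ) = ((Real.exp (-Λ) : ℝ) : ℂ) := by rw [hr]; push_cast; ring
    simp only [hF]
    rw [this, ← Complex.ofReal_log (Real.exp_pos _).le, Real.log_exp]
    have : (Λ : ℂ) ≠ 0 := by exact_mod_cast hΛ0.ne'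
    push_cast
    field_simp
  refine ⟨P, ?_, ?_, fun z hz ↦ ?_⟩
  · rw [hPeval]; simp [Complex.logTaylor_at_zero]
  · have := happrox 1 (by simp)
    rw [hF1] at this
    linarith
  · set w := 1 + -r * z with hw
    have hre : (F z).re = -(Λ⁻¹ * Real.log ‖w‖) := by
      simp only [hF]
      rw [← Complex.ofReal_inv, ← Complex.ofReal_neg, Complex.re_ofReal_mul, Complex.log_re]; ring
    have him : (F z).im = -(Λ⁻¹ * w.arg) := by
      simp only [hF]
      rw [← Complex.ofReal_inv, ← Complex.ofReal_neg, Complex.im_ofReal_mul, Complex.log_im]; ring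
    have hi : 0 < Λ⁻¹ := inv_pos.2 hΛ0
    have hwl : Real.exp (-Λ) ≤ ‖w‖ := by
      have := norm_sub_norm_le (1 : ℂ) (r * z)
      have h2 := hrz z hz
      rw [neg_mul, norm_neg] at h2
      rw [hw, neg_mul, ← sub_eq_add_neg]
      simp only [norm_one] at this
      linarith
    have hwu : ‖w‖ ≤ 2 := by
      have := norm_add_le (1 : ℂ) (-r * z)
      have h2 := hrz z hz
      simp only [norm_one] at this
      linarith
    have hw0 : 0 < ‖w‖ := (Real.exp_pos _).trans_le hwl
    have hl1 : -Λ ≤ Real.log ‖w‖ := by rwa [Real.le_log_iff_exp_le hw0]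
    have hl2 : Real.log ‖w‖ ≤ 1 := by
      rw [Real.log_le_iff_le_exp hw0]
      linarith [Real.add_one_le_exp 1]
    have h1 : (F z).re ≤ 1 := by
      rw [hre]
      have : Λ⁻¹ * Λ = 1 := inv_mul_cancel₀ hΛ0.ne'
      nlinarith
    have h2 : -Λ⁻¹ ≤ (F z).re := by rw [hre]; nlinarith
    have h3 : |(F z).im| ≤ 4 * Λ⁻¹ := by
      rw [him, abs_neg, abs_mul, abs_of_pos hi]
      have := Complex.abs_arg_le_pi w
      have := Real.pi_le_four
      nlinarith
    have h4 := Complex.norm_le_abs_re_add_abs_im (F z)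
    have h5 := Complex.norm_le_abs_re_add_abs_im (1 - F z)
    simp only [Complex.sub_re, Complex.one_re, Complex.sub_im, Complex.one_im, zero_sub,
      abs_neg] at h5
    have h6 : |(F z).re| + |1 - (F z).re| ≤ 1 + 2 * Λ⁻¹ := by
      rw [abs_of_nonneg (by linarith : 0 ≤ 1 - (F z).re)]
      rcases abs_cases (F z).re with ⟨h, _⟩ | ⟨h, _⟩ <;> linarith
    have h7 := happrox z hz
    have h8 : ‖P.eval z‖ ≤ ‖F z‖ + ‖F z - P.eval z‖ := by
      have := norm_sub_le (F z) (F z - P.eval z)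
      rwa [sub_sub_cancel] at this
    have h9 : ‖1 - P.eval z‖ ≤ ‖1 - F z‖ + ‖F z - P.eval z‖ := by
      have := norm_add_le (1 - F z) (F z - P.eval z)
      rwa [sub_add_sub_cancel] at this
    have h10 : 10 * Λ⁻¹ < ε / 2 := by rwa [← div_eq_mul_inv]
    linarith

/-- Approximate square roots of a fixed function are equicontinuous at each point of a locally
connected space. -/
theorem exists_nhds_norm_sub_le_of_norm_sq_sub_le {X : Type*} [TopologicalSpace X]
    [CompactSpace X] [LocallyConnectedSpace X] (h : C(X, ℂ)) (x : X) {κ : ℝ} (hκ : 0 < κ) :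
    ∃ V ∈ 𝓝 x, ∀ s : C(X, ℂ), ‖s ^ 2 - h‖ ≤ κ ^ 2 / 4 → ∀ y ∈ V, ‖s y - s x‖ ≤ 5 * κ := by
  have hU : {y | ‖h y - h x‖ < κ ^ 2 / 4} ∈ 𝓝 x := by
    have : Continuous fun y ↦ ‖h y - h x‖ := by fun_prop
    exact (this.tendsto x).eventually_lt_const (by simpa using by positivity)
  obtain ⟨V, hV, hVc, hVU⟩ :=
    locallyConnectedSpace_iff_connected_subsets.1 inferInstance x _ hU
  refine ⟨V, hV, fun s hs y hy ↦ ?_⟩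
  have hprod : ∀ z ∈ V, ‖s z - s x‖ * ‖s z + s x‖ < κ ^ 2 := fun z hz ↦ by
    have h1 : ‖s z ^ 2 - h z‖ ≤ κ ^ 2 / 4 := ((s ^ 2 - h).norm_coe_le_norm z).trans hs
    have h2 : ‖s x ^ 2 - h x‖ ≤ κ ^ 2 / 4 := ((s ^ 2 - h).norm_coe_le_norm x).trans hs
    have h3 : ‖h z - h x‖ < κ ^ 2 / 4 := hVU hz
    rw [← norm_mul, show (s z - s x) * (s z + s x) =
      (s z ^ 2 - h z) + (h z - h x) - (s x ^ 2 - h x) by ring]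
    have h4 := norm_sub_le ((s z ^ 2 - h z) + (h z - h x)) (s x ^ 2 - h x)
    have h5 := norm_add_le (s z ^ 2 - h z) (h z - h x)
    have : 0 < κ ^ 2 := by positivity
    linarith
  have hsum : ∀ z, 2 * ‖s x‖ ≤ ‖s z + s x‖ + ‖s z - s x‖ := fun z ↦ by
    have := norm_sub_le (s z + s x) (s z - s x)
    rwa [show s z + s x - (s z - s x) = 2 * s x by ring, norm_mul, Complex.norm_ofNat] at this
  have hsum' : ∀ z, ‖s z - s x‖ ≤ ‖s z + s x‖ + 2 * ‖s x‖ := fun z ↦ by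
    have := norm_sub_le (s z + s x) (2 * s x)
    rwa [show s z + s x - 2 * s x = s z - s x by ring, norm_mul, Complex.norm_ofNat] at this
  by_contra! hlt
  rcases le_or_gt ‖s x‖ (2 * κ) with hle | hgt
  · have := hsum' y
    have := hprod y hy
    nlinarith
  · have hcont : ContinuousOn (fun z ↦ ‖s z - s x‖) V := by fun_prop
    obtain ⟨z, hz, hze⟩ := hVc.intermediate_value (mem_of_mem_nhds hV) hy hcont
      (show 3 / 2 * κ ∈ Icc _ _ from ⟨by simpa using hκ.le, by linarith⟩)
    simp only at hze
    have h1 := hsum z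
    have h2 := hprod z hz
    rw [hze] at h1 h2
    nlinarith

/-- Squaring is a proper map on `C(X, ℂ)` when `X` is compact and locally connected. -/
theorem isProperMap_sq_continuousMap (X : Type*) [TopologicalSpace X] [CompactSpace X]
    [LocallyConnectedSpace X] : IsProperMap fun s : C(X, ℂ) ↦ s ^ 2 := by
  refine isProperMap_iff_ultrafilter.2 ⟨by fun_prop, fun 𝒰 h hh ↦ ?_⟩
  suffices hc : Cauchy (𝒰 : Filter C(X, ℂ)) by
    obtain ⟨s, hs⟩ := CompleteSpace.complete hc
    exact ⟨s, tendsto_nhds_unique (((continuous_pow 2).tendsto s).mono_left hs) hh, hs⟩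
  refine Metric.cauchy_iff.2 ⟨inferInstance, fun ε hε ↦ ?_⟩
  obtain ⟨κ, hκ, hκε⟩ : ∃ κ : ℝ, 0 < κ ∧ 12 * κ < ε := ⟨ε / 13, by positivity, by linarith⟩
  have hclose : ∀ᶠ s in (𝒰 : Filter C(X, ℂ)), ‖s ^ 2 - h‖ ≤ κ ^ 2 / 4 := by
    have := hh.eventually (Metric.closedBall_mem_nhds h (by positivity : 0 < κ ^ 2 / 4))
    simpa only [Metric.mem_closedBall, dist_eq_norm] using this
  choose V hV hVs using fun x ↦ exists_nhds_norm_sub_le_of_norm_sq_sub_le h x hκ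
  obtain ⟨t, -, ht⟩ := isCompact_univ.elim_nhds_subcover V fun x _ ↦ hV x
  have hlim : ∀ x, ∃ c : ℂ, Tendsto (fun s : C(X, ℂ) ↦ s x) 𝒰 (𝓝 c) := fun x ↦ by
    have hball : ∀ᶠ s in (𝒰 : Filter C(X, ℂ)),
        s x ∈ Metric.closedBall (0 : ℂ) (1 + ‖h‖ + κ ^ 2 / 4) := by
      filter_upwards [hclose] with s hs
      have h1 : ‖s x ^ 2 - h x‖ ≤ κ ^ 2 / 4 := ((s ^ 2 - h).norm_coe_le_norm x).trans hs
      have h2 := h.norm_coe_le_norm x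
      have h3 : ‖s x‖ ^ 2 ≤ ‖h‖ + κ ^ 2 / 4 := by
        have := norm_add_le (s x ^ 2 - h x) (h x)
        rw [sub_add_cancel, norm_pow] at this
        linarith
      rw [mem_closedBall_zero_iff]
      nlinarith [norm_nonneg (s x), sq_nonneg (‖s x‖ - 1)]
    obtain ⟨c, -, hc⟩ := (isCompact_closedBall (0 : ℂ) _).ultrafilter_le_nhds'
      (𝒰.map fun s : C(X, ℂ) ↦ s x) hball
    exact ⟨c, hc⟩
  choose c hc using hlim
  have hev : ∀ᶠ s in (𝒰 : Filter C(X, ℂ)), ∀ x ∈ t, ‖s x - c x‖ < κ :=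
    (Filter.eventually_all_finset t).2 fun x _ ↦ by
      simpa only [Metric.mem_ball, dist_eq_norm] using
        (hc x).eventually (Metric.ball_mem_nhds _ hκ)
  refine ⟨{s | ‖s ^ 2 - h‖ ≤ κ ^ 2 / 4 ∧ ∀ x ∈ t, ‖s x - c x‖ < κ}, hclose.and hev, ?_⟩
  rintro s ⟨hs1, hs2⟩ s' ⟨hs1', hs2'⟩
  refine ((ContinuousMap.dist_le (by positivity : 0 ≤ 12 * κ)).2 fun y ↦ ?_).trans_lt hκε
  obtain ⟨x, hxt, hy⟩ := mem_iUnion₂.1 (ht (mem_univ y))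
  have h1 := hVs x s hs1 y hy
  have h2 := hVs x s' hs1' y hy
  have h3 := hs2 x hxt
  have h4 := hs2' x hxt
  rw [dist_eq_norm, show s y - s' y =
    (s y - s x) + (s x - c x) - ((s' y - s' x) + (s' x - c x)) by ring]
  have h5 := norm_sub_le ((s y - s x) + (s x - c x)) ((s' y - s' x) + (s' x - c x))
  have h6 := norm_add_le (s y - s x) (s x - c x)
  have h7 := norm_add_le (s' y - s' x) (s' x - c x)
  linarith

/-- Near a point where `u` does not vanish, powers of a root of `u` of large degree oscillate
little. -/
theorem exists_nhds_norm_pow_sub_pow_le {X : Type*} [TopologicalSpace X]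
    [LocallyConnectedSpace X] (u : C(X, ℂ)) {x : X} (hx : u x ≠ 0) :
    ∃ V ∈ 𝓝 x, ∀ (N k : ℕ) (s : C(X, ℂ)), k ≤ N → s ^ N = u → ‖s x‖ ≤ 1 →
      ∀ y ∈ V, ‖s y ^ k - s x ^ k‖ ≤ 2 * (k / N) := by
  have hcd : Continuous fun y ↦ u y / u x := by fun_prop
  have hU : {y | u y / u x ∈ Complex.slitPlane ∧ ‖Complex.log (u y / u x)‖ < 1} ∈ 𝓝 x := by
    have h1 : u x / u x ∈ Complex.slitPlane := by rw [div_self hx]; exact Complex.one_mem_slitPlane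
    refine ((hcd.tendsto x).eventually (Complex.isOpen_slitPlane.mem_nhds h1)).and ?_
    have h2 : ContinuousAt (fun y ↦ ‖Complex.log (u y / u x)‖) x :=
      (ContinuousAt.clog hcd.continuousAt h1).norm
    exact h2.tendsto.eventually_lt_const (by simp [div_self hx])
  obtain ⟨V, hV, hVc, hVU⟩ :=
    locallyConnectedSpace_iff_connected_subsets.1 inferInstance x _ hU
  refine ⟨V, hV, fun N k s hkN hs hsx y hy ↦ ?_⟩
  rcases Nat.eq_zero_or_pos N with rfl | hN
  · obtain rfl : k = 0 := by omega
    simp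
  have hN' : (N : ℂ) ≠ 0 := by exact_mod_cast hN.ne'
  have hpow : ∀ z, s z ^ N = u z := fun z ↦ by rw [← hs]; rfl
  have hsx0 : s x ≠ 0 := fun h ↦ hx (by rw [← hpow, h, zero_pow hN.ne'])
  set ℓ : X → ℂ := fun y ↦ Complex.log (u y / u x) with hℓ
  have hℓc : ContinuousOn ℓ V := fun z hz ↦
    (ContinuousAt.clog hcd.continuousAt (hVU hz).1).continuousWithinAt
  have hℓx : ℓ x = 0 := by simp [hℓ]
  set φ : X → ℂ := fun y ↦ s y / s x * Complex.exp (-ℓ y / N) with hφ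
  have hφc : ContinuousOn φ V := by fun_prop
  have hφN : MapsTo φ V {z | z ^ N = 1} := fun z hz ↦ by
    have huz : u z / u x ≠ 0 := Complex.slitPlane_ne_zero (hVU hz).1
    simp only [hφ, mem_ofPred_eq, mul_pow, div_pow, hpow]
    rw [← Complex.exp_nat_mul, mul_div_cancel₀ _ hN', Complex.exp_neg, Complex.exp_log huz,
      mul_inv_cancel₀ huz]
  have hfin : {z : ℂ | z ^ N = 1}.Finite := by
    refine (Polynomial.nthRoots N (1 : ℂ)).toFinset.finite_toSet.subset fun z hz ↦ ?_
    simpa [Polynomial.mem_nthRoots hN] using hz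
  have hφ1 : φ y = 1 := by
    rw [hVc.constant_of_mapsTo hfin.isDiscrete hφc hφN hy (mem_of_mem_nhds hV)]
    simp [hφ, hℓx, div_self hsx0]
  have hsy : s y = s x * Complex.exp (ℓ y / N) := by
    simp only [hφ, neg_div, Complex.exp_neg] at hφ1
    have := Complex.exp_ne_zero (ℓ y / N)
    field_simp at hφ1
    exact hφ1
  have hkN1 : (k / N : ℝ) ≤ 1 := by
    rw [div_le_one (by exact_mod_cast hN)]; exact_mod_cast hkN
  have hnorm : ‖(k : ℂ) * (ℓ y / N)‖ ≤ k / N := by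
    rw [norm_mul, norm_div, Complex.norm_natCast, Complex.norm_natCast, ← mul_div_assoc]
    gcongr
    have : ‖ℓ y‖ < 1 := (hVU hy).2
    nlinarith [Nat.cast_nonneg (α := ℝ) k]
  rw [hsy, mul_pow, ← Complex.exp_nat_mul, ← mul_sub_one, norm_mul, norm_pow]
  have h1 := Complex.norm_exp_sub_one_le (hnorm.trans hkN1)
  have h2 : ‖s x‖ ^ k ≤ 1 := pow_le_one₀ (norm_nonneg _) hsx
  have h3 := norm_nonneg (Complex.exp (k * (ℓ y / N)) - 1)
  nlinarith [pow_nonneg (norm_nonneg (s x)) k]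

/-- Finitely many sequences of complex numbers whose norms tend to `1` can be raised to a common
positive power so that, infinitely often, all of them are close to `1`. -/
theorem exists_pow_frequently_norm_sub_one_lt {ι : Type*} [Finite ι] {c : ℕ → ι → ℂ}
    (hc : ∀ i, Tendsto (fun n ↦ ‖c n i‖) atTop (𝓝 1)) {δ : ℝ} (hδ : 0 < δ) :
    ∃ k ≠ 0, ∃ᶠ n in atTop, ∀ i, ‖c n i ^ k - 1‖ < δ := by
  have := Fintype.ofFinite ι
  have hbdd : ∃ᶠ n in atTop, c n ∈ Metric.closedBall (0 : ι → ℂ) 2 := by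
    refine Eventually.frequently ?_
    have : ∀ᶠ n in atTop, ∀ i, ‖c n i‖ < 2 :=
      eventually_all.2 fun i ↦ (hc i).eventually_lt_const (by norm_num)
    filter_upwards [this] with n hn
    rw [mem_closedBall_zero_iff, pi_norm_le_iff_of_nonneg (by norm_num)]
    exact fun i ↦ (hn i).le
  obtain ⟨g, -, φ, hφ, hg⟩ := tendsto_subseq_of_frequently_bounded Metric.isBounded_closedBall hbdd
  have hg' : ∀ i, Tendsto (fun n ↦ c (φ n) i) atTop (𝓝 (g i)) := tendsto_pi_nhds.1 hg
  have hg1 : ∀ i, ‖g i‖ = 1 := fun i ↦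
    tendsto_nhds_unique (hg' i).norm ((hc i).comp hφ.tendsto_atTop)
  let G : ι → Circle := fun i ↦ ⟨g i, mem_sphere_zero_iff_norm.2 (hg1 i)⟩
  have hnhds : {a : ι → Circle | ∀ i, ‖(a i : ℂ) - 1‖ < δ} ∈ 𝓝 (1 : ι → Circle) := by
    refine eventually_all.2 fun i ↦ ?_
    have : Continuous fun a : ι → Circle ↦ ‖(a i : ℂ) - 1‖ := by fun_prop
    exact (this.tendsto 1).eventually_lt_const (by simpa using hδ)
  obtain ⟨k, hk, hk1⟩ := (((mapClusterPt_one_atTop_pow G).frequently hnhds).and_eventually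
    (eventually_ge_atTop 1)).exists
  refine ⟨k, by omega, ?_⟩
  have hev : ∀ᶠ n in atTop, ∀ i, ‖c (φ n) i ^ k - 1‖ < δ :=
    eventually_all.2 fun i ↦ (((hg' i).pow k).sub_const 1).norm.eventually_lt_const (hk i)
  exact hφ.tendsto_atTop.frequently hev.frequently

/-- In an algebra closed under square roots on a locally connected space, a function of norm at
most one gives rise to functions in the unit ball with the same zeros, close to one on a given
compact set where the function does not vanish. -/
theorem Subalgebra.exists_mem_norm_sub_one_le {X : Type*} [TopologicalSpace X]
    [LocallyConnectedSpace X] {A : Subalgebra ℂ C(X, ℂ)}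
    (hsqrt : ∀ f ∈ A, ∃ s ∈ A, s ^ 2 = f) {u : C(X, ℂ)} (hu : u ∈ A) (hu1 : ∀ x, ‖u x‖ ≤ 1)
    {K : Set X} (hK : IsCompact K) (hKu : ∀ x ∈ K, u x ≠ 0) {δ : ℝ} (hδ : 0 < δ) :
    ∃ p ∈ A, (∀ x, ‖p x‖ ≤ 1) ∧ (∀ x, u x = 0 → p x = 0) ∧ ∀ x ∈ K, ‖p x - 1‖ < δ := by
  have hroot : ∀ n : ℕ, ∃ s ∈ A, s ^ 2 ^ n = u := fun n ↦ by
    induction n with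
    | zero => exact ⟨u, hu, by simp⟩
    | succ n ih =>
      obtain ⟨s, hs, hsu⟩ := ih
      obtain ⟨s', hs', hss'⟩ := hsqrt s hs
      exact ⟨s', hs', by rw [pow_succ', pow_mul, hss', hsu]⟩
  choose s hsA hs using hroot
  have hpow : ∀ n x, s n x ^ 2 ^ n = u x := fun n x ↦ by rw [← hs n]; rfl
  have hnorm : ∀ n x, ‖s n x‖ ≤ 1 := fun n x ↦ by
    refine (pow_le_one_iff_of_nonneg (norm_nonneg _) (pow_ne_zero n two_ne_zero)).1 ?_
    rw [← norm_pow, hpow]; exact hu1 x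
  have hlim : ∀ x, u x ≠ 0 → Tendsto (fun n ↦ ‖s n x‖) atTop (𝓝 1) := fun x hx ↦ by
    have h1 : ∀ n, ‖s n x‖ = ‖u x‖ ^ ((2 ^ n : ℝ)⁻¹) := fun n ↦ by
      rw [← hpow n, norm_pow]
      have := Real.pow_rpow_inv_natCast (norm_nonneg (s n x)) (pow_ne_zero n two_ne_zero)
      push_cast at this
      exact this.symm
    have h2 : Tendsto (fun n : ℕ ↦ (2 ^ n : ℝ)⁻¹) atTop (𝓝 0) :=
      (tendsto_pow_atTop_atTop_of_one_lt one_lt_two).inv_tendsto_atTop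
    have h3 := (Real.continuousAt_const_rpow (norm_ne_zero_iff.2 hx) (b := 0)).tendsto.comp h2
    rw [Real.rpow_zero] at h3
    exact h3.congr fun n ↦ (h1 n).symm
  have hV : ∀ x : K, ∃ V ∈ 𝓝 (x : X), ∀ (N k : ℕ) (s : C(X, ℂ)), k ≤ N → s ^ N = u →
      ‖s x‖ ≤ 1 → ∀ y ∈ V, ‖s y ^ k - s x ^ k‖ ≤ 2 * (k / N) :=
    fun x ↦ exists_nhds_norm_pow_sub_pow_le u (hKu x x.2)
  choose V hV hVs using hV
  obtain ⟨t, ht⟩ := hK.elim_nhds_subcover' (fun x hx ↦ V ⟨x, hx⟩) fun x hx ↦ hV ⟨x, hx⟩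
  obtain ⟨k, hk0, hk⟩ := exists_pow_frequently_norm_sub_one_lt (ι := t)
    (c := fun n x ↦ s n (x : K)) (fun x ↦ hlim _ (hKu _ x.1.2)) (half_pos hδ)
  have hkn : Tendsto (fun n : ℕ ↦ 2 * ((k : ℝ) / 2 ^ n)) atTop (𝓝 0) := by
    have := (tendsto_const_nhds (x := (k : ℝ))).div_atTop
      (tendsto_pow_atTop_atTop_of_one_lt (one_lt_two (α := ℝ)))
    simpa using this.const_mul 2
  obtain ⟨n, hn, hn1, hn2⟩ := (hk.and_eventually
    ((hkn.eventually_lt_const (half_pos hδ)).and (eventually_ge_atTop k))).exists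
  refine ⟨s n ^ k, pow_mem (hsA n) k, fun x ↦ ?_, fun x hx ↦ ?_, fun y hy ↦ ?_⟩
  · rw [ContinuousMap.pow_apply, norm_pow]
    exact pow_le_one₀ (norm_nonneg _) (hnorm n x)
  · have : s n x = 0 := eq_zero_of_pow_eq_zero ((hpow n x).trans hx)
    rw [ContinuousMap.pow_apply, this, zero_pow hk0]
  · obtain ⟨x, hxt, hyx⟩ := mem_iUnion₂.1 (ht hy)
    have h1 := hVs x (2 ^ n) k (s n) (hn2.trans n.lt_two_pow_self.le) (hs n) (hnorm n x) y hyx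
    have h2 := hn ⟨x, hxt⟩
    push_cast at h1
    rw [ContinuousMap.pow_apply]
    have h3 := norm_sub_le_norm_sub_add_norm_sub (s n y ^ k) (s n x ^ k) 1
    linarith

/-- In an algebra closed under square roots on a compact locally connected space, there are almost
`[0, 1]`-valued functions vanishing with `u` and close to one on a given compact set where `u` does
not vanish. -/
theorem Subalgebra.exists_mem_norm_add_norm_one_sub_le {X : Type*} [TopologicalSpace X]
    [CompactSpace X] [LocallyConnectedSpace X] {A : Subalgebra ℂ C(X, ℂ)}
    (hsqrt : ∀ f ∈ A, ∃ s ∈ A, s ^ 2 = f) {u : C(X, ℂ)} (hu : u ∈ A)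
    {K : Set X} (hK : IsCompact K) (hKu : ∀ x ∈ K, u x ≠ 0) {ε : ℝ} (hε : 0 < ε) :
    ∃ q ∈ A, (∀ x, u x = 0 → q x = 0) ∧ (∀ x, ‖q x‖ + ‖1 - q x‖ < 1 + ε) ∧
      ∀ x ∈ K, ‖1 - q x‖ < ε := by
  obtain ⟨P, hP0, hP1, hP⟩ := exists_polynomial_disc_thin_ellipse hε
  have hcont : Continuous fun z ↦ ‖1 - P.eval z‖ := by fun_prop
  obtain ⟨δ, hδ, hPδ⟩ := Metric.eventually_nhds_iff.1
    ((hcont.tendsto 1).eventually_lt_const hP1)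
  have hc0 : ((‖u‖ + 1 : ℝ) : ℂ)⁻¹ ≠ 0 :=
    inv_ne_zero (Complex.ofReal_ne_zero.2 (by positivity))
  obtain ⟨p, hpA, hp1, hp0, hpK⟩ := Subalgebra.exists_mem_norm_sub_one_le hsqrt
    (A.smul_mem hu ((‖u‖ + 1 : ℝ) : ℂ)⁻¹)
    (fun x ↦ by
      rw [ContinuousMap.smul_apply, norm_smul, norm_inv, Complex.norm_real,
        Real.norm_of_nonneg (by positivity), inv_mul_le_one₀ (by positivity)]
      linarith [u.norm_coe_le_norm x])
    hK (fun x hx ↦ smul_ne_zero hc0 (hKu x hx)) hδ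
  refine ⟨Polynomial.aeval p P, by
    simpa [Polynomial.aeval_subalgebra_coe] using (Polynomial.aeval (⟨p, hpA⟩ : A) P).2, fun x hx ↦ ?_, fun x ↦ ?_,
    fun x hx ↦ ?_⟩ <;> rw [Polynomial.aeval_continuousMap_apply]
  · rw [hp0 x (by simp [hx]), hP0]
  · exact hP _ (hp1 x)
  · exact hPδ (by rw [dist_eq_norm]; exact hpK x hx)

/-- If every element of `A` is at distance at least `d` from `g`, there is a minimal closed set on
which this remains true. -/
theorem exists_minimal_isClosed_le_norm_sub {X : Type*} [TopologicalSpace X] [CompactSpace X]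
    {A : Set C(X, ℂ)} {g : C(X, ℂ)} {d : ℝ}
    (hg : ∀ a ∈ A, ∃ x, d ≤ ‖g x - a x‖) :
    ∃ S : Set X, Minimal (fun S ↦ IsClosed S ∧ ∀ a ∈ A, ∃ x ∈ S, d ≤ ‖g x - a x‖) S := by
  have hchains : ∀ c ⊆ {S : Set X | IsClosed S ∧ ∀ a ∈ A, ∃ x ∈ S, d ≤ ‖g x - a x‖},
      IsChain (· ⊆ ·) c → c.Nonempty →
      ∃ lb ∈ {S : Set X | IsClosed S ∧ ∀ a ∈ A, ∃ x ∈ S, d ≤ ‖g x - a x‖}, ∀ s ∈ c, lb ⊆ s := by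
    intro c hc hchain hne
    refine ⟨⋂₀ c, ⟨isClosed_sInter fun T hT ↦ (hc hT).1, fun a ha ↦ ?_⟩,
      fun T hT ↦ sInter_subset_of_mem hT⟩
    have hcl : IsClosed {x | d ≤ ‖g x - a x‖} := isClosed_le continuous_const (by fun_prop)
    have := hne.to_subtype
    have hcl' : ∀ T : c, IsClosed ((T : Set X) ∩ {x | d ≤ ‖g x - a x‖}) := fun T ↦
      (hc T.2).1.inter hcl
    obtain ⟨x, hx⟩ := IsCompact.nonempty_iInter_of_directed_nonempty_isCompact_isClosed
      (fun T : c ↦ (T : Set X) ∩ {x | d ≤ ‖g x - a x‖}) (fun T T' ↦ by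
        rcases hchain.total T.2 T'.2 with h | h
        · exact ⟨T, subset_rfl, inter_subset_inter_left _ h⟩
        · exact ⟨T', inter_subset_inter_left _ h, subset_rfl⟩)
      (fun T ↦ (hc T.2).2 a ha) (fun T ↦ (hcl' T).isCompact) hcl'
    rw [mem_iInter] at hx
    exact ⟨x, mem_sInter.2 fun T hT ↦ (hx ⟨T, hT⟩).1, (hx ⟨_, hne.some_mem⟩).2⟩
  obtain ⟨S, -, hS⟩ := zorn_superset_nonempty _ hchains univ
    ⟨isClosed_univ, fun a ha ↦ by simpa using hg a ha⟩
  exact ⟨S, hS⟩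

/-- On a minimal set of bad approximation by an algebra closed under square roots, the algebra
has no zero divisors. -/
theorem Subalgebra.eqOn_zero_or_eqOn_zero_of_mul_eq_zero {X : Type*} [TopologicalSpace X]
    [CompactSpace X] [LocallyConnectedSpace X] {A : Subalgebra ℂ C(X, ℂ)}
    (hsqrt : ∀ f ∈ A, ∃ s ∈ A, s ^ 2 = f) {g : C(X, ℂ)} {d : ℝ} (hd : 0 < d) {S : Set X}
    (hS : Minimal (fun S ↦ IsClosed S ∧ ∀ a ∈ A, ∃ x ∈ S, d ≤ ‖g x - a x‖) S)
    {u v : C(X, ℂ)} (hu : u ∈ A) (huv : u * v = 0) :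
    (∀ x ∈ S, u x = 0) ∨ ∀ x ∈ S, v x = 0 := by
  have hzero : ∀ w : C(X, ℂ), (∀ x ∈ S, w x = 0) ∨
      ∃ a ∈ A, ∀ x ∈ S, w x = 0 → ‖g x - a x‖ < d := fun w ↦ by
    by_contra! hw
    obtain ⟨⟨x, hxS, hx⟩, hw⟩ := hw
    have hcl : IsClosed (S ∩ {x | w x = 0}) :=
      hS.prop.1.inter (isClosed_eq w.continuous continuous_const)
    refine hx (hS.le_of_le ⟨hcl, fun a ha ↦ ?_⟩ inter_subset_left hxS).2
    obtain ⟨y, hy, hy0, hyd⟩ := hw a ha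
    exact ⟨y, ⟨hy, hy0⟩, hyd⟩
  rcases hzero u with h | ⟨a, haA, ha⟩
  · exact Or.inl h
  rcases hzero v with h | ⟨b, hbA, hb⟩
  · exact Or.inr h
  exfalso
  have hvanish : ∀ x, u x = 0 ∨ v x = 0 := fun x ↦ by
    simpa using DFunLike.congr_fun huv x
  have hlevel : ∀ w c : C(X, ℂ), (∀ x ∈ S, w x = 0 → ‖g x - c x‖ < d) →
      ∃ θ, 0 < θ ∧ θ < d ∧ ∀ x ∈ S, w x = 0 → ‖g x - c x‖ < θ := fun w c hc ↦ by
    have hcomp : IsCompact (S ∩ {x | w x = 0}) :=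
      (hS.prop.1.inter (isClosed_eq w.continuous continuous_const)).isCompact
    rcases (S ∩ {x | w x = 0}).eq_empty_or_nonempty with he | hne
    · refine ⟨d / 2, by positivity, by linarith, fun x hx hwx ↦ ?_⟩
      exact ((eq_empty_iff_forall_notMem.1 he) x ⟨hx, hwx⟩).elim
    · obtain ⟨y, ⟨hyS, hy0⟩, hy⟩ := hcomp.exists_isMaxOn hne
        (f := fun x ↦ ‖g x - c x‖) (by fun_prop)
      have hyd := hc y hyS hy0
      refine ⟨(‖g y - c y‖ + d) / 2, by positivity, by linarith, fun x hx hwx ↦ ?_⟩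
      have : ‖g x - c x‖ ≤ ‖g y - c y‖ := hy ⟨hx, hwx⟩
      linarith
  obtain ⟨θ₁, hθ₁, hθ₁d, ha'⟩ := hlevel u a ha
  obtain ⟨θ₂, hθ₂, hθ₂d, hb'⟩ := hlevel v b hb
  obtain ⟨θ, hθ0, hθd, h1θ, h2θ⟩ : ∃ θ, 0 < θ ∧ θ < d ∧ θ₁ ≤ θ ∧ θ₂ ≤ θ :=
    ⟨max θ₁ θ₂, by positivity, max_lt hθ₁d hθ₂d, le_max_left _ _, le_max_right _ _⟩
  set M := ‖g - a‖ with hM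
  have hM0 : 0 ≤ M := norm_nonneg _
  obtain ⟨ε, hε, hεd⟩ : ∃ ε > 0, θ * (1 + ε) + ε * M < d := by
    refine ⟨(d - θ) / (2 * (θ + M)), by have := sub_pos.2 hθd; positivity, ?_⟩
    have : (d - θ) / (2 * (θ + M)) * (θ + M) = (d - θ) / 2 := by field_simp
    nlinarith
  have hKc : IsCompact (S ∩ {x | θ ≤ ‖g x - a x‖}) :=
    (hS.prop.1.inter (isClosed_le continuous_const (by fun_prop))).isCompact
  obtain ⟨q, hqA, hq0, hq, hqK⟩ := Subalgebra.exists_mem_norm_add_norm_one_sub_le hsqrt hu hKc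
    (fun x hx h0 ↦ by
      have h1 := ha' x hx.1 h0
      have h2 : θ ≤ ‖g x - a x‖ := hx.2
      linarith) hε
  obtain ⟨x, hxS, hx⟩ := hS.prop.2 (q * b + (1 - q) * a)
    (add_mem (mul_mem hqA hbA) (mul_mem (sub_mem (one_mem A) hqA) haA))
  have hle : ‖g x - (q * b + (1 - q) * a) x‖ ≤
      ‖q x‖ * ‖g x - b x‖ + ‖1 - q x‖ * ‖g x - a x‖ := by
    rw [← norm_mul, ← norm_mul]
    have heq : g x - (q * b + (1 - q) * a) x =
        q x * (g x - b x) + (1 - q x) * (g x - a x) := by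
      change g x - (q x * b x + (1 - q x) * a x) = _
      ring
    rw [heq]
    exact norm_add_le _ _
  have hqx := hq x
  have hn1 := norm_nonneg (q x)
  have hn2 := norm_nonneg (1 - q x)
  have hMx : ‖g x - a x‖ ≤ M := (g - a).norm_coe_le_norm x
  rcases eq_or_ne (u x) 0 with hux | hux
  · have := ha' x hxS hux
    rw [hq0 x hux] at hle
    simp only [norm_zero, zero_mul, sub_zero, norm_one, one_mul, zero_add] at hle
    linarith
  · have hbx := hb' x hxS ((hvanish x).resolve_left hux)
    rcases lt_or_ge ‖g x - a x‖ θ with hlt | hge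
    · nlinarith
    · have := hqK x ⟨hxS, hge⟩
      nlinarith [norm_nonneg (g x - a x)]

/-- A closed subalgebra of `C(X, ℂ)`, with `X` compact and locally connected, which separates points
and is closed under square roots is everything. -/
theorem Subalgebra.eq_top_of_forall_exists_sq_eq {X : Type*} [TopologicalSpace X] [CompactSpace X]
    [LocallyConnectedSpace X] {A : Subalgebra ℂ C(X, ℂ)} (hA : IsClosed (A : Set C(X, ℂ)))
    (hsep : ∀ x y : X, x ≠ y → ∃ f ∈ A, f x ≠ f y) (hsqrt : ∀ f ∈ A, ∃ s ∈ A, s ^ 2 = f) :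
    A = ⊤ := by
  refine Algebra.eq_top_iff.2 fun g ↦ ?_
  by_contra hgA
  have hne : (A : Set C(X, ℂ)).Nonempty := ⟨0, A.zero_mem⟩
  set d := Metric.infDist g A with hd_def
  have hd : 0 < d := (hA.notMem_iff_infDist_pos hne).1 hgA
  obtain ⟨S, hS⟩ := exists_minimal_isClosed_le_norm_sub (d := d) (g := g) fun a ha ↦ by
    by_contra! hlt
    have h1 : d ≤ ‖g - a‖ := by rw [← dist_eq_norm]; exact Metric.infDist_le_dist_of_mem ha
    exact h1.not_gt ((ContinuousMap.norm_lt_iff _ hd).2 hlt)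
  obtain ⟨x, hxS, -⟩ := hS.prop.2 0 A.zero_mem
  obtain ⟨y, hyS, hy⟩ := hS.prop.2 (algebraMap ℂ _ (g x)) (A.algebraMap_mem _)
  have hxy : x ≠ y := by
    rintro rfl
    have hgx : algebraMap ℂ C(X, ℂ) (g x) x = g x := rfl
    rw [hgx, sub_self, norm_zero] at hy
    linarith
  obtain ⟨f, hfA, hf⟩ := hsep x y hxy
  choose s hsA hs using fun z : ℂ ↦ hsqrt (f - algebraMap ℂ _ z) (sub_mem hfA (A.algebraMap_mem z))
  have hsx : ∀ z w, s z w ^ 2 = f w - z := fun z w ↦ by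
    simpa using DFunLike.congr_fun (hs z) w
  refine hf (eq_of_continuous_sqrt_mul (p := fun z ↦ s z x * s z y) ?_ fun z ↦ ?_)
  · refine continuous_iff_continuousAt.2 fun z ↦ (tendsto_iff_ultrafilter _ _ _).2 fun 𝒰 h𝒰 ↦ ?_
    have hlim : Tendsto (fun r : C(X, ℂ) ↦ r ^ 2) (𝒰.map s : Ultrafilter C(X, ℂ))
        (𝓝 (f - algebraMap ℂ _ z)) := by
      rw [Ultrafilter.coe_map, tendsto_map'_iff]
      have hcont : Continuous fun w : ℂ ↦ f - algebraMap ℂ C(X, ℂ) w :=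
        continuous_const.sub (continuous_algebraMap ℂ C(X, ℂ))
      exact ((hcont.tendsto z).mono_left h𝒰).congr fun w ↦ (hs w).symm
    obtain ⟨r, hr, hr𝒰⟩ := (isProperMap_iff_ultrafilter.1 (isProperMap_sq_continuousMap X)).2 hlim
    have hr𝒰' : Tendsto s 𝒰 (𝓝 r) := hr𝒰
    have hrA : r ∈ A := hA.mem_of_tendsto hr𝒰' (Eventually.of_forall hsA)
    have hval : r x * r y = s z x * s z y := by
      have hr' : r ^ 2 = s z ^ 2 := hr.trans (hs z).symm
      rcases Subalgebra.eqOn_zero_or_eqOn_zero_of_mul_eq_zero hsqrt hd hS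
        (sub_mem hrA (hsA z)) (v := r + s z)
        (by rw [mul_comm, ← sq_sub_sq, hr', sub_self]) with h | h
      · rw [sub_eq_zero.1 (h x hxS), sub_eq_zero.1 (h y hyS)]
      · rw [eq_neg_of_add_eq_zero_left (h x hxS), eq_neg_of_add_eq_zero_left (h y hyS), neg_mul_neg]
    have hcont : Continuous fun r : C(X, ℂ) ↦ r x * r y := by fun_prop
    simpa only [hval] using! (hcont.tendsto r).comp hr𝒰'
  · simp only [mul_pow, hsx]

/-- Čirka's theorem: a uniform algebra with dense squares on a compact, Hausdorff,
locally connected space is all of `C(E, ℂ)`. -/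
theorem stmt_4 (E : Type*) [TopologicalSpace E] [CompactSpace E] [T2Space E]
    [LocallyConnectedSpace E] (B : Subalgebra ℂ C(E, ℂ))
    (hclosed : IsClosed (B : Set C(E, ℂ)))
    (hsep : ∀ x y : E, x ≠ y → ∃ f ∈ B, f x ≠ f y)
    (hsq : (B : Set C(E, ℂ)) ⊆ closure {f : C(E, ℂ) | ∃ b ∈ B, f = b ^ 2}) :
    B = ⊤ := by
  refine Subalgebra.eq_top_of_forall_exists_sq_eq hclosed hsep fun f hf ↦ ?_
  have himage : {f : C(E, ℂ) | ∃ b ∈ B, f = b ^ 2} = (fun s ↦ s ^ 2) '' (B : Set C(E, ℂ)) := by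
    ext f
    simp [eq_comm]
  have hmem := hsq hf
  rwa [himage, ((isProperMap_sq_continuousMap E).isClosedMap _ hclosed).closure_eq] at hmem
end

section
/- Let A be a unital commutative Banach algebra over ℂ with dense invertibles and suppose {a² : a ∈ A} is dense in A, and suppose the maximal ideal space 𝔐_A is locally connected. Then the Gelfand transform image of A is uniformly dense in C(𝔐_A, ℂ). -/
open Filter Topology

/-- On a preconnected set, a continuous function whose `n`-th power stays close to `w` stays
close to a single `n`-th root of `w`. -/
theorem IsPreconnected.exists_root_near {X : Type*} [TopologicalSpace X] {V : Set X}
    (hV : IsPreconnected V) {u : X → ℂ} (hu : ContinuousOn u V) {n : ℕ} (hn : n ≠ 0) {w : ℂ}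
    (hw : w ≠ 0) (h : ∀ x ∈ V, ‖u x ^ n - w‖ ≤ ‖w‖ / 2) :
    ∃ ξ : ℂ, ξ ^ n = w ∧ ∀ x ∈ V, ‖u x - ξ‖ ≤ 2 * ‖ξ‖ / n := by
  have hw' : 0 < ‖w‖ := norm_pos_iff.2 hw
  have hn' : (1 : ℝ) ≤ n := by exact_mod_cast Nat.one_le_iff_ne_zero.2 hn
  have hnC : (n : ℂ) ≠ 0 := Nat.cast_ne_zero.2 hn
  have hz : ∀ x ∈ V, ‖(u x ^ n - w) / w‖ ≤ 1 / 2 := fun x hx ↦ by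
    rw [norm_div, div_le_iff₀ hw']
    linarith [h x hx]
  have hslit : ∀ x ∈ V, 1 + (u x ^ n - w) / w ∈ Complex.slitPlane := fun x hx ↦
    Complex.mem_slitPlane_of_norm_lt_one ((hz x hx).trans_lt (by norm_num))
  set e : X → ℂ := fun x ↦ Complex.exp (Complex.log (1 + (u x ^ n - w) / w) / n) with he
  have he_cont : ContinuousOn e V := by
    refine Complex.continuous_exp.comp_continuousOn (ContinuousOn.div_const ?_ _)
    exact ContinuousOn.clog (by fun_prop) hslit
  have he_pow : ∀ x ∈ V, e x ^ n = u x ^ n / w := fun x hx ↦ by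
    rw [he, ← Complex.exp_nat_mul, mul_div_cancel₀ _ hnC,
      Complex.exp_log (Complex.slitPlane_ne_zero (hslit x hx))]
    field_simp
    ring
  have he_ne : ∀ x, e x ≠ 0 := fun x ↦ Complex.exp_ne_zero _
  have hfin : {ξ : ℂ | ξ ^ n = w}.Finite :=
    (Polynomial.nthRootsFinset n w).finite_toSet.subset fun ξ hξ ↦ by
      simpa [Polynomial.mem_nthRootsFinset (Nat.pos_of_ne_zero hn)] using hξ
  obtain ⟨ξ, hξ, hξV⟩ := hV.eqOn_const_of_mapsTo (f := fun x ↦ u x / e x) hfin.isDiscrete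
    (hu.div he_cont fun x _ ↦ he_ne x)
    (fun x hx ↦ by
      have h1 : u x ^ n ≠ 0 := by
        have := pow_ne_zero n (he_ne x)
        rw [he_pow x hx] at this
        exact (div_ne_zero_iff.1 this).1
      show (u x / e x) ^ n = w
      rw [div_pow, he_pow x hx, div_div_cancel₀ h1])
    (IsAlgClosed.exists_pow_nat_eq w (Nat.pos_of_ne_zero hn))
  refine ⟨ξ, hξ, fun x hx ↦ ?_⟩
  have h1 : u x = ξ * e x := (div_eq_iff (he_ne x)).1 (hξV hx)
  have h2 : ‖Complex.log (1 + (u x ^ n - w) / w) / n‖ ≤ 1 / n := by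
    rw [norm_div, Complex.norm_natCast]
    gcongr
    linarith [Complex.norm_log_one_add_half_le_self (hz x hx), hz x hx]
  have h3 : ‖e x - 1‖ ≤ 2 * (1 / n) :=
    (Complex.norm_exp_sub_one_le (h2.trans (by rw [div_le_one] <;> linarith))).trans (by gcongr)
  calc ‖u x - ξ‖ = ‖ξ‖ * ‖e x - 1‖ := by rw [h1, ← norm_mul, mul_sub, mul_one]
    _ ≤ ‖ξ‖ * (2 * (1 / n)) := by gcongr
    _ = 2 * ‖ξ‖ / n := by ring

theorem norm_prod_sub_sub_prod_sub_le {ι : Type*} (t : Finset ι) (c : ι → ℂ) {D : ℝ}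
    (hc : ∀ i ∈ t, ‖c i‖ ≤ 1) {z w : ℂ} (hz : ‖z‖ ≤ D) (hw : ‖w‖ ≤ D) :
    ‖∏ i ∈ t, (z - c i) - ∏ i ∈ t, (w - c i)‖ ≤ t.card * (D + 1) ^ t.card * ‖z - w‖ := by
  classical
  have hD : 0 ≤ D := (norm_nonneg z).trans hz
  induction t using Finset.induction_on with
  | empty => simp
  | insert a t ha ih =>
    have hca := hc a (Finset.mem_insert_self _ _)
    have hct : ∀ i ∈ t, ‖c i‖ ≤ 1 := fun i hi ↦ hc i (Finset.mem_insert_of_mem hi)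
    have h1 : ‖∏ i ∈ t, (w - c i)‖ ≤ (D + 1) ^ t.card := by
      rw [norm_prod, ← Finset.prod_const]
      exact Finset.prod_le_prod (fun _ _ ↦ norm_nonneg _)
        fun i hi ↦ (norm_sub_le _ _).trans (add_le_add hw (hct i hi))
    have h2 : ‖z - c a‖ ≤ D + 1 := (norm_sub_le _ _).trans (add_le_add hz hca)
    have h3 : (1 : ℝ) ≤ D + 1 := by linarith
    rw [Finset.prod_insert ha, Finset.prod_insert ha, Finset.card_insert_of_notMem ha]
    calc _ = ‖(z - c a) * (∏ i ∈ t, (z - c i) - ∏ i ∈ t, (w - c i))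
            + (z - w) * ∏ i ∈ t, (w - c i)‖ := by ring_nf
      _ ≤ (D + 1) * (t.card * (D + 1) ^ t.card * ‖z - w‖) + ‖z - w‖ * (D + 1) ^ t.card := by
        refine (norm_add_le _ _).trans ?_
        rw [norm_mul, norm_mul]
        gcongr
        exact ih hct
      _ ≤ (D + 1) * (t.card * (D + 1) ^ t.card * ‖z - w‖)
            + ‖z - w‖ * (D + 1) ^ (t.card + 1) := by
        gcongr
        omega
      _ = _ := by push_cast; ring

theorem exists_norm_pow_sub_pow_le (T : ℕ) {ε : ℝ} (hε : 0 < ε) :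
    ∃ δ : ℝ, 0 < δ ∧ δ < 1 ∧ ∀ n ≤ T, ∀ z s : ℂ, ‖s‖ ≤ 1 → ‖z - s‖ ≤ δ →
      ‖z ^ n - s ^ n‖ ≤ ε := by
  refine ⟨min (1 / 2) (ε / (T * 2 ^ T + 1)), by positivity, by
    exact (min_le_left _ _).trans_lt (by norm_num), fun n hn z s hs hzs ↦ ?_⟩
  have hz : ‖z‖ ≤ 2 := by
    have := norm_le_norm_add_norm_sub' z s
    linarith [hzs.trans (min_le_left _ _)]
  have key : ∀ n : ℕ, ‖z ^ n - s ^ n‖ ≤ n * 2 ^ n * ‖z - s‖ := by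
    intro n
    induction n with
    | zero => simp
    | succ k ih =>
      calc ‖z ^ (k + 1) - s ^ (k + 1)‖ = ‖z ^ k * (z - s) + (z ^ k - s ^ k) * s‖ := by ring_nf
        _ ≤ 2 ^ k * ‖z - s‖ + (k * 2 ^ k * ‖z - s‖) * 1 := by
          refine (norm_add_le _ _).trans ?_
          rw [norm_mul, norm_mul, norm_pow]
          gcongr
        _ ≤ _ := by
          push_cast
          rw [pow_succ]
          have : 0 ≤ 2 ^ k * ‖z - s‖ := by positivity
          nlinarith [mul_nonneg (Nat.cast_nonneg (α := ℝ) k) this]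
  calc ‖z ^ n - s ^ n‖ ≤ n * 2 ^ n * ‖z - s‖ := key n
    _ ≤ T * 2 ^ T * (ε / (T * 2 ^ T + 1)) := by
      gcongr
      · norm_num
      · exact hzs.trans (min_le_right _ _)
    _ ≤ ε := by
      rw [mul_div_assoc', div_le_iff₀ (by positivity)]
      nlinarith

/-- Simultaneous recurrence on a finite torus, with a uniform bound on the return time. -/
theorem exists_uniform_norm_pow_sub_one_le (ι : Type*) [Finite ι] {ε : ℝ} (hε : 0 < ε) :
    ∃ T : ℕ, ∀ s : ι → ℂ, (∀ i, ‖s i‖ = 1) → ∃ n, n ≠ 0 ∧ n ≤ T ∧ ∀ i, ‖s i ^ n - 1‖ ≤ ε := by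
  classical
  have := Fintype.ofFinite ι
  have hK : IsCompact (Set.univ.pi fun _ : ι ↦ Metric.sphere (0 : ℂ) 1) :=
    isCompact_univ_pi fun _ ↦ isCompact_sphere _ _
  obtain ⟨t, -, ht⟩ := hK.elim_nhds_subcover (fun p ↦ Metric.ball p (ε / 2))
    fun p _ ↦ Metric.ball_mem_nhds p (by positivity)
  refine ⟨t.card, fun s hs ↦ ?_⟩
  have hmem : ∀ k : ℕ, ∃ p ∈ t, s ^ k ∈ Metric.ball p (ε / 2) := fun k ↦ by
    have : s ^ k ∈ Set.univ.pi fun _ : ι ↦ Metric.sphere (0 : ℂ) 1 := fun i _ ↦ by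
      simp [hs i]
    simpa using ht this
  choose p hpt hp using hmem
  have hmain : ∀ i j, i < j → j ≤ t.card → p i = p j →
      ∃ n, n ≠ 0 ∧ n ≤ t.card ∧ ∀ l, ‖s l ^ n - 1‖ ≤ ε := fun i j hij hj hpij ↦ by
    refine ⟨j - i, by omega, by omega, fun l ↦ ?_⟩
    have h1 : dist (s ^ j) (s ^ i) < ε := by
      have h2 := hp i
      have h3 := hp j
      rw [hpij, Metric.mem_ball] at h2
      rw [Metric.mem_ball] at h3
      linarith [dist_triangle_right (s ^ j) (s ^ i) (p j)]
    have h4 : ‖s l ^ j - s l ^ i‖ ≤ ε := by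
      have := (dist_le_pi_dist (s ^ j) (s ^ i) l).trans h1.le
      rwa [dist_eq_norm] at this
    calc ‖s l ^ (j - i) - 1‖ = ‖s l ^ i * (s l ^ (j - i) - 1)‖ := by simp [hs l]
      _ = ‖s l ^ j - s l ^ i‖ := by rw [mul_sub, mul_one, ← pow_add, Nat.add_sub_cancel' hij.le]
      _ ≤ ε := h4
  obtain ⟨i, hi, j, hj, hne, hij⟩ := Finset.exists_ne_map_eq_of_card_lt_of_maps_to
    (s := Finset.range (t.card + 1)) (t := t) (f := p) (by simp) (fun k _ ↦ hpt k)
  rw [Finset.mem_range] at hi hj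
  rcases lt_or_gt_of_ne hne with h | h
  · exact hmain i j h (by omega) hij
  · exact hmain j i h (by omega) hij.symm

theorem IsCompact.exists_finset_cover_isPreconnected {X : Type*} [TopologicalSpace X]
    [LocallyConnectedSpace X] {K : Set X} (hK : IsCompact K) {U : X → Set X}
    (hU : ∀ x ∈ K, U x ∈ 𝓝 x) :
    ∃ (t : Finset X) (V : X → Set X), (∀ y ∈ t, y ∈ V y ∧ IsPreconnected (V y) ∧ V y ⊆ U y) ∧
      ∀ x ∈ K, ∃ y ∈ t, x ∈ V y := by
  have h : ∀ x, ∃ V ∈ 𝓝 x, x ∈ K → x ∈ V ∧ IsPreconnected V ∧ V ⊆ U x := fun x ↦ by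
    by_cases hx : x ∈ K
    · obtain ⟨V, ⟨hVo, hxV, hVc⟩, hVU⟩ :=
        (LocallyConnectedSpace.open_connected_basis x).mem_iff.1 (hU x hx)
      exact ⟨V, hVo.mem_nhds hxV, fun _ ↦ ⟨hxV, hVc.isPreconnected, hVU⟩⟩
    · exact ⟨Set.univ, univ_mem, fun h ↦ (hx h).elim⟩
  choose V hV hVK using h
  obtain ⟨t, htK, ht⟩ := hK.elim_nhds_subcover V fun x _ ↦ hV x
  exact ⟨t, V, fun y hy ↦ hVK y (htK y hy), fun x hx ↦ by simpa using ht hx⟩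

theorem Complex.norm_eq_one_of_norm_pow_eq_one {c : ℂ} {n : ℕ} (hn : n ≠ 0)
    (h : ‖c ^ n‖ = 1) : ‖c‖ = 1 := by
  rw [norm_pow] at h
  exact (pow_eq_one_iff_of_nonneg (norm_nonneg _) hn).1 h

/-- An algebra with approximate roots contains functions that are small on `{‖f‖ ≤ a}` and are
bounded below and of small oscillation on each member of a finite preconnected cover of
`{b ≤ ‖f‖}`; the cover and the bounds do not depend on how small the functions are on
`{‖f‖ ≤ a}`. They are products of `g - cᵢ`, where `g ^ N` is close to `1 - f ^ N` for large `N`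
and `g` is close to the constants `cᵢ` on a cover of `{‖f‖ ≤ a}`. -/
theorem exists_collapse {X : Type*} [TopologicalSpace X] [CompactSpace X]
    [LocallyConnectedSpace X] {S : Subalgebra ℂ C(X, ℂ)}
    (hS : ∀ f ∈ S, ∀ (n : ℕ) (τ : ℝ), 0 < τ → ∃ g ∈ S, ∀ x, ‖g x ^ 2 ^ n - f x‖ ≤ τ)
    {f : C(X, ℂ)} (hf : f ∈ S) {a b : ℝ} (ha0 : 0 ≤ a) (ha : a < 1) (hb : 1 < b) :
    ∃ (D η : ℝ) (t : Finset X) (W : X → Set X), 0 < η ∧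
      (∀ y ∈ t, y ∈ W y ∧ IsPreconnected (W y)) ∧ (∀ x, b ≤ ‖f x‖ → ∃ y ∈ t, x ∈ W y) ∧
      ∀ ε > 0, ∃ q ∈ S, (∀ x, ‖q x‖ ≤ D) ∧ (∀ x, ‖f x‖ ≤ a → ‖q x‖ ≤ ε) ∧
        ∀ y ∈ t, η ≤ ‖q y‖ ∧ ∀ x ∈ W y, ‖q x - q y‖ ≤ η / 4 := by
  have hF : ∀ x, ‖f x‖ ≤ ‖f‖ := f.norm_coe_le_norm
  have hF0 : 0 ≤ ‖f‖ := norm_nonneg f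
  set F := ‖f‖
  have hfc : Continuous fun x ↦ ‖f x‖ := by fun_prop
  obtain ⟨t₀, V, hV, hVK⟩ :=
    (isClosed_le hfc continuous_const : IsClosed {x | ‖f x‖ ≤ a}).isCompact
      |>.exists_finset_cover_isPreconnected (U := fun _ ↦ {x | ‖f x‖ < (a + 1) / 2})
      fun x hx ↦ (isOpen_lt hfc continuous_const).mem_nhds
        (show ‖f x‖ < (a + 1) / 2 by linarith [show ‖f x‖ ≤ a from hx])
  set m := t₀.card with hm
  set L : ℝ := m * (F + 2 + 1) ^ m with hL
  have hL0 : 0 ≤ L := by positivity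
  set β : ℝ := (b - 1) / 4 with hβ
  have hβ0 : 0 < β := by rw [hβ]; linarith
  set η : ℝ := β ^ m with hη
  have hη0 : 0 < η := by positivity
  set σ : ℝ := η / (8 * (L + 1)) with hσ
  have hσ0 : 0 < σ := by positivity
  have hLσ : L * σ ≤ η / 8 := by
    rw [hσ, mul_div_assoc', div_le_div_iff₀ (by positivity) (by norm_num)]
    nlinarith
  obtain ⟨t, W, hW, hWK⟩ :=
    (isClosed_le continuous_const hfc : IsClosed {x | b ≤ ‖f x‖}).isCompact
      |>.exists_finset_cover_isPreconnected
        (U := fun y ↦ {x | (1 + b) / 2 < ‖f x‖} ∩ {x | ‖f x - f y‖ < σ})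
      fun x hx ↦ inter_mem
        ((isOpen_lt continuous_const hfc).mem_nhds
          (show (1 + b) / 2 < ‖f x‖ by linarith [show b ≤ ‖f x‖ from hx]))
        ((isOpen_lt (by fun_prop) continuous_const).mem_nhds
          (show ‖f x - f x‖ < σ by simpa using hσ0))
  refine ⟨(F + 2 + 1) ^ m, η, t, W, hη0, fun y hy ↦ ⟨(hW y hy).1, (hW y hy).2.1⟩, hWK,
    fun ε hε ↦ ?_⟩
  have h2 : Tendsto (fun n : ℕ ↦ 2 ^ n) atTop (atTop : Filter ℕ) :=
    tendsto_pow_atTop_atTop_of_one_lt one_lt_two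
  have hinv : ∀ (C δ : ℝ), 0 < δ → ∀ᶠ n : ℕ in atTop, C / ((2 ^ n : ℕ) : ℝ) ≤ δ := fun C δ hδ ↦
    h2.eventually (((tendsto_const_div_atTop_nhds_zero_nat C).eventually_lt_const hδ).mono
      fun _ h ↦ h.le)
  have e1 : ∀ᶠ n : ℕ in atTop, ((a + 1) / 2) ^ (2 ^ n) ≤ 1 / 4 :=
    h2.eventually (((tendsto_pow_atTop_nhds_zero_of_lt_one (by linarith)
      (by linarith)).eventually_lt_const (by norm_num)).mono fun _ h ↦ h.le)
  have e2 : ∀ᶠ n : ℕ in atTop, 4 ≤ ((1 + b) / 2) ^ (2 ^ n) :=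
    h2.eventually ((tendsto_pow_atTop_atTop_of_one_lt (by linarith)).eventually_ge_atTop 4)
  obtain ⟨n, e1, e2, e3, e4, e5⟩ := (e1.and (e2.and ((hinv (2 * F) β hβ0).and
    ((hinv (L * (4 * F)) (η / 8) (by positivity)).and (hinv (L * 2) ε hε))))).exists
  set N := 2 ^ n with hN
  have hN0 : N ≠ 0 := by positivity
  obtain ⟨g, hg, hgf⟩ := hS (1 - f ^ N) (sub_mem (one_mem S) (pow_mem hf N)) n (1 / 4)
    (by norm_num)
  replace hgf : ∀ x, ‖g x ^ N - (1 - f x ^ N)‖ ≤ 1 / 4 := fun x ↦ by simpa using hgf x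
  have hgD : ∀ x, ‖g x‖ ≤ F + 2 := fun x ↦ by
    refine le_of_pow_le_pow_left₀ hN0 (by positivity) ?_
    calc ‖g x‖ ^ N = ‖(g x ^ N - (1 - f x ^ N)) + (1 - f x ^ N)‖ := by rw [sub_add_cancel, norm_pow]
      _ ≤ 1 / 4 + (1 + ‖f x‖ ^ N) := by
        refine (norm_add_le _ _).trans (add_le_add (hgf x) ((norm_sub_le _ _).trans ?_))
        simp
      _ ≤ F ^ N + 2 ^ N := by
        have h3 : ‖f x‖ ^ N ≤ F ^ N := by gcongr; exact hF x
        have h4 : (2 : ℝ) ^ 1 ≤ 2 ^ N :=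
          pow_le_pow_right₀ (by norm_num) (Nat.one_le_iff_ne_zero.2 hN0)
        linarith
      _ ≤ (F + 2) ^ N := pow_add_pow_le hF0 (by norm_num) hN0
  have hc : ∀ i, ∃ c : ℂ, i ∈ t₀ → ‖c‖ = 1 ∧ ∀ x ∈ V i, ‖g x - c‖ ≤ 2 / N := fun i ↦ by
    by_cases hi : i ∈ t₀
    · obtain ⟨-, hVc, hVU⟩ := hV i hi
      obtain ⟨c, hc1, hc⟩ := hVc.exists_root_near (u := g) (by fun_prop) hN0 one_ne_zero
        fun x hx ↦ by
          have hx' : ‖f x‖ < (a + 1) / 2 := hVU hx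
          have h3 : ‖f x ^ N‖ ≤ 1 / 4 := by
            rw [norm_pow]
            exact (pow_le_pow_left₀ (norm_nonneg _) hx'.le N).trans e1
          calc ‖g x ^ N - 1‖ = ‖(g x ^ N - (1 - f x ^ N)) - f x ^ N‖ := by ring_nf
            _ ≤ 1 / 4 + 1 / 4 := (norm_sub_le _ _).trans (add_le_add (hgf x) h3)
            _ = ‖(1 : ℂ)‖ / 2 := by norm_num
      have hc2 : ‖c‖ = 1 := Complex.norm_eq_one_of_norm_pow_eq_one hN0 (by rw [hc1, norm_one])
      exact ⟨c, fun _ ↦ ⟨hc2, by simpa [hc2] using hc⟩⟩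
    · exact ⟨0, fun h ↦ (hi h).elim⟩
  choose c hc using hc
  have hc1 : ∀ i ∈ t₀, ‖c i‖ ≤ 1 := fun i hi ↦ (hc i hi).1.le
  have hω : ∀ y ∈ t, ∃ ω : ℂ, ‖ω‖ = 1 ∧ ∀ x ∈ W y, ‖g x - ω * f x‖ ≤ 2 * F / N := fun y hy ↦ by
    obtain ⟨-, hWc, hWU⟩ := hW y hy
    have hfx : ∀ x ∈ W y, f x ≠ 0 := fun x hx ↦ by
      rw [← norm_pos_iff]
      have : (1 + b) / 2 < ‖f x‖ := (hWU hx).1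
      linarith
    obtain ⟨ω, hω1, hω⟩ := hWc.exists_root_near (u := fun x ↦ g x / f x)
      (ContinuousOn.div (by fun_prop) (by fun_prop) hfx) hN0 (neg_ne_zero.2 one_ne_zero)
      fun x hx ↦ by
        have hx' : (1 + b) / 2 < ‖f x‖ := (hWU hx).1
        have h3 : 4 ≤ ‖f x‖ ^ N := e2.trans (pow_le_pow_left₀ (by linarith) hx'.le N)
        have h4 : ‖g x ^ N + f x ^ N‖ ≤ 2 := by
          calc ‖g x ^ N + f x ^ N‖ = ‖(g x ^ N - (1 - f x ^ N)) + 1‖ := by ring_nf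
            _ ≤ 1 / 4 + 1 := (norm_add_le _ _).trans (add_le_add (hgf x) (by simp))
            _ ≤ 2 := by norm_num
        have h5 : (g x / f x) ^ N - -1 = (g x ^ N + f x ^ N) / f x ^ N := by
          have := pow_ne_zero N (hfx x hx)
          rw [div_pow]
          field_simp
          ring
        rw [h5, norm_div, norm_pow, norm_neg, norm_one, div_le_iff₀ (by linarith)]
        linarith
    have hω2 : ‖ω‖ = 1 :=
      Complex.norm_eq_one_of_norm_pow_eq_one hN0 (by rw [hω1, norm_neg, norm_one])
    refine ⟨ω, hω2, fun x hx ↦ ?_⟩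
    calc ‖g x - ω * f x‖ = ‖g x / f x - ω‖ * ‖f x‖ := by
          rw [← norm_mul, sub_mul, div_mul_cancel₀ _ (hfx x hx)]
      _ ≤ 2 * ‖ω‖ / N * F := by
        gcongr
        exacts [hω x hx, hF x]
      _ = 2 * F / N := by rw [hω2]; ring
  have hq : ∀ x, (∏ i ∈ t₀, (g - algebraMap ℂ C(X, ℂ) (c i))) x = ∏ i ∈ t₀, (g x - c i) :=
    fun x ↦ by simp [ContinuousMap.prod_apply]
  refine ⟨∏ i ∈ t₀, (g - algebraMap ℂ C(X, ℂ) (c i)),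
    prod_mem fun i _ ↦ sub_mem hg (S.algebraMap_mem _), fun x ↦ ?_, fun x hx ↦ ?_,
    fun y hy ↦ ?_⟩
  · rw [hq, norm_prod, hm, ← Finset.prod_const]
    exact Finset.prod_le_prod (fun _ _ ↦ norm_nonneg _)
      fun i hi ↦ (norm_sub_le _ _).trans (add_le_add (hgD x) (hc1 i hi))
  · obtain ⟨i, hi, hxi⟩ := hVK x hx
    have h3 := norm_prod_sub_sub_prod_sub_le t₀ c hc1 (hgD x)
      (show ‖c i‖ ≤ F + 2 by linarith [hc1 i hi])
    rw [show ∏ j ∈ t₀, (c i - c j) = 0 from Finset.prod_eq_zero hi (sub_self (c i)),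
      sub_zero] at h3
    rw [hq]
    calc _ ≤ L * ‖g x - c i‖ := h3
      _ ≤ L * (2 / N) := by gcongr; exact (hc i hi).2 x hxi
      _ ≤ ε := by rw [mul_div_assoc']; exact e5
  · obtain ⟨hyW, -, hWU⟩ := hW y hy
    obtain ⟨ω, hω1, hω⟩ := hω y hy
    have hgy : 1 + β ≤ ‖g y‖ := by
      have h3 : (1 + b) / 2 < ‖f y‖ := (hWU hyW).1
      have h4 := norm_le_norm_add_norm_sub (g y) (ω * f y)
      rw [norm_mul, hω1, one_mul] at h4
      have h5 := (hω y hyW).trans e3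
      rw [hβ] at *
      linarith
    refine ⟨?_, fun x hx ↦ ?_⟩
    · rw [hq, norm_prod, hη, hm, ← Finset.prod_const]
      refine Finset.prod_le_prod (fun _ _ ↦ hβ0.le) fun i hi ↦ ?_
      linarith [norm_sub_norm_le (g y) (c i), hc1 i hi]
    · rw [hq, hq]
      have h3 : ‖g x - g y‖ ≤ σ + 4 * F / N := by
        have h4 : ‖f x - f y‖ < σ := (hWU hx).2
        calc ‖g x - g y‖ = ‖(g x - ω * f x) - (g y - ω * f y) + ω * (f x - f y)‖ := by ring_nf
          _ ≤ 2 * F / N + 2 * F / N + ‖ω * (f x - f y)‖ := by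
            refine (norm_add_le _ _).trans ?_
            gcongr
            exact (norm_sub_le _ _).trans (add_le_add (hω x hx) (hω y hyW))
          _ ≤ 2 * F / N + 2 * F / N + σ := by
            rw [norm_mul, hω1, one_mul]
            gcongr
          _ = _ := by ring
      calc _ ≤ L * ‖g x - g y‖ := norm_prod_sub_sub_prod_sub_le t₀ c hc1 (hgD x) (hgD y)
        _ ≤ L * (σ + 4 * F / N) := by gcongr
        _ = L * σ + L * (4 * F) / N := by ring
        _ ≤ η / 8 + η / 8 := add_le_add hLσ e4
        _ = η / 4 := by ring

theorem exists_separating_of_lt_one_of_one_lt {X : Type*} [TopologicalSpace X] [CompactSpace X]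
    [LocallyConnectedSpace X] {S : Subalgebra ℂ C(X, ℂ)}
    (hS : ∀ f ∈ S, ∀ (n : ℕ) (τ : ℝ), 0 < τ → ∃ g ∈ S, ∀ x, ‖g x ^ 2 ^ n - f x‖ ≤ τ)
    {f : C(X, ℂ)} (hf : f ∈ S) {a b : ℝ} (ha0 : 0 ≤ a) (ha : a < 1) (hb : 1 < b)
    {ε : ℝ} (hε : 0 < ε) (hε1 : ε ≤ 1) :
    ∃ k ∈ S, (∀ x, ‖k x‖ ≤ 2) ∧ (∀ x, ‖f x‖ ≤ a → ‖k x‖ ≤ ε) ∧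
      ∀ x, b ≤ ‖f x‖ → ‖k x - 1‖ ≤ ε := by
  obtain ⟨D, η, t, W, hη0, hW, hWK, hq⟩ := exists_collapse hS hf ha0 ha hb
  obtain ⟨T, hT⟩ := exists_uniform_norm_pow_sub_one_le t (half_pos hε)
  obtain ⟨δ, hδ0, hδ1, hδ⟩ := exists_norm_pow_sub_pow_le T (half_pos hε)
  have h2 : Tendsto (fun n : ℕ ↦ 2 ^ n) atTop (atTop : Filter ℕ) :=
    tendsto_pow_atTop_atTop_of_one_lt one_lt_two
  have e1 : ∀ᶠ p : ℕ in atTop, 4 / ((2 ^ p : ℕ) : ℝ) < δ / 2 := h2.eventually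
    ((tendsto_const_div_atTop_nhds_zero_nat 4).eventually_lt_const (half_pos hδ0))
  have e2 : ∀ᶠ p : ℕ in atTop, D + 1 ≤ (1 + δ / 2) ^ (2 ^ p) := h2.eventually
    ((tendsto_pow_atTop_atTop_of_one_lt (by linarith)).eventually_ge_atTop _)
  have e3 : ∀ᶠ p : ℕ in atTop, (1 - δ / 2) ^ (2 ^ p) < η := h2.eventually
    ((tendsto_pow_atTop_nhds_zero_of_lt_one (by linarith) (by linarith)).eventually_lt_const hη0)
  obtain ⟨p, e1, e2, e3⟩ := (e1.and (e2.and e3)).exists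
  set M := 2 ^ p with hM
  have hM0 : M ≠ 0 := by positivity
  obtain ⟨q, hqS, hqD, hqa, hqt⟩ := hq (ε ^ M / 2) (by positivity)
  obtain ⟨r, hrS, hr⟩ := hS q hqS p (min (min (η / 4) (ε ^ M / 2)) 1) (by positivity)
  have hr1 : ∀ x, ‖r x ^ M - q x‖ ≤ η / 4 := fun x ↦
    (hr x).trans ((min_le_left _ _).trans (min_le_left _ _))
  have hr2 : ∀ x, ‖r x ^ M - q x‖ ≤ ε ^ M / 2 := fun x ↦
    (hr x).trans ((min_le_left _ _).trans (min_le_right _ _))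
  have hr3 : ∀ x, ‖r x ^ M - q x‖ ≤ 1 := fun x ↦ (hr x).trans (min_le_right _ _)
  have hrM : ∀ x, ‖r x‖ ^ M ≤ ‖q x‖ + ‖r x ^ M - q x‖ := fun x ↦ by
    rw [← norm_pow]
    exact norm_le_norm_add_norm_sub' _ _
  have hrD : ∀ x, ‖r x‖ ≤ 1 + δ / 2 := fun x ↦ le_of_pow_le_pow_left₀ hM0 (by positivity)
    (((hrM x).trans (add_le_add (hqD x) (hr3 x))).trans e2)
  have hs : ∀ y : t, ∃ s : ℂ, ‖s‖ = 1 ∧ ∀ x ∈ W y, ‖r x - s‖ ≤ δ := fun ⟨y, hy⟩ ↦ by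
    obtain ⟨hyη, hWq⟩ := hqt y hy
    have hqy : q y ≠ 0 := norm_pos_iff.1 (hη0.trans_le hyη)
    obtain ⟨ξ, hξ, hξW⟩ := (hW y hy).2.exists_root_near (u := r) (by fun_prop) hM0 hqy
      fun x hx ↦ by
        calc ‖r x ^ M - q y‖ = ‖(r x ^ M - q x) + (q x - q y)‖ := by ring_nf
          _ ≤ η / 4 + η / 4 := (norm_add_le _ _).trans (add_le_add (hr1 x) (hWq x hx))
          _ ≤ ‖q y‖ / 2 := by linarith
    have hξM : ‖ξ‖ ^ M = ‖q y‖ := by rw [← norm_pow, hξ]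
    have hξ1 : ‖ξ‖ ≤ 1 + δ / 2 := le_of_pow_le_pow_left₀ hM0 (by positivity) (by
      rw [hξM]
      linarith [hqD y])
    have hξ2 : 1 - δ / 2 ≤ ‖ξ‖ := le_of_pow_le_pow_left₀ hM0 (norm_nonneg _) (by
      rw [hξM]
      linarith)
    have hξ0 : (‖ξ‖ : ℂ) ≠ 0 := by
      rw [Complex.ofReal_ne_zero]
      linarith
    have hξs : ‖ξ - ξ / ‖ξ‖‖ ≤ δ / 2 := by
      have h3 : ξ - ξ / ‖ξ‖ = ξ / ‖ξ‖ * ((‖ξ‖ - 1 : ℝ) : ℂ) := by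
        push_cast
        field_simp
      have h4 : ‖ξ / ‖ξ‖‖ = 1 := by
        rw [norm_div, Complex.norm_real, norm_norm, div_self (by linarith)]
      rw [h3, norm_mul, h4, one_mul, Complex.norm_real, Real.norm_eq_abs, abs_le]
      constructor <;> linarith
    refine ⟨ξ / ‖ξ‖, ?_, fun x hx ↦ ?_⟩
    · rw [norm_div, Complex.norm_real, norm_norm, div_self (by linarith)]
    · have h3 : 2 * ‖ξ‖ / M ≤ 4 / M := by
        gcongr
        linarith
      linarith [norm_sub_le_norm_sub_add_norm_sub (r x) ξ (ξ / ‖ξ‖), hξW x hx]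
  choose s hs1 hs using hs
  obtain ⟨n, hn0, hnT, hn⟩ := hT s hs1
  refine ⟨r ^ n, pow_mem hrS n, fun x ↦ ?_, fun x hx ↦ ?_, fun x hx ↦ ?_⟩
  · have h3 := hδ n hnT ((1 + δ / 2 : ℝ) : ℂ) 1 (by simp) (by
      push_cast
      rw [add_sub_cancel_left, ← Complex.ofReal_ofNat, ← Complex.ofReal_div, Complex.norm_real,
        Real.norm_of_nonneg (by positivity)]
      linarith)
    have h4 := norm_le_norm_add_norm_sub' (((1 + δ / 2 : ℝ) : ℂ) ^ n) (1 ^ n)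
    rw [norm_pow, Complex.norm_real, Real.norm_of_nonneg (by positivity), one_pow, norm_one] at h4
    rw [one_pow] at h3
    calc ‖(r ^ n) x‖ = ‖r x‖ ^ n := by simp
      _ ≤ (1 + δ / 2) ^ n := by gcongr; exact hrD x
      _ ≤ 2 := by linarith
  · have h3 : ‖r x‖ ≤ ε := le_of_pow_le_pow_left₀ hM0 hε.le (by
      linarith [hrM x, hqa x hx, hr2 x])
    calc ‖(r ^ n) x‖ = ‖r x‖ ^ n := by simp
      _ ≤ ε ^ n := by gcongr
      _ ≤ ε := pow_le_of_le_one hε.le hε1 hn0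
  · obtain ⟨y, hy, hxy⟩ := hWK x hx
    have h3 := hδ n hnT (r x) (s ⟨y, hy⟩) (hs1 _).le (hs ⟨y, hy⟩ x hxy)
    have h4 := hn ⟨y, hy⟩
    calc ‖(r ^ n) x - 1‖ = ‖(r x ^ n - s ⟨y, hy⟩ ^ n) + (s ⟨y, hy⟩ ^ n - 1)‖ := by simp
      _ ≤ ε / 2 + ε / 2 := (norm_add_le _ _).trans (add_le_add h3 h4)
      _ = ε := add_halves ε

/-- An algebra with approximate roots contains functions bounded by `2` that are close to `0` on
`{‖f‖ ≤ a}` and close to `1` on `{b ≤ ‖f‖}`. -/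
theorem exists_separating {X : Type*} [TopologicalSpace X] [CompactSpace X]
    [LocallyConnectedSpace X] {S : Subalgebra ℂ C(X, ℂ)}
    (hS : ∀ f ∈ S, ∀ (n : ℕ) (τ : ℝ), 0 < τ → ∃ g ∈ S, ∀ x, ‖g x ^ 2 ^ n - f x‖ ≤ τ)
    {f : C(X, ℂ)} (hf : f ∈ S) {a b : ℝ} (ha : 0 ≤ a) (hab : a < b)
    {ε : ℝ} (hε : 0 < ε) (hε1 : ε ≤ 1) :
    ∃ k ∈ S, (∀ x, ‖k x‖ ≤ 2) ∧ (∀ x, ‖f x‖ ≤ a → ‖k x‖ ≤ ε) ∧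
      ∀ x, b ≤ ‖f x‖ → ‖k x - 1‖ ≤ ε := by
  set ρ : ℝ := (a + b) / 2 with hρ
  have hρ0 : 0 < ρ := by linarith
  have hnorm : ∀ x, ‖(((ρ⁻¹ : ℝ) : ℂ) • f) x‖ = ‖f x‖ / ρ := fun x ↦ by
    rw [ContinuousMap.smul_apply, norm_smul, Complex.norm_real,
      Real.norm_of_nonneg (inv_nonneg.2 hρ0.le), inv_mul_eq_div]
  obtain ⟨k, hk, hk2, hka, hkb⟩ := exists_separating_of_lt_one_of_one_lt hS
    (S.smul_mem hf ((ρ⁻¹ : ℝ) : ℂ)) (a := a / ρ) (b := b / ρ) (by positivity)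
    (by rw [div_lt_one hρ0]; linarith) (by rw [one_lt_div hρ0]; linarith) hε hε1
  refine ⟨k, hk, hk2, fun x hx ↦ hka x ?_, fun x hx ↦ hkb x ?_⟩ <;>
  · rw [hnorm]
    gcongr

theorem exists_norm_sub_norm_le {X : Type*} [TopologicalSpace X] [CompactSpace X]
    [LocallyConnectedSpace X] {S : Subalgebra ℂ C(X, ℂ)}
    (hS : ∀ f ∈ S, ∀ (n : ℕ) (τ : ℝ), 0 < τ → ∃ g ∈ S, ∀ x, ‖g x ^ 2 ^ n - f x‖ ≤ τ)
    {f : C(X, ℂ)} (hf : f ∈ S) {ε : ℝ} (hε : 0 < ε) :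
    ∃ h ∈ S, ∀ x, ‖h x - (‖f x‖ : ℂ)‖ ≤ ε := by
  have hF : ∀ x, ‖f x‖ ≤ ‖f‖ := f.norm_coe_le_norm
  have hF0 : 0 ≤ ‖f‖ := norm_nonneg f
  set F := ‖f‖
  obtain ⟨n, hn⟩ := exists_nat_gt (5 * (F + 1) / ε)
  have hn0 : (0 : ℝ) < n := lt_of_le_of_lt (by positivity) hn
  have hn1 : (1 : ℝ) ≤ n := by exact_mod_cast hn0
  set δ : ℝ := (F + 1) / n with hδ
  have hδ0 : 0 < δ := by positivity
  have hδε : 5 * δ ≤ ε := by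
    rw [div_lt_iff₀ hε] at hn
    rw [hδ, mul_div_assoc', div_le_iff₀ hn0]
    linarith
  choose k hk hk2 hka hkb using fun i : ℕ ↦ exists_separating hS hf
    (a := i * δ) (b := (i + 1) * δ) (by positivity) (by nlinarith) (ε := (1 : ℝ) / n)
    (by positivity) (by rw [div_le_one hn0]; exact hn1)
  refine ⟨(δ : ℂ) • ∑ i ∈ Finset.range n, k i, S.smul_mem (sum_mem fun i _ ↦ hk i) _,
    fun x ↦ ?_⟩
  set j := ⌊‖f x‖ / δ⌋₊ with hj
  have hj1 : j * δ ≤ ‖f x‖ := by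
    rw [← le_div_iff₀ hδ0]
    exact Nat.floor_le (by positivity)
  have hj2 : ‖f x‖ < (j + 1) * δ := by
    rw [← div_lt_iff₀ hδ0]
    exact Nat.lt_floor_add_one _
  have hjn : j ≤ n := by
    have h1 : (j : ℝ) * δ ≤ n * δ := by
      rw [hδ, mul_div_cancel₀ _ hn0.ne', ← hδ]
      linarith [hF x]
    exact_mod_cast le_of_mul_le_mul_right h1 hδ0
  have hterm : ∀ i, ‖k i x - if i < j then 1 else 0‖ ≤ 1 / n + if i = j then 2 else 0 := fun i ↦ by
    rcases lt_trichotomy i j with h | h | h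
    · rw [if_pos h, if_neg h.ne, add_zero]
      refine hkb i x (le_trans ?_ hj1)
      gcongr
      exact_mod_cast h
    · rw [if_neg h.not_lt, if_pos h, sub_zero]
      linarith [hk2 i x, one_div_pos.2 hn0]
    · rw [if_neg h.not_gt, if_neg h.ne', sub_zero, add_zero]
      refine hka i x (hj2.le.trans ?_)
      gcongr
      exact_mod_cast h
  have hcount : ∑ i ∈ Finset.range n, (if i < j then (1 : ℂ) else 0) = j := by
    rw [← Finset.sum_filter, Finset.sum_const, nsmul_one]
    congr 1
    rw [show (Finset.range n).filter (· < j) = Finset.range j by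
      ext i
      simp only [Finset.mem_filter, Finset.mem_range]
      omega, Finset.card_range]
  have hsum : ‖∑ i ∈ Finset.range n, k i x - (j : ℂ)‖ ≤ 3 := by
    rw [← hcount, ← Finset.sum_sub_distrib]
    calc _ ≤ ∑ i ∈ Finset.range n, (1 / (n : ℝ) + if i = j then 2 else 0) :=
          norm_sum_le_of_le _ fun i _ ↦ hterm i
      _ ≤ 1 + 2 := by
        rw [Finset.sum_add_distrib, Finset.sum_ite_eq']
        gcongr
        · simp [hn0.ne']
        · split_ifs <;> norm_num
      _ = 3 := by norm_num
  have hreal : ‖((j * δ - ‖f x‖ : ℝ) : ℂ)‖ ≤ δ := by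
    rw [Complex.norm_real, Real.norm_eq_abs, abs_le]
    constructor <;> linarith
  calc _ = ‖(δ : ℂ) * (∑ i ∈ Finset.range n, k i x - (j : ℂ)) + ((j * δ - ‖f x‖ : ℝ) : ℂ)‖ := by
        congr 1
        simp only [ContinuousMap.smul_apply, ContinuousMap.sum_apply, smul_eq_mul]
        push_cast
        ring
    _ ≤ δ * 3 + δ := by
      refine (norm_add_le _ _).trans (add_le_add ?_ hreal)
      rw [norm_mul, Complex.norm_real, Real.norm_of_nonneg hδ0.le]
      gcongr
    _ ≤ ε := by linarith

theorem Subalgebra.exists_pow_two_pow_near {X : Type*} [TopologicalSpace X] [CompactSpace X]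
    {S : Subalgebra ℂ C(X, ℂ)} (hsq : ∀ f ∈ S, f ∈ closure ((· ^ 2) '' (S : Set C(X, ℂ)))) :
    ∀ f ∈ S, ∀ (n : ℕ) (τ : ℝ), 0 < τ → ∃ g ∈ S, ∀ x, ‖g x ^ 2 ^ n - f x‖ ≤ τ := by
  have h : ∀ n : ℕ, (S : Set C(X, ℂ)) ⊆ closure ((· ^ 2 ^ n) '' (S : Set C(X, ℂ))) := fun n ↦ by
    induction n with
    | zero => simpa using subset_closure
    | succ n ih =>
      refine fun f hf ↦ closure_minimal ?_ isClosed_closure (hsq f hf)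
      rintro _ ⟨g, hg, rfl⟩
      refine map_mem_closure (f := fun l : C(X, ℂ) ↦ l ^ 2) (continuous_pow 2) (ih hg) ?_
      rintro _ ⟨l, hl, rfl⟩
      exact ⟨l, hl, by simp only [pow_succ (2 : ℕ) n, pow_mul]⟩
  intro f hf n τ hτ
  obtain ⟨_, ⟨g, hg, rfl⟩, hgf⟩ := Metric.mem_closure_iff.1 (h n hf) τ hτ
  refine ⟨g, hg, fun x ↦ ?_⟩
  rw [dist_comm, dist_eq_norm] at hgf
  exact ((g ^ 2 ^ n - f).norm_coe_le_norm x).trans hgf.le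

/-- **Čirka's theorem**: on a locally connected compact space, a closed point-separating
subalgebra of continuous functions whose squares are dense in it contains every continuous
function. -/
theorem Subalgebra.eq_top_of_dense_squares {X : Type*} [TopologicalSpace X] [CompactSpace X]
    [LocallyConnectedSpace X] {S : Subalgebra ℂ C(X, ℂ)} (hcl : IsClosed (S : Set C(X, ℂ)))
    (hsep : S.SeparatesPoints)
    (hsq : ∀ f ∈ S, f ∈ closure ((· ^ 2) '' (S : Set C(X, ℂ)))) : S = ⊤ := by
  have habs : ∀ f ∈ S, (⟨fun x ↦ (‖f x‖ : ℂ), by fun_prop⟩ : C(X, ℂ)) ∈ S := fun f hf ↦ by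
    refine hcl.closure_subset (Metric.mem_closure_iff.2 fun ε hε ↦ ?_)
    obtain ⟨h, hhS, hh⟩ := exists_norm_sub_norm_le (exists_pow_two_pow_near hsq) hf (half_pos hε)
    refine ⟨h, hhS, ?_⟩
    rw [dist_comm, dist_eq_norm]
    exact ((ContinuousMap.norm_le _ (half_pos hε).le).2 hh).trans_lt (half_lt_self hε)
  have hstar : ∀ f ∈ S, star f ∈ S := fun f hf ↦ by
    have h := sub_mem (sub_mem (sub_mem (pow_mem (habs _ (add_mem hf (one_mem S))) 2)
      (pow_mem (habs f hf) 2)) (one_mem S)) hf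
    convert h using 1
    ext x
    have key : ∀ z : ℂ, star z = (‖z + 1‖ : ℂ) ^ 2 - (‖z‖ : ℂ) ^ 2 - 1 - z := fun z ↦ by
      rw [← Complex.conj_mul', ← Complex.conj_mul', map_add, map_one, Complex.star_def]
      ring
    simpa using key (f x)
  let S' : StarSubalgebra ℂ C(X, ℂ) := { S with star_mem' := fun {f} hf ↦ hstar f hf }
  have hS' := ContinuousMap.starSubalgebra_topologicalClosure_eq_top_of_separatesPoints S' hsep
  refine eq_top_iff.2 fun f _ ↦ hcl.closure_subset ?_
  have hf : f ∈ S'.topologicalClosure := hS' ▸ StarSubalgebra.mem_top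
  exact hf

theorem WeakDual.continuous_gelfandTransform (A : Type*) [NormedCommRing A] [NormedAlgebra ℂ A]
    [CompleteSpace A] : Continuous (gelfandTransform ℂ A) :=
  AddMonoidHomClass.continuous_of_bound (gelfandTransform ℂ A) ‖(1 : A)‖ fun a ↦
    (ContinuousMap.norm_le _ (by positivity)).2 fun φ ↦ by
      rw [mul_comm]
      exact AlgHom.norm_apply_le_self_mul_norm_one φ a

/-- If `A` is a commutative unital Banach algebra with dense invertibles and dense squares
whose maximal ideal space is locally connected, then the Gelfand transforms of elements
of `A` are uniformly dense in `C(𝔐_A, ℂ)`. -/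
theorem stmt_14 (A : Type*) [NormedCommRing A] [NormedAlgebra ℂ A] [CompleteSpace A]
    (hd : Dense {a : A | IsUnit a}) (hsq : Dense {a : A | ∃ b : A, a = b ^ 2})
    (hlc : LocallyConnectedSpace (WeakDual.characterSpace ℂ A)) :
    Dense (Set.range (fun a : A => WeakDual.gelfandTransform ℂ A a)) := by
  let S := (WeakDual.gelfandTransform ℂ A).range.topologicalClosure
  have hcoe : (S : Set C(WeakDual.characterSpace ℂ A, ℂ)) =
      closure (Set.range fun a : A ↦ WeakDual.gelfandTransform ℂ A a) := by
    simp [S, Subalgebra.topologicalClosure_coe, AlgHom.coe_range]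
  have hmem : ∀ a, WeakDual.gelfandTransform ℂ A a ∈ S := fun a ↦
    Subalgebra.le_topologicalClosure _ ⟨a, rfl⟩
  have htop : S = ⊤ := by
    refine Subalgebra.eq_top_of_dense_squares (Subalgebra.isClosed_topologicalClosure _) ?_ ?_
    · intro φ ψ hne
      obtain ⟨a, ha⟩ := DFunLike.ne_iff.1 hne
      exact ⟨_, ⟨_, hmem a, rfl⟩, ha⟩
    · intro f hf
      replace hf : f ∈ closure (Set.range fun a : A ↦ WeakDual.gelfandTransform ℂ A a) := hcoe ▸ hf
      refine closure_minimal ?_ isClosed_closure hf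
      rintro _ ⟨a, rfl⟩
      refine map_mem_closure (WeakDual.continuous_gelfandTransform A) (hsq a) ?_
      rintro _ ⟨b, rfl⟩
      exact ⟨_, hmem b, (map_pow _ _ _).symm⟩
  rw [dense_iff_closure_eq, ← hcoe, htop, Algebra.coe_top]
end
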